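/- arXiv:q-alg/9704004 — 2 statements merged into one kernel-verified Lean document; each statement's English description precedes it below -/
import Mathlib

section
/- Let f be a holomorphic function on the upper half plane ℍ with f(z+1) = f(z) for all z, whose Fourier expansion is f(z) = 1 + Σ_{n≥1} c_n·q^n with integer coefficients c_n, where q = exp(2πiz). Then there exists a unique sequence (a(n))_{n≥1} of integers such that for all z ∈ ℍ with sufficiently large imaginary part (equivalently, sufficiently small |q|) the product ∏_{n≥1}(1−q^n)^{a(n)} converges and equals f(z). -/
open Complex Filter Topology UpperHalfPlane
open scoped Real Manifold

noncomputable section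

namespace PE
open PowerSeries

/-- The unit `1 - X^(k+1)` of `ℤ⟦X⟧`. -/
def u (k : ℕ) : (PowerSeries ℤ)ˣ where
  val := 1 - X ^ (k+1)
  inv := PowerSeries.mk (fun n => if (k+1) ∣ n then 1 else 0)
  val_inv := by
    rw [mul_comm]
    ext n
    rw [mul_sub, mul_one, map_sub, coeff_mul_X_pow', coeff_mk, coeff_one]
    by_cases h : k + 1 ≤ n
    · have h1 : n ≠ 0 := by omega
      have h2 : (k + 1 ∣ n - (k+1)) ↔ (k + 1 ∣ n) := by
        rw [Nat.dvd_sub_iff_left h (dvd_refl _)]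
      simp [h, h1, h2]
    · by_cases h1 : n = 0
      · simp [h1]
      · have : ¬ (k + 1 ∣ n) := fun hd => h (Nat.le_of_dvd (by omega) hd)
        simp [h, h1, this]
  inv_val := by
    ext n
    rw [mul_sub, mul_one, map_sub, coeff_mul_X_pow', coeff_mk, coeff_one]
    by_cases h : k + 1 ≤ n
    · have h1 : n ≠ 0 := by omega
      have h2 : (k + 1 ∣ n - (k+1)) ↔ (k + 1 ∣ n) := by
        rw [Nat.dvd_sub_iff_left h (dvd_refl _)]
      simp [h, h1, h2]
    · by_cases h1 : n = 0
      · simp [h1]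
      · have : ¬ (k + 1 ∣ n) := fun hd => h (Nat.le_of_dvd (by omega) hd)
        simp [h, h1, this]

lemma u_val (k : ℕ) : (u k : PowerSeries ℤ) = 1 - X ^ (k+1) := rfl
lemma u_inv (k : ℕ) : ((u k)⁻¹ : (PowerSeries ℤ)ˣ).val =
  PowerSeries.mk (fun n => if (k+1) ∣ n then 1 else 0) := rfl

/-- First-order expansion of the powers. -/
lemma u_zpow (k : ℕ) (e : ℤ) :
    (X : PowerSeries ℤ) ^ (k + 2) ∣ ((u k ^ e : (PowerSeries ℤ)ˣ) : PowerSeries ℤ)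
      - (1 - (e : PowerSeries ℤ) * X ^ (k+1)) := by
  induction e using Int.induction_on with
  | zero => simp
  | succ i ih =>
    obtain ⟨R, hR⟩ := ih
    refine ⟨R * (u k : PowerSeries ℤ) + (i : PowerSeries ℤ) * X ^ k, ?_⟩
    have h2 := eq_add_of_sub_eq hR
    rw [zpow_add_one, Units.val_mul, h2, u_val]
    push_cast
    ring
  | pred i ih =>
    obtain ⟨R, hR⟩ := ih
    have h2 := eq_add_of_sub_eq hR
    have key : (u k : PowerSeries ℤ) * (((u k ^ (-(i:ℤ) - 1) : (PowerSeries ℤ)ˣ) : PowerSeries ℤ)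
      - (1 - ((-(i:ℤ) - 1 : ℤ) : PowerSeries ℤ) * X ^ (k+1)))
       = X ^ (k+2) * (R - ((i:PowerSeries ℤ) + 1) * (-X ^ k)) := by
      have h3 : (u k : PowerSeries ℤ) * ((u k ^ (-(i:ℤ) - 1) : (PowerSeries ℤ)ˣ) : PowerSeries ℤ)
          = ((u k ^ (-(i:ℤ)) : (PowerSeries ℤ)ˣ) : PowerSeries ℤ) := by
        rw [← Units.val_mul, ← zpow_one_add]
        congr 2
        ring
      rw [mul_sub, h3, h2, u_val]
      push_cast
      ring
    exact (Units.dvd_mul_left).1 ⟨_, key⟩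

/-- The logarithmic derivative `X * d/dX` relation. -/
def LD (p l : PowerSeries ℤ) : Prop := X * derivative ℤ p = p * l

lemma LD.mul {p l p' l' : PowerSeries ℤ} (h : LD p l) (h' : LD p' l') : LD (p * p') (l + l') := by
  unfold LD at *
  rw [Derivation.leibniz, smul_eq_mul, smul_eq_mul]
  linear_combination p' * h + p * h'

lemma LD.cancel {p l p' l' : PowerSeries ℤ} (hp : IsUnit p) (h : LD p l)
    (h' : LD (p * p') l') : LD p' (l' - l) := by
  unfold LD at *
  rw [Derivation.leibniz, smul_eq_mul, smul_eq_mul] at h'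
  apply hp.mul_left_cancel
  linear_combination h' - p' * h

/-- logarithmic derivative of `u k`. -/
def lu (k : ℕ) : PowerSeries ℤ :=
  ((u k)⁻¹ : (PowerSeries ℤ)ˣ).val * X ^ (k+1) * ((-((k:ℤ)+1) : ℤ) : PowerSeries ℤ)

lemma LD_u (k : ℕ) : LD (u k) (lu k) := by
  unfold LD lu
  rw [← mul_assoc, ← mul_assoc, Units.mul_inv, u_val, map_sub, Derivation.leibniz_pow]
  simp
  ring

lemma LD_u_zpow (k : ℕ) (e : ℤ) : LD (u k ^ e : (PowerSeries ℤ)ˣ) ((e : PowerSeries ℤ) * lu k) := by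
  induction e using Int.induction_on with
  | zero => simp [LD]
  | succ i ih =>
    have := ih.mul (LD_u k)
    rw [← Units.val_mul, ← zpow_add_one] at this
    convert this using 1
    push_cast; ring
  | pred i ih =>
    have : LD ((u k : PowerSeries ℤ) * (u k ^ (-(i:ℤ) - 1) : (PowerSeries ℤ)ˣ)) (((-(i:ℤ) : ℤ) : PowerSeries ℤ) * lu k) := by
      rw [← Units.val_mul, ← zpow_one_add]
      have h : (1 + (-(i:ℤ) - 1)) = -(i:ℤ) := by ring
      rw [h]; exact ih
    have := LD.cancel (u k).isUnit (LD_u k) this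
    convert this using 1
    push_cast; ring

lemma lu_coeff (k n : ℕ) : |coeff n (lu k)| ≤ (k:ℤ) + 1 := by
  unfold lu
  rw [mul_comm, ← zsmul_eq_mul, map_zsmul, coeff_mul_X_pow', u_inv, coeff_mk]
  split_ifs <;> simp
  · rw [abs_of_nonpos] <;> omega
  · omega
  · omega

lemma lu_coeff0 (k : ℕ) : coeff 0 (lu k) = 0 := by
  unfold lu
  simp

/-- The successive quotients. -/
def P (F : PowerSeries ℤ) : ℕ → PowerSeries ℤ
  | 0 => F
  | n + 1 => P F n * (u n ^ (coeff (n+1) (P F n)) : (PowerSeries ℤ)ˣ)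

/-- The exponents (negated). -/
def e (F : PowerSeries ℤ) (n : ℕ) : ℤ := coeff (n+1) (P F n)

lemma P_succ (F : PowerSeries ℤ) (n : ℕ) :
    P F (n+1) = P F n * (u n ^ (e F n) : (PowerSeries ℤ)ˣ) := rfl

lemma P_dvd (F : PowerSeries ℤ) (h0 : coeff 0 F = 1) (n : ℕ) :
    (X : PowerSeries ℤ) ^ (n+1) ∣ P F n - 1 := by
  induction n with
  | zero => simpa [P, X_dvd_iff, sub_eq_zero] using h0
  | succ n ih =>
    obtain ⟨Q, hQ⟩ := ih
    have hQ' := eq_add_of_sub_eq hQ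
    have he : e F n = constantCoeff Q := by
      unfold e
      rw [hQ', map_add, coeff_X_pow_mul']
      simp [coeff_one]
    obtain ⟨R, hR⟩ := u_zpow n (e F n)
    have hR' := eq_add_of_sub_eq hR
    have hQ2 : (X : PowerSeries ℤ) ∣ Q - (e F n : PowerSeries ℤ) := by
      rw [X_dvd_iff]; simp [he]
    obtain ⟨Q2, hQ2⟩ := hQ2
    have hQ2' := eq_add_of_sub_eq hQ2
    rw [P_succ, hQ', hR', hQ2']
    refine ⟨Q2 + R + X ^ (n+1) * R * (X * Q2 + (e F n : PowerSeries ℤ))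
      - (e F n : PowerSeries ℤ) * X ^ n * (X * Q2 + (e F n : PowerSeries ℤ)), ?_⟩
    ring

lemma P_LD (F L : PowerSeries ℤ) (hL : LD F L) (n : ℕ) :
    LD (P F n) (L + ∑ k ∈ Finset.range n, (e F k : PowerSeries ℤ) * lu k) := by
  induction n with
  | zero => simpa [P] using hL
  | succ n ih =>
    rw [P_succ, Finset.sum_range_succ, ← add_assoc]
    exact ih.mul (LD_u_zpow n _)

lemma coeff_intmul (a : ℤ) (p : PowerSeries ℤ) (n : ℕ) :
    coeff n ((a : PowerSeries ℤ) * p) = a * coeff n p := by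
  rw [← zsmul_eq_mul, map_zsmul, smul_eq_mul]

lemma e_rec (F L : PowerSeries ℤ) (h0 : coeff 0 F = 1) (hL : LD F L) (hL0 : coeff 0 L = 0) (n : ℕ) :
    ((n : ℤ) + 1) * e F n = coeff (n+1) L + ∑ k ∈ Finset.range n, e F k * coeff (n+1) (lu k) := by
  have h := P_LD F L hL n
  set S := L + ∑ k ∈ Finset.range n, (e F k : PowerSeries ℤ) * lu k with hS
  have hS0 : constantCoeff S = 0 := by
    rw [← coeff_zero_eq_constantCoeff_apply, hS, map_add, hL0, map_sum]
    simp [coeff_intmul, lu_coeff0, -coeff_zero_eq_constantCoeff]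
  have hS1 : coeff (n+1) S = coeff (n+1) L + ∑ k ∈ Finset.range n, e F k * coeff (n+1) (lu k) := by
    rw [hS, map_add, map_sum]
    simp [coeff_intmul]
  rw [← hS1]
  obtain ⟨Q, hQ⟩ := P_dvd F h0 n
  have hQ' := eq_add_of_sub_eq hQ
  have h2 := congrArg (coeff (n+1)) h
  rw [coeff_succ_X_mul, coeff_derivative] at h2
  have h3 : coeff (n+1) (P F n * S) = coeff (n+1) S := by
    rw [hQ', add_mul, map_add, mul_assoc, coeff_X_pow_mul']
    simp [hS0]
  rw [h3] at h2
  rw [← h2, e]; ring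

lemma L_exists (F : PowerSeries ℤ) (h0 : coeff 0 F = 1) : ∃ L, LD F L ∧ coeff 0 L = 0 := by
  have hu : F * invOfUnit F 1 = 1 := mul_invOfUnit F 1 (by simpa using h0)
  refine ⟨X * derivative ℤ F * invOfUnit F 1, ?_, by simp⟩
  unfold LD
  linear_combination (-(X * derivative ℤ F)) * hu

lemma geom4 (n : ℕ) : (2:ℝ) ^ (n+1) + ∑ k ∈ Finset.range (n+1), (4:ℝ) ^ k ≤ 4 ^ (n+1) := by
  induction n with
  | zero => norm_num
  | succ n ih =>
    rw [Finset.sum_range_succ, pow_succ, pow_succ 4 (n+1)]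
    have : (2:ℝ)^(n+1) ≤ 4^(n+1) := by gcongr; norm_num
    have h0 : (0:ℝ) ≤ 4^(n+1) := by positivity
    linarith

lemma L_bound (F L : PowerSeries ℤ) (h0 : coeff 0 F = 1) (hL : LD F L) (hL0 : coeff 0 L = 0)
    (M : ℝ) (hM1 : 1 ≤ M) (hM : ∀ n, |((coeff n F : ℤ) : ℝ)| ≤ M ^ n) (n : ℕ) :
    |((coeff n L : ℤ) : ℝ)| ≤ (4 * M) ^ n := by
  induction n using Nat.strong_induction_on with
  | _ n ih =>
  rcases n with _ | n
  · simp [-coeff_zero_eq_constantCoeff, hL0]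
  have h2 := congrArg (coeff (n+1)) hL
  rw [coeff_succ_X_mul, coeff_derivative, mul_comm F L, coeff_mul,
    Finset.Nat.sum_antidiagonal_eq_sum_range_succ (fun i j => coeff i L * coeff j F),
    Finset.sum_range_succ, Nat.sub_self, h0, mul_one] at h2
  have h3 : ((coeff (n+1) L : ℤ) : ℝ) = coeff (n+1) F * ((n:ℝ) + 1)
      - ∑ k ∈ Finset.range (n+1), ((coeff k L : ℤ) : ℝ) * coeff (n+1-k) F := by
    have := congrArg (fun z : ℤ => (z : ℝ)) h2
    push_cast at this
    linarith
  rw [h3]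
  have h4 : |∑ k ∈ Finset.range (n+1), ((coeff k L : ℤ) : ℝ) * coeff (n+1-k) F| ≤
      ∑ k ∈ Finset.range (n+1), M ^ (n+1) * 4 ^ k := by
    refine (Finset.abs_sum_le_sum_abs _ _).trans (Finset.sum_le_sum fun k hk => ?_)
    rw [Finset.mem_range] at hk
    rw [abs_mul]
    calc _ ≤ (4 * M) ^ k * M ^ (n+1-k) := by
          gcongr
          · exact ih k hk
          · exact hM _
      _ = M ^ (n+1) * 4 ^ k := by
          rw [mul_pow, mul_assoc, ← pow_add, mul_comm]; congr 2; omega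
  have h5 : |((coeff (n+1) F : ℤ) : ℝ) * ((n:ℝ) + 1)| ≤ M ^ (n+1) * 2 ^ (n+1) := by
    rw [abs_mul]
    gcongr
    · exact hM _
    · rw [abs_of_nonneg (by positivity)]
      exact_mod_cast (Nat.lt_two_pow_self (n := n+1)).le
  rw [← Finset.mul_sum] at h4
  calc _ ≤ _ := abs_sub _ _
    _ ≤ M ^ (n+1) * (2 ^ (n+1) + ∑ k ∈ Finset.range (n+1), (4:ℝ) ^ k) := by linarith
    _ ≤ M ^ (n+1) * 4 ^ (n+1) := by gcongr; exact geom4 n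
    _ = _ := by rw [mul_pow, mul_comm]

lemma geomB (B : ℝ) (hB : 1 ≤ B) (n : ℕ) :
    B ^ (n+1) + ∑ k ∈ Finset.range n, (2 * B) ^ (k+1) ≤ (2 * B) ^ (n+1) := by
  induction n with
  | zero => simp; linarith
  | succ n ih =>
    rw [Finset.sum_range_succ, pow_succ B, pow_succ (2*B) (n+1)]
    have h1 : B ^(n+1) ≤ (2*B)^(n+1) := by gcongr; linarith
    have h3 : 0 ≤ (2*B)^(n+1) := by positivity
    nlinarith

lemma e_bound (F : PowerSeries ℤ) (h0 : coeff 0 F = 1)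
    (M : ℝ) (hM1 : 1 ≤ M) (hM : ∀ n, |((coeff n F : ℤ) : ℝ)| ≤ M ^ n) (n : ℕ) :
    |(e F n : ℝ)| ≤ (8 * M) ^ (n+1) := by
  obtain ⟨L, hL, hL0⟩ := L_exists F h0
  have key : ∀ n : ℕ, ((n:ℝ)+1) * |(e F n : ℝ)| ≤ (2 * (4 * M)) ^ (n+1) := by
    intro n
    induction n using Nat.strong_induction_on with
    | _ n ih =>
    have h := congrArg (fun z : ℤ => (z : ℝ)) (e_rec F L h0 hL hL0 n)
    push_cast at h
    rw [← abs_of_nonneg (show (0:ℝ) ≤ (n:ℝ)+1 by positivity), ← abs_mul, h]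
    refine (abs_add_le _ _).trans (le_trans ?_ (geomB (4*M) (by linarith) n))
    gcongr ?_ + ?_
    · exact L_bound F L h0 hL hL0 M hM1 hM _
    refine (Finset.abs_sum_le_sum_abs _ _).trans (Finset.sum_le_sum fun k hk => ?_)
    rw [Finset.mem_range] at hk
    refine le_trans ?_ (ih k hk)
    rw [abs_mul, mul_comm]
    gcongr
    exact_mod_cast lu_coeff k (n+1)
  have := key n
  have h8 : 2 * (4 * M) = 8 * M := by ring
  rw [h8] at this
  refine le_trans ?_ this
  have : 0 ≤ (n:ℝ) * |(e F n : ℝ)| := by positivity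
  linarith

end PE

namespace PE
open PowerSeries

/-- Evaluation of an integral power series. -/
def ev (p : PowerSeries ℤ) (q : ℂ) : ℂ := ∑' n, ((coeff n p : ℤ) : ℂ) * q ^ n

/-- The weighted `ℓ¹` norm of `p` is at most `C`. -/
def Bd (r C : ℝ) (p : PowerSeries ℤ) : Prop :=
  Summable (fun n => |((coeff n p : ℤ) : ℝ)| * r ^ n) ∧
    ∑' n, |((coeff n p : ℤ) : ℝ)| * r ^ n ≤ C

lemma Bd.nonneg {r C : ℝ} {p : PowerSeries ℤ} (hr : 0 ≤ r) (h : Bd r C p) : 0 ≤ C :=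
  le_trans (tsum_nonneg fun n => by positivity) h.2

lemma Bd.mono {r C C' : ℝ} {p : PowerSeries ℤ} (h : Bd r C p) (hC : C ≤ C') : Bd r C' p :=
  ⟨h.1, h.2.trans hC⟩

lemma Bd.mul {r C C' : ℝ} {p p' : PowerSeries ℤ} (hr : 0 ≤ r) (h : Bd r C p) (h' : Bd r C' p') :
    Bd r (C * C') (p * p') := by
  have n1 : Summable (fun n => ‖|((coeff n p : ℤ) : ℝ)| * r ^ n‖) := h.1.norm
  have n2 : Summable (fun n => ‖|((coeff n p' : ℤ) : ℝ)| * r ^ n‖) := h'.1.norm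
  have hs := (summable_norm_sum_mul_antidiagonal_of_summable_norm n1 n2).of_norm
  have ht := tsum_mul_tsum_eq_tsum_sum_antidiagonal_of_summable_norm n1 n2
  have hle : ∀ n, |((coeff n (p * p') : ℤ) : ℝ)| * r ^ n ≤
      ∑ kl ∈ Finset.HasAntidiagonal.antidiagonal n,
        (|((coeff kl.1 p : ℤ) : ℝ)| * r ^ kl.1) * (|((coeff kl.2 p' : ℤ) : ℝ)| * r ^ kl.2) := by
    intro n
    rw [coeff_mul]
    push_cast
    calc _ ≤ (∑ kl ∈ Finset.HasAntidiagonal.antidiagonal n,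
        |((coeff kl.1 p : ℤ) : ℝ) * ((coeff kl.2 p' : ℤ) : ℝ)|) * r ^ n := by
          gcongr
          exact Finset.abs_sum_le_sum_abs _ _
      _ = _ := by
          rw [Finset.sum_mul]
          refine Finset.sum_congr rfl fun kl hkl => ?_
          rw [Finset.HasAntidiagonal.mem_antidiagonal] at hkl
          rw [← hkl, pow_add, abs_mul]; ring
  have hs2 := Summable.of_nonneg_of_le (fun n => by positivity) hle hs
  refine ⟨hs2, (hs2.tsum_le_tsum hle hs).trans ?_⟩
  rw [← ht]
  exact mul_le_mul h.2 h'.2 (tsum_nonneg fun n => by positivity) (h.nonneg hr)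

lemma Bd.summ {r C : ℝ} {p : PowerSeries ℤ} (h : Bd r C p) {q : ℂ} (hq : ‖q‖ ≤ r) :
    Summable (fun n => ‖((coeff n p : ℤ) : ℂ) * q ^ n‖) := by
  refine Summable.of_nonneg_of_le (fun n => norm_nonneg _) (fun n => ?_) h.1
  rw [norm_mul, norm_pow, Complex.norm_intCast]
  gcongr

lemma ev_mul {r C C' : ℝ} {p p' : PowerSeries ℤ} (h : Bd r C p) (h' : Bd r C' p')
    {q : ℂ} (hq : ‖q‖ ≤ r) : ev (p * p') q = ev p q * ev p' q := by
  unfold ev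
  rw [tsum_mul_tsum_eq_tsum_sum_antidiagonal_of_summable_norm (h.summ hq) (h'.summ hq)]
  refine tsum_congr fun n => ?_
  rw [coeff_mul]
  push_cast
  rw [Finset.sum_mul]
  refine Finset.sum_congr rfl fun kl hkl => ?_
  rw [Finset.HasAntidiagonal.mem_antidiagonal] at hkl
  rw [← hkl, pow_add]; ring

lemma ev_one (q : ℂ) : ev 1 q = 1 := by
  unfold ev
  rw [tsum_eq_single 0]
  · simp
  · intro n hn
    simp [coeff_one, hn]

lemma Bd_one (r : ℝ) : Bd r 1 1 := by
  have h : ∀ n, n ∉ ({0} : Finset ℕ) → |((coeff n (1 : PowerSeries ℤ) : ℤ) : ℝ)| * r ^ n = 0 := by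
    intro n hn
    have : n ≠ 0 := by simpa using hn
    simp [coeff_one, this]
  refine ⟨summable_of_ne_finset_zero h, ?_⟩
  rw [tsum_eq_sum h]
  simp

lemma Bd.pow {r C : ℝ} {p : PowerSeries ℤ} (hr : 0 ≤ r) (h : Bd r C p) (n : ℕ) :
    Bd r (C ^ n) (p ^ n) := by
  induction n with
  | zero => simpa using Bd_one r
  | succ n ih => rw [pow_succ, pow_succ]; exact ih.mul hr h

lemma ev_pow {r C : ℝ} {p : PowerSeries ℤ} (hr : 0 ≤ r) (h : Bd r C p) {q : ℂ} (hq : ‖q‖ ≤ r)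
    (n : ℕ) : ev (p ^ n) q = ev p q ^ n := by
  induction n with
  | zero => simpa using ev_one q
  | succ n ih => rw [pow_succ, pow_succ, ev_mul (h.pow hr n) h hq, ih]

lemma u_coeff (k n : ℕ) (hn : n ∉ ({0, k + 1} : Finset ℕ)) :
    coeff n ((u k : (PowerSeries ℤ)ˣ) : PowerSeries ℤ) = 0 := by
  have h : n ≠ 0 ∧ n ≠ k + 1 := by simpa using hn
  simp [u_val, coeff_one, coeff_X_pow, h.1, h.2]

lemma Bd_u {r : ℝ} (hr : 0 ≤ r) (hr1 : r < 1) (k : ℕ) : Bd r (1 - r ^ (k+1))⁻¹ (u k) := by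
  have h : ∀ n, n ∉ ({0, k+1} : Finset ℕ) →
      |((coeff n ((u k : (PowerSeries ℤ)ˣ) : PowerSeries ℤ) : ℤ) : ℝ)| * r ^ n = 0 := by
    intro n hn
    rw [u_coeff k n hn]; simp
  refine ⟨summable_of_ne_finset_zero h, ?_⟩
  rw [tsum_eq_sum h, Finset.sum_pair (by omega)]
  have h1 : r ^ (k+1) < 1 := pow_lt_one₀ hr hr1 (by omega)
  have h2 : 0 < 1 - r ^ (k+1) := by linarith
  have h3 : 0 ≤ r ^ (k+1) := by positivity
  rw [← one_div, le_div_iff₀ h2]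
  simp [u_val, coeff_one, coeff_X_pow]
  nlinarith

lemma ev_u (k : ℕ) (q : ℂ) : ev (u k) q = 1 - q ^ (k+1) := by
  have h : ∀ n, n ∉ ({0, k+1} : Finset ℕ) →
      ((coeff n ((u k : (PowerSeries ℤ)ˣ) : PowerSeries ℤ) : ℤ) : ℂ) * q ^ n = 0 := by
    intro n hn
    rw [u_coeff k n hn]; simp
  unfold ev
  rw [tsum_eq_sum h, Finset.sum_pair (by omega)]
  simp [u_val, coeff_one, coeff_X_pow]
  ring

lemma Bd_uinv {r : ℝ} (hr : 0 ≤ r) (hr1 : r < 1) (k : ℕ) :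
    Bd r (1 - r ^ (k+1))⁻¹ ((u k)⁻¹ : (PowerSeries ℤ)ˣ) := by
  have h1 : r ^ (k+1) < 1 := pow_lt_one₀ hr hr1 (by omega)
  have hg := hasSum_geometric_of_lt_one (by positivity) h1
  have hinj : Function.Injective (fun j : ℕ => (k+1) * j) := fun a b h => by simpa using h
  have : HasSum (fun n => |((coeff n (((u k)⁻¹ : (PowerSeries ℤ)ˣ) : PowerSeries ℤ) : ℤ) : ℝ)| * r ^ n)
      (1 - r ^ (k+1))⁻¹ := by
    rw [← hinj.hasSum_iff]
    · convert hg using 2 with j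
      simp [u_inv, pow_mul]
    · intro n hn
      have : ¬ (k+1 ∣ n) := fun ⟨j, hj⟩ => hn ⟨j, hj.symm⟩
      simp [u_inv, this]
  exact ⟨this.summable, this.tsum_eq.le⟩

lemma ev_uinv (k : ℕ) {q : ℂ} (hq : ‖q‖ < 1) :
    ev ((u k)⁻¹ : (PowerSeries ℤ)ˣ) q = (1 - q ^ (k+1))⁻¹ := by
  have h := ev_mul (Bd_u (norm_nonneg q) hq k) (Bd_uinv (norm_nonneg q) hq k) le_rfl
  rw [Units.mul_inv, ev_one, ev_u] at h
  exact eq_inv_of_mul_eq_one_right h.symm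

lemma u_zpow_ev {r : ℝ} (hr : 0 ≤ r) (hr1 : r < 1) (k : ℕ) (e : ℤ) :
    Bd r ((1 - r ^ (k+1))⁻¹ ^ e.natAbs) (u k ^ e : (PowerSeries ℤ)ˣ) ∧
    ∀ q : ℂ, ‖q‖ ≤ r → ev (u k ^ e : (PowerSeries ℤ)ˣ) q = (1 - q ^ (k+1)) ^ e := by
  obtain ⟨n, rfl | rfl⟩ := e.eq_nat_or_neg
  · simp only [zpow_natCast, Units.val_pow_eq_pow_val, Int.natAbs_natCast]
    refine ⟨(Bd_u hr hr1 k).pow hr n, fun q hq => ?_⟩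
    rw [ev_pow hr (Bd_u hr hr1 k) hq, ev_u]
  · simp only [zpow_neg, zpow_natCast, ← inv_pow, Units.val_pow_eq_pow_val, Int.natAbs_natCast,
      Int.natAbs_neg]
    refine ⟨(Bd_uinv hr hr1 k).pow hr n, fun q hq => ?_⟩
    rw [ev_pow hr (Bd_uinv hr hr1 k) hq, ev_uinv k (lt_of_le_of_lt hq hr1)]

lemma P_ev {r C : ℝ} (hr : 0 ≤ r) (hr1 : r < 1) (F : PowerSeries ℤ) (hF : Bd r C F) (n : ℕ) :
    Bd r (C * ∏ k ∈ Finset.range n, (1 - r ^ (k+1))⁻¹ ^ (e F k).natAbs) (P F n) ∧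
    ∀ q : ℂ, ‖q‖ ≤ r → ev (P F n) q =
      ev F q * ∏ k ∈ Finset.range n, (1 - q ^ (k+1)) ^ (e F k) := by
  induction n with
  | zero => simpa [P] using hF
  | succ n ih =>
    obtain ⟨h1, h2⟩ := u_zpow_ev hr hr1 n (e F n)
    refine ⟨?_, fun q hq => ?_⟩
    · rw [Finset.prod_range_succ, ← mul_assoc, P_succ]
      exact ih.1.mul hr h1
    · rw [Finset.prod_range_succ, ← mul_assoc, P_succ, ev_mul ih.1 h1 hq, ih.2 q hq, h2 q hq]

lemma inv_one_sub_le {x : ℝ} (h0 : 0 ≤ x) (h1 : x ≤ 1/2) : (1 - x)⁻¹ ≤ Real.exp (2 * x) := by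
  rw [inv_le_iff_one_le_mul₀ (by linarith)]
  have := Real.add_one_le_exp (2 * x)
  nlinarith

lemma geomhalf (n : ℕ) : ∑ k ∈ Finset.range n, ((1:ℝ)/2) ^ (k+1) ≤ 1 := by
  have : ∑ k ∈ Finset.range n, ((1:ℝ)/2) ^ (k+1) = 1 - (1/2)^n := by
    induction n with
    | zero => simp
    | succ n ih => rw [Finset.sum_range_succ, ih, pow_succ]; ring
  rw [this]
  have : (0:ℝ) ≤ (1/2)^n := by positivity
  linarith

lemma prod_bound (K : ℝ) (hK : 1 ≤ K) (b : ℕ → ℤ) (hb : ∀ n, |(b n : ℝ)| ≤ K ^ (n+1)) (n : ℕ) :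
    ∏ k ∈ Finset.range n, (1 - (1/(2*K)) ^ (k+1))⁻¹ ^ (b k).natAbs ≤ Real.exp 2 := by
  have hr0 : 0 ≤ 1/(2*K) := by positivity
  have hr : 1/(2*K) ≤ 1/2 := by
    apply one_div_le_one_div_of_le <;> linarith
  have hp : ∀ k : ℕ, (1/(2*K)) ^ (k+1) ≤ 1/2 := fun k =>
    (pow_le_of_le_one hr0 (by linarith) (by omega)).trans hr
  calc _ ≤ ∏ k ∈ Finset.range n, Real.exp (2 * ((1:ℝ)/2) ^ (k+1)) := by
        refine Finset.prod_le_prod (fun k _ => ?_) (fun k _ => ?_)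
        · have := hp k
          have : 0 ≤ 1 - (1/(2*K)) ^ (k+1) := by linarith
          positivity
        · have h2 : 0 ≤ 1 - (1/(2*K)) ^ (k+1) := by linarith [hp k]
          calc _ ≤ Real.exp (2 * (1/(2*K)) ^ (k+1)) ^ (b k).natAbs := by
                gcongr
                exact inv_one_sub_le (by positivity) (hp k)
            _ = Real.exp ((b k).natAbs * (2 * (1/(2*K)) ^ (k+1))) := by
                rw [← Real.exp_nat_mul]
            _ ≤ _ := by
                rw [Real.exp_le_exp]
                have h3 : (((b k).natAbs : ℕ) : ℝ) ≤ K ^ (k+1) := by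
                  rw [Nat.cast_natAbs]; push_cast; exact hb k
                calc _ ≤ K ^ (k+1) * (2 * (1/(2*K)) ^ (k+1)) := by gcongr
                  _ = 2 * (K * (1/(2*K))) ^ (k+1) := by rw [mul_pow]; ring
                  _ = _ := by
                    congr 2
                    field_simp
    _ = Real.exp (2 * ∑ k ∈ Finset.range n, ((1:ℝ)/2) ^ (k+1)) := by
        rw [← Real.exp_sum, Finset.mul_sum]
    _ ≤ _ := by
        rw [Real.exp_le_exp]
        linarith [geomhalf n]

lemma ev_sub_one {r C : ℝ} (hr : 0 < r) {p : PowerSeries ℤ} {n : ℕ}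
    (hp : (X : PowerSeries ℤ) ^ (n+1) ∣ p - 1) (hB : Bd r C p) {q : ℂ} (hq : ‖q‖ ≤ r) :
    ‖ev p q - 1‖ ≤ C * (‖q‖ / r) ^ (n+1) := by
  rw [X_pow_dvd_iff] at hp
  have hs := hB.summ hq
  have h1 : ev p q - 1 = ∑' m, (((coeff (m+1) p : ℤ) : ℂ) * q ^ (m+1)) := by
    unfold ev
    rw [hs.of_norm.tsum_eq_zero_add]
    have h := hp 0 (by omega)
    rw [map_sub, sub_eq_zero] at h
    rw [h]; simp
  have hle : ∀ m, ‖(((coeff (m+1) p : ℤ) : ℂ) * q ^ (m+1))‖ ≤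
      |((coeff (m+1) p : ℤ) : ℝ)| * r ^ (m+1) * (‖q‖ / r) ^ (n+1) := by
    intro m
    by_cases hm : m + 1 < n + 1
    · have h := hp (m+1) hm
      rw [map_sub, coeff_one, if_neg (by omega), sub_zero] at h
      rw [h]; simp
    · rw [norm_mul, norm_pow, Complex.norm_intCast, mul_assoc]
      gcongr
      have hq1 : ‖q‖ / r ≤ 1 := by rw [div_le_one hr]; exact hq
      calc ‖q‖ ^ (m+1) = r ^ (m+1) * (‖q‖ / r) ^ (m+1) := by
            rw [← mul_pow]; congr 1; field_simp
        _ ≤ _ := by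
            gcongr ?_ * ?_
            exact pow_le_pow_of_le_one (by positivity) hq1 (by omega)
  have hs1 := (summable_nat_add_iff 1).2 hB.1
  rw [h1]
  refine (tsum_of_norm_bounded (hs1.mul_right _).hasSum hle).trans ?_
  rw [tsum_mul_right]
  gcongr
  refine le_trans ?_ hB.2
  rw [hB.1.tsum_eq_zero_add]
  simp only [pow_zero, mul_one]
  have : 0 ≤ |((coeff 0 p : ℤ) : ℝ)| := abs_nonneg _
  linarith

lemma norm_q_pow {K : ℝ} (hK : 1 ≤ K) {q : ℂ} (hq : ‖q‖ < 1/(2*K)) (k : ℕ) :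
    ‖q ^ (k+1)‖ ≤ 1/2 := by
  have hr : 1/(2*K) ≤ 1/2 := by
    apply one_div_le_one_div_of_le <;> linarith
  rw [norm_pow]
  exact (pow_le_of_le_one (norm_nonneg _) (by linarith) (by omega)).trans (by linarith)

lemma log_term {K : ℝ} (hK : 1 ≤ K) {q : ℂ} (hq : ‖q‖ < 1/(2*K)) (b : ℕ → ℤ)
    (hb : ∀ n, |(b n : ℝ)| ≤ K ^ (n+1)) (k : ℕ) :
    ‖(b k : ℂ) * Complex.log (1 - q ^ (k+1))‖ ≤ 2 * (K * ‖q‖) ^ (k+1) := by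
  have h := Complex.norm_log_one_add_half_le_self (z := -q ^ (k+1))
    (by rw [norm_neg]; exact norm_q_pow hK hq k)
  rw [norm_neg, ← sub_eq_add_neg] at h
  rw [norm_mul, Complex.norm_intCast, mul_pow]
  calc _ ≤ K ^ (k+1) * (2 * ‖q‖ ^ (k+1)) := by
        gcongr
        · exact hb k
        · rw [norm_pow] at h
          have : 0 ≤ ‖q‖ ^ (k+1) := by positivity
          linarith
    _ = _ := by ring

lemma Kq {K : ℝ} (hK : 1 ≤ K) {q : ℂ} (hq : ‖q‖ < 1/(2*K)) : K * ‖q‖ < 1/2 := by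
  rw [lt_div_iff₀ (by positivity)] at hq
  linarith

lemma log_summable {K : ℝ} (hK : 1 ≤ K) {q : ℂ} (hq : ‖q‖ < 1/(2*K)) (b : ℕ → ℤ)
    (hb : ∀ n, |(b n : ℝ)| ≤ K ^ (n+1)) :
    Summable (fun k => (b k : ℂ) * Complex.log (1 - q ^ (k+1))) := by
  refine Summable.of_norm_bounded ?_ (log_term hK hq b hb)
  refine Summable.mul_left 2 ?_
  exact (summable_nat_add_iff 1).2
    (summable_geometric_of_lt_one (by positivity) (by linarith [Kq hK hq]))

lemma one_sub_ne {K : ℝ} (hK : 1 ≤ K) {q : ℂ} (hq : ‖q‖ < 1/(2*K)) (k : ℕ) :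
    1 - q ^ (k+1) ≠ 0 := by
  intro h
  have h1 := norm_q_pow hK hq k
  rw [← sub_eq_zero.1 h] at h1
  norm_num at h1

lemma hasProd_exp {K : ℝ} (hK : 1 ≤ K) {q : ℂ} (hq : ‖q‖ < 1/(2*K)) (b : ℕ → ℤ)
    (hb : ∀ n, |(b n : ℝ)| ≤ K ^ (n+1)) :
    HasProd (fun k => (1 - q ^ (k+1)) ^ (b k))
      (Complex.exp (∑' k, (b k : ℂ) * Complex.log (1 - q ^ (k+1)))) := by
  convert (log_summable hK hq b hb).hasSum.cexp using 2 with k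
  simp only [Function.comp]
  rw [Complex.exp_int_mul, Complex.exp_log (one_sub_ne hK hq k)]

lemma main_exist (F : PowerSeries ℤ) (h0 : coeff 0 F = 1) (M : ℝ) (hM1 : 1 ≤ M)
    (hM : ∀ n, |((coeff n F : ℤ) : ℝ)| ≤ M ^ n) :
    ∃ (a : ℕ → ℤ) (K : ℝ), 1 ≤ K ∧ M ≤ K ∧ (∀ n, |(a n : ℝ)| ≤ K ^ (n+1)) ∧
      ∀ q : ℂ, ‖q‖ < 1/(2*K) →
        ev F q = Complex.exp (∑' k, (a k : ℂ) * Complex.log (1 - q ^ (k+1))) := by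
  set K := 8 * M with hKdef
  have hK : 1 ≤ K := by linarith
  have he : ∀ n, |(e F n : ℝ)| ≤ K ^ (n+1) := e_bound F h0 M hM1 hM
  refine ⟨fun n => - e F n, K, hK, by linarith, fun n => by simpa using he n, fun q hq => ?_⟩
  set r := 1/(2*K) with hr
  have hr0 : 0 < r := by positivity
  have hr1 : r < 1 := by
    rw [hr, div_lt_one (by positivity)]; linarith
  have hMr : M * r ≤ 1/2 := by
    rw [hr, hKdef]
    field_simp
    norm_num
  have hF : Bd r 2 F := by
    have hle : ∀ n, |((coeff n F : ℤ) : ℝ)| * r ^ n ≤ (1/2) ^ n := fun n => by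
      calc _ ≤ M ^ n * r ^ n := by gcongr; exact hM n
        _ = (M * r) ^ n := by rw [mul_pow]
        _ ≤ _ := by gcongr
    have hs := Summable.of_nonneg_of_le (fun n => by positivity) hle summable_geometric_two
    exact ⟨hs, (hs.tsum_le_tsum hle summable_geometric_two).trans tsum_geometric_two.le⟩
  have hev : ∀ n, ‖ev (P F n) q - 1‖ ≤ (2 * Real.exp 2) * (‖q‖ / r) ^ (n+1) := fun n => by
    refine ev_sub_one hr0 (P_dvd F h0 n) (((P_ev hr0.le hr1 F hF n).1).mono ?_) hq.le
    gcongr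
    exact prod_bound K hK (e F) he n
  have hq1 : ‖q‖ / r < 1 := by rw [div_lt_one hr0]; exact hq
  have ht1 : Tendsto (fun n => ev (P F n) q) atTop (𝓝 1) := by
    rw [tendsto_iff_norm_sub_tendsto_zero]
    refine squeeze_zero (fun n => norm_nonneg _) hev ?_
    have := ((tendsto_add_atTop_iff_nat 1).2
      (tendsto_pow_atTop_nhds_zero_of_lt_one (by positivity) hq1)).const_mul (2 * Real.exp 2)
    simpa using this
  have ht2 : Tendsto (fun n => ev (P F n) q) atTop
      (𝓝 (ev F q * Complex.exp (∑' k, (e F k : ℂ) * Complex.log (1 - q ^ (k+1))))) := by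
    simp only [fun n => (P_ev hr0.le hr1 F hF n).2 q hq.le]
    exact (hasProd_exp hK hq (e F) he).tendsto_prod_nat.const_mul _
  have := tendsto_nhds_unique ht2 ht1
  have h3 : (∑' k, ((- e F k : ℤ) : ℂ) * Complex.log (1 - q ^ (k+1)))
      = - ∑' k, (e F k : ℂ) * Complex.log (1 - q ^ (k+1)) := by
    rw [← tsum_neg]; simp
  rw [h3, Complex.exp_neg]
  exact eq_inv_of_mul_eq_one_left this

end PE

namespace PE
open PowerSeries

lemma log_lower {y : ℝ} (h0 : 0 ≤ y) (h1 : y < 1) : y ≤ |Real.log (1 - y)| := by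
  have := Real.log_le_sub_one_of_pos (show 0 < 1 - y by linarith)
  rw [abs_of_nonpos (by linarith)]
  linarith

lemma growth {x : ℝ} (h0 : 0 < x) (h1 : x < 1) (b : ℕ → ℤ) (v : ℂ) (hv : v ≠ 0)
    (h : HasProd (fun k => (1 - (x:ℂ) ^ (k+1)) ^ (b k)) v) :
    ∃ K : ℝ, 1 ≤ K ∧ ∀ n, |(b n : ℝ)| ≤ K ^ (n+1) := by
  have hy : ∀ k : ℕ, x ^ (k+1) < 1 := fun k => pow_lt_one₀ h0.le h1 (by omega)
  have hne : ∀ k : ℕ, (1 - (x:ℂ) ^ (k+1)) ≠ 0 := fun k hk => by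
    have : ((1 - x ^ (k+1) : ℝ) : ℂ) = 0 := by push_cast; exact hk
    have := Complex.ofReal_eq_zero.1 this
    linarith [hy k]
  have ht := h.tendsto_prod_nat
  have ht2 := ((tendsto_add_atTop_iff_nat 1).2 ht).div ht hv
  rw [div_self hv] at ht2
  have ht3 : Tendsto (fun k => ‖(1 - (x:ℂ) ^ (k+1)) ^ (b k)‖) atTop (𝓝 1) := by
    have := ht2.norm
    rw [norm_one] at this
    refine this.congr fun n => ?_
    simp only [Pi.div_apply]
    rw [Finset.prod_range_succ, mul_div_cancel_left₀]
    exact Finset.prod_ne_zero_iff.2 fun k _ => zpow_ne_zero _ (hne k)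
  have ht4 := ht3.log one_ne_zero
  have ht5 : Tendsto (fun k : ℕ => (b k : ℝ) * Real.log (1 - x ^ (k+1))) atTop
      (𝓝 (Real.log 1)) := by
    refine ht4.congr fun n => ?_
    have : (1 - (x:ℂ) ^ (n+1)) = ((1 - x ^ (n+1) : ℝ) : ℂ) := by push_cast; rfl
    rw [norm_zpow, Real.log_zpow, this, Complex.norm_real, Real.norm_eq_abs, Real.log_abs]
  obtain ⟨C, hC⟩ := (Metric.isBounded_range_of_tendsto _ ht5).exists_norm_le
  have hC' : ∀ n : ℕ, |(b n : ℝ)| * x ^ (n+1) ≤ max C 1 := fun n => by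
    have := hC _ ⟨n, rfl⟩
    simp only [norm_mul, Real.norm_eq_abs] at this
    refine le_trans ?_ (this.trans (le_max_left _ _))
    gcongr
    exact log_lower (by positivity) (hy n)
  have hm : 1 ≤ max C 1 := le_max_right _ _
  refine ⟨max C 1 / x, ?_, fun n => ?_⟩
  · rw [le_div_iff₀ h0]; linarith
  · rw [div_pow, le_div_iff₀ (by positivity)]
    exact (hC' n).trans (le_self_pow₀ hm (by omega))

lemma real_sum {x : ℝ} (h0 : 0 < x) (h1 : x < 1) (b : ℕ → ℤ) :
    (∑' k, (b k : ℂ) * Complex.log (1 - (x:ℂ) ^ (k+1)))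
      = ((∑' k, (b k : ℝ) * Real.log (1 - x ^ (k+1)) : ℝ) : ℂ) := by
  rw [Complex.ofReal_tsum]
  refine tsum_congr fun k => ?_
  have hy : x ^ (k+1) < 1 := pow_lt_one₀ h0.le h1 (by omega)
  rw [Complex.ofReal_mul, Complex.ofReal_log (by linarith)]
  push_cast; rfl

lemma unique_aux {K δ : ℝ} (hK : 1 ≤ K) (hδ : 0 < δ) (d : ℕ → ℤ)
    (hd : ∀ n, |(d n : ℝ)| ≤ K ^ (n+1))
    (h : ∀ x : ℝ, 0 < x → x < δ → ∑' k, (d k : ℂ) * Complex.log (1 - (x:ℂ) ^ (k+1)) = 0) (m : ℕ) :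
    d m = 0 := by
  induction m using Nat.strong_induction_on with
  | _ m ih =>
  by_contra hm
  obtain ⟨x, hx0, hx⟩ := exists_between (show 0 < min δ (min (1/(2*K)) (1 / (4 * K^(m+2)))) by positivity)
  have hx1 : x < δ := hx.trans_le (min_le_left _ _)
  have hx2 : x < 1/(2*K) := hx.trans_le ((min_le_right _ _).trans (min_le_left _ _))
  have hx3 : x < 1 / (4 * K^(m+2)) := hx.trans_le ((min_le_right _ _).trans (min_le_right _ _))
  have hxn : ‖(x:ℂ)‖ = x := by rw [Complex.norm_real, Real.norm_eq_abs, abs_of_pos hx0]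
  have hq : ‖(x:ℂ)‖ < 1/(2*K) := by rw [hxn]; exact hx2
  have hxlt1 : x < 1 := by
    have : 1/(2*K) ≤ 1/2 := by
      apply one_div_le_one_div_of_le <;> linarith
    linarith
  have hKx := Kq hK hq
  rw [hxn] at hKx
  have hs := log_summable hK hq d hd
  have h1 := hs.sum_add_tsum_nat_add (m+1)
  rw [h x hx0 hx1, Finset.sum_range_succ, Finset.sum_eq_zero, zero_add] at h1
  swap
  · intro k hk
    rw [ih k (Finset.mem_range.1 hk)]; simp
  have hb : ∀ k : ℕ, ‖(d (k+(m+1)) : ℂ) * Complex.log (1 - (x:ℂ) ^ (k+(m+1)+1))‖ ≤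
      2 * (K*x)^(m+2) * (K * x) ^ k := fun k => by
    have := log_term hK hq d hd (k+(m+1))
    rw [hxn] at this
    refine this.trans_eq ?_
    rw [mul_assoc, ← pow_add]; congr 2; omega
  have hb2 := tsum_of_norm_bounded
    ((hasSum_geometric_of_lt_one (by positivity) (show K * x < 1 by linarith)).mul_left
      (2 * (K*x)^(m+2))) hb
  have h2 : ‖(d m : ℂ) * Complex.log (1 - (x:ℂ) ^ (m+1))‖ ≤ 2 * (K*x)^(m+2) * (1 - K*x)⁻¹ := by
    rw [eq_neg_of_add_eq_zero_left h1, norm_neg]; exact hb2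
  have hy : x ^ (m+1) < 1 := pow_lt_one₀ hx0.le hxlt1 (by omega)
  have h3 : x ^ (m+1) ≤ ‖(d m : ℂ) * Complex.log (1 - (x:ℂ) ^ (m+1))‖ := by
    have e1 : (1 - (x:ℂ) ^ (m+1)) = ((1 - x ^ (m+1) : ℝ) : ℂ) := by push_cast; rfl
    rw [norm_mul, Complex.norm_intCast, e1, ← Complex.ofReal_log (by linarith),
      Complex.norm_real, Real.norm_eq_abs]
    have e2 : (1:ℝ) ≤ |(d m : ℝ)| := by exact_mod_cast Int.one_le_abs hm
    have e3 := log_lower (show 0 ≤ x ^ (m+1) by positivity) hy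
    have e4 : 0 ≤ x ^ (m+1) := by positivity
    nlinarith
  have h4 : (1 - K*x)⁻¹ ≤ 2 := by
    rw [inv_le_comm₀ (by linarith) (by norm_num)]; linarith
  have h5 : x ^ (m+1) ≤ x ^ (m+1) * (4 * K^(m+2) * x) := by
    calc _ ≤ 2 * (K*x)^(m+2) * 2 := (h3.trans h2).trans (by gcongr)
      _ = _ := by rw [mul_pow]; ring
  have h6 : 1 ≤ 4 * K^(m+2) * x := by
    refine le_of_mul_le_mul_left ?_ (show 0 < x^(m+1) by positivity)
    rw [mul_one]; exact h5
  rw [lt_div_iff₀ (by positivity)] at hx3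
  linarith

lemma unique_main {Ka Kb δ : ℝ} (ha1 : 1 ≤ Ka) (hb1 : 1 ≤ Kb) (hδ : 0 < δ) (a b : ℕ → ℤ)
    (ha : ∀ n, |(a n : ℝ)| ≤ Ka ^ (n+1)) (hb : ∀ n, |(b n : ℝ)| ≤ Kb ^ (n+1))
    (h : ∀ x : ℝ, 0 < x → x < δ → ∏' k, (1 - (x:ℂ) ^ (k+1)) ^ (a k)
      = ∏' k, (1 - (x:ℂ) ^ (k+1)) ^ (b k)) : a = b := by
  have hK : 1 ≤ Ka + Kb := by linarith
  have ha' : ∀ n, |(a n : ℝ)| ≤ (Ka + Kb) ^ (n+1) := fun n => (ha n).trans (by gcongr; linarith)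
  have hb' : ∀ n, |(b n : ℝ)| ≤ (Ka + Kb) ^ (n+1) := fun n => (hb n).trans (by gcongr; linarith)
  funext m
  rw [← sub_eq_zero]
  refine unique_aux (K := Ka + Kb) (δ := min δ (1/(2*(Ka+Kb)))) hK (by positivity)
    (fun n => a n - b n) ?_ ?_ m
  · intro n
    push_cast
    refine (abs_sub _ _).trans ((add_le_add (ha n) (hb n)).trans ?_)
    exact pow_add_pow_le (by linarith) (by linarith) (by omega)
  · intro x hx0 hx
    have hx1 : x < δ := hx.trans_le (min_le_left _ _)
    have hx2 : x < 1/(2*(Ka+Kb)) := hx.trans_le (min_le_right _ _)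
    have hxn : ‖(x:ℂ)‖ = x := by rw [Complex.norm_real, Real.norm_eq_abs, abs_of_pos hx0]
    have hq : ‖(x:ℂ)‖ < 1/(2*(Ka+Kb)) := by rw [hxn]; exact hx2
    have hxlt1 : x < 1 := by
      have : 1/(2*(Ka+Kb)) ≤ 1/2 := by
        apply one_div_le_one_div_of_le <;> linarith
      linarith
    have e1 := h x hx0 hx1
    rw [(hasProd_exp hK hq a ha').tprod_eq, (hasProd_exp hK hq b hb').tprod_eq,
      real_sum hx0 hxlt1, real_sum hx0 hxlt1, ← Complex.ofReal_exp, ← Complex.ofReal_exp,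
      Complex.ofReal_inj, Real.exp_eq_exp] at e1
    have e2 := (log_summable hK hq a ha').tsum_sub (log_summable hK hq b hb')
    rw [real_sum hx0 hxlt1, real_sum hx0 hxlt1, e1, sub_self] at e2
    rw [← e2]
    refine tsum_congr fun k => ?_
    push_cast; ring

lemma exp_eq (z : UpperHalfPlane) (n : ℕ) :
    Complex.exp (2 * (π : ℂ) * Complex.I * ((n : ℂ) + 1) * (z : ℂ))
      = Complex.exp (2 * (π : ℂ) * Complex.I * (z : ℂ)) ^ (n+1) := by
  rw [← Complex.exp_nat_mul]
  congr 1
  push_cast; ring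

lemma norm_exp_q (z : UpperHalfPlane) :
    ‖Complex.exp (2 * (π : ℂ) * Complex.I * (z : ℂ))‖ = Real.exp (-(2 * π * z.im)) := by
  rw [Complex.norm_exp]
  congr 1
  simp

lemma exists_z (Y : ℝ) : ∃ δ : ℝ, 0 < δ ∧ δ ≤ 1 ∧ ∀ x : ℝ, 0 < x → x < δ →
    ∃ z : UpperHalfPlane, Y < z.im ∧ Complex.exp (2 * (π : ℂ) * Complex.I * (z : ℂ)) = x := by
  refine ⟨min 1 (Real.exp (-(2 * π * Y))), by positivity, min_le_left _ _, fun x hx0 hx => ?_⟩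
  have hx1 : x < 1 := hx.trans_le (min_le_left _ _)
  have hx2 : x < Real.exp (-(2 * π * Y)) := hx.trans_le (min_le_right _ _)
  have hl := Real.log_neg hx0 hx1
  rw [← Real.log_lt_iff_lt_exp hx0] at hx2
  have hpos : 0 < -Real.log x / (2 * π) := div_pos (by linarith) (by positivity)
  refine ⟨⟨((-Real.log x / (2 * π) : ℝ) : ℂ) * Complex.I, ?_⟩, ?_, ?_⟩
  · rw [Complex.mul_I_im, Complex.ofReal_re]; exact hpos
  · change Y < (((-Real.log x / (2 * π) : ℝ) : ℂ) * Complex.I).im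
    rw [Complex.mul_I_im, Complex.ofReal_re]
    rw [lt_div_iff₀ (by positivity)]
    linarith
  · change Complex.exp (2 * (π : ℂ) * Complex.I * (((-Real.log x / (2 * π) : ℝ) : ℂ) * Complex.I)) = x
    have : 2 * (π : ℂ) * Complex.I * (((-Real.log x / (2 * π) : ℝ) : ℂ) * Complex.I)
        = ((Real.log x : ℝ) : ℂ) := by
      have hpi : (π : ℂ) ≠ 0 := by exact_mod_cast Real.pi_ne_zero
      push_cast
      field_simp
      rw [Complex.I_sq]; ring
    rw [this, ← Complex.ofReal_exp, Real.exp_log hx0]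

lemma coeffs (f : UpperHalfPlane → ℂ) (c : ℕ → ℤ)
    (hexp : ∀ z : UpperHalfPlane,
      f z = 1 + ∑' n : ℕ, (c n : ℂ) *
        Complex.exp (2 * (π : ℂ) * Complex.I * ((n : ℂ) + 1) * (z : ℂ))) :
    ∃ (c' : ℕ → ℤ) (M : ℝ), 1 ≤ M ∧ (∀ n, |(c' n : ℝ)| ≤ M ^ (n+1)) ∧
      ∀ z : UpperHalfPlane, f z = 1 + ∑' n : ℕ, (c' n : ℂ) *
        Complex.exp (2 * (π : ℂ) * Complex.I * (z : ℂ)) ^ (n+1) := by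
  simp only [exp_eq] at hexp
  by_cases hs : ∃ z : UpperHalfPlane, Summable (fun n : ℕ => (c n : ℂ) *
        Complex.exp (2 * (π : ℂ) * Complex.I * (z : ℂ)) ^ (n+1))
  · obtain ⟨z, hz⟩ := hs
    have hx0 : 0 < Real.exp (-(2 * π * z.im)) := Real.exp_pos _
    have hx1 : Real.exp (-(2 * π * z.im)) < 1 := by
      rw [Real.exp_lt_one_iff]
      have := mul_pos Real.two_pi_pos z.im_pos
      linarith
    have ht := hz.tendsto_atTop_zero
    obtain ⟨C, hC⟩ := (Metric.isBounded_range_of_tendsto _ ht).exists_norm_le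
    have hm : 1 ≤ max C 1 := le_max_right _ _
    refine ⟨c, max C 1 / Real.exp (-(2 * π * z.im)), ?_, fun n => ?_, hexp⟩
    · rw [le_div_iff₀ hx0]; linarith
    · rw [div_pow, le_div_iff₀ (by positivity)]
      have := hC _ ⟨n, rfl⟩
      simp only [norm_mul, norm_pow, Complex.norm_intCast, norm_exp_q] at this
      exact this.trans ((le_max_left _ _).trans (le_self_pow₀ hm (by omega)))
  · refine ⟨0, 1, le_rfl, fun n => by simp, fun z => ?_⟩
    rw [hexp z, tsum_eq_zero_of_not_summable fun h => hs ⟨z, h⟩]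
    simp

end PE

/-- Product expansion theorem: a holomorphic 1-periodic function on `ℍ` with Fourier expansion
`1 + Σ_{n≥1} c_n q^n`, `c_n ∈ ℤ`, has a unique product expansion `∏_{n≥1}(1−q^n)^{a(n)}`
with integer exponents, valid for sufficiently small `|q|`.  Here `a : ℕ → ℤ` encodes the
exponent of `(1−q^{n+1})` as `a n`. -/
theorem sl2z_invariant_units_stmt11 (f : UpperHalfPlane → ℂ)
    (hhol : MDifferentiable 𝓘(ℂ) 𝓘(ℂ) f)
    (hper : ∀ z : UpperHalfPlane, f ((1 : ℝ) +ᵥ z) = f z)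
    (c : ℕ → ℤ)
    (hexp : ∀ z : UpperHalfPlane,
      f z = 1 + ∑' n : ℕ, (c n : ℂ) *
        Complex.exp (2 * (π : ℂ) * Complex.I * ((n : ℂ) + 1) * (z : ℂ))) :
    ∃! a : ℕ → ℤ, ∃ Y : ℝ, ∀ z : UpperHalfPlane, Y < z.im →
      Multipliable
        (fun n : ℕ =>
          (1 - Complex.exp (2 * (π : ℂ) * Complex.I * ((n : ℂ) + 1) * (z : ℂ))) ^ a n) ∧
      (∏' n : ℕ,
        (1 - Complex.exp (2 * (π : ℂ) * Complex.I * ((n : ℂ) + 1) * (z : ℂ))) ^ a n) = f z := by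
  obtain ⟨c', M, hM1, hM, hf⟩ := PE.coeffs f c hexp
  set F : PowerSeries ℤ := PowerSeries.mk (fun n => Nat.casesOn n 1 c') with hF
  have hF0 : PowerSeries.coeff 0 F = 1 := by rw [hF, PowerSeries.coeff_mk]; rfl
  have hFs : ∀ n, PowerSeries.coeff (n+1) F = c' n := fun n => by rw [hF, PowerSeries.coeff_mk]
  have hFM : ∀ n, |((PowerSeries.coeff n F : ℤ) : ℝ)| ≤ M ^ n := by
    intro n
    rcases n with _ | n
    · rw [hF0]; simp
    · rw [hFs]; exact hM n
  obtain ⟨a, K, hK1, hMK, ha, hev⟩ := PE.main_exist F hF0 M hM1 hFM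
  have hK0 : 0 < K := by linarith
  have hq : ∀ z : UpperHalfPlane, Real.log (2 * K) / (2 * π) < z.im →
      ‖Complex.exp (2 * (π : ℂ) * Complex.I * (z : ℂ))‖ < 1/(2*K) := by
    intro z hz
    rw [div_lt_iff₀ Real.two_pi_pos] at hz
    rw [PE.norm_exp_q, one_div, ← Real.exp_log (show 0 < 2 * K by positivity), ← Real.exp_neg,
      Real.exp_lt_exp]
    linarith
  have hfe : ∀ z : UpperHalfPlane, Real.log (2 * K) / (2 * π) < z.im →
      f z = Complex.exp (∑' k, (a k : ℂ) *
        Complex.log (1 - Complex.exp (2 * (π : ℂ) * Complex.I * (z : ℂ)) ^ (k+1))) := by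
    intro z hz
    rw [← hev _ (hq z hz), hf z]
    unfold PE.ev
    symm
    rw [Summable.tsum_eq_zero_add]
    · rw [hF0]; simp only [hFs]; simp
    · have hlt : M * ‖Complex.exp (2 * (π : ℂ) * Complex.I * (z : ℂ))‖ < 1 := by
        have := PE.Kq hK1 (hq z hz)
        nlinarith [norm_nonneg (Complex.exp (2 * (π : ℂ) * Complex.I * (z : ℂ)))]
      refine Summable.of_norm_bounded (summable_geometric_of_lt_one (by positivity) hlt) fun n => ?_
      rw [norm_mul, norm_pow, Complex.norm_intCast, mul_pow]
      gcongr
      exact hFM n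
  simp only [PE.exp_eq]
  refine ⟨a, ⟨Real.log (2 * K) / (2 * π), fun z hz => ?_⟩, ?_⟩
  · have h := PE.hasProd_exp hK1 (hq z hz) a ha
    exact ⟨h.multipliable, by rw [h.tprod_eq, hfe z hz]⟩
  · rintro b ⟨Y, hY⟩
    obtain ⟨δ, hδ, hδ1, hz⟩ := PE.exists_z (max Y (Real.log (2 * K) / (2 * π)))
    have hb : ∃ K' : ℝ, 1 ≤ K' ∧ ∀ n, |(b n : ℝ)| ≤ K' ^ (n+1) := by
      obtain ⟨z, hz1, hz2⟩ := hz (δ/2) (by positivity) (by linarith)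
      obtain ⟨h1, h2⟩ := hY z ((le_max_left _ _).trans_lt hz1)
      have h3 := hfe z ((le_max_right _ _).trans_lt hz1)
      have h4 := h1.hasProd
      rw [h2, hz2] at h4
      exact PE.growth (by positivity) (by linarith) b (f z) (by rw [h3]; exact Complex.exp_ne_zero _) h4
    obtain ⟨K', hK', hb⟩ := hb
    refine PE.unique_main hK' hK1 hδ b a hb ha fun x hx0 hx => ?_
    obtain ⟨z, hz1, hz2⟩ := hz x hx0 hx
    have h1 := (hY z ((le_max_left _ _).trans_lt hz1)).2
    have hz3 := (le_max_right _ _).trans_lt hz1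
    have h2 := (PE.hasProd_exp hK1 (hq z hz3) a ha).tprod_eq
    rw [← hfe z hz3] at h2
    rw [hz2] at h1 h2
    rw [h1, h2]
end
end

section
/- Let l ≥ 1 be an integer and let f be a modular unit such that, for some rational number s, f(z)·exp(−2πisz) = 1 + Σ_{n≥1} c_n·exp(2πinz) for all z ∈ ℍ with rational coefficients c_n. If f^N ∈ E(l) for some positive integer N, then f ∈ E(2l); if moreover l is odd, then f ∈ E(l). -/
open Complex Filter Topology UpperHalfPlane Matrix MatrixGroups
open scoped Real Manifold

noncomputable section

/-- `B(x) = y² − y + 1/6` where `y` is the fractional part of `x`. -/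
def bern (x : ℝ) : ℝ := Int.fract x ^ 2 - Int.fract x + 1 / 6

/-- The modular unit `[r]_l`. -/
def rl (l r : ℤ) : UpperHalfPlane → ℂ := fun z =>
  Complex.exp (2 * (π : ℂ) * Complex.I *
      ((-((l : ℝ) * bern ((r : ℝ) / (l : ℝ)) / 2) : ℝ) : ℂ) * (z : ℂ)) *
    (∏' n : {n : ℤ // 0 < n ∧ n ≡ r [ZMOD l]},
      (1 - Complex.exp (2 * (π : ℂ) * Complex.I * ((n : ℤ) : ℂ) * (z : ℂ)))⁻¹) *
    (∏' n : {n : ℤ // 0 < n ∧ n ≡ -r [ZMOD l]},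
      (1 - Complex.exp (2 * (π : ℂ) * Complex.I * ((n : ℤ) : ℂ) * (z : ℂ)))⁻¹)

/-- A modular unit: holomorphic, nowhere vanishing on `ℍ`, invariant under some principal
congruence subgroup, and meromorphic at all cusps. -/
def IsModularUnit (f : UpperHalfPlane → ℂ) : Prop :=
  MDifferentiable 𝓘(ℂ) 𝓘(ℂ) f ∧
  (∀ z, f z ≠ 0) ∧
  (∃ N : ℕ, 0 < N ∧ ∀ A ∈ CongruenceSubgroup.Gamma N, ∀ z : UpperHalfPlane, f (A • z) = f z) ∧
  (∀ A : SL(2, ℤ), ∃ (α : ℝ) (κ : ℂ), κ ≠ 0 ∧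
    Filter.Tendsto
      (fun z : UpperHalfPlane =>
        f (A • z) * Complex.exp (-(2 * (π : ℂ) * Complex.I * (α : ℂ) * (z : ℂ))))
      UpperHalfPlane.atImInfty (nhds κ))

/-- Membership in the group `E(l)` generated by the `[r]_l`, `1 ≤ r ≤ ⌊l/2⌋`, i.e. being a
product of integral powers of the generators. -/
def MemE (l : ℕ) (f : UpperHalfPlane → ℂ) : Prop :=
  ∃ m : ℕ → ℤ, ∀ z, f z = ∏ r ∈ Finset.Icc 1 (l / 2), rl l r z ^ m r

section Part1

/-- `φ` is given by the power series `p` in `q^(1/n)`. -/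
def HasQ (n : ℕ) (φ : ℍ → ℂ) (p : PowerSeries ℂ) : Prop :=
  ∀ z : ℍ, HasSum (fun i => PowerSeries.coeff i p * (Function.Periodic.qParam n z) ^ i) (φ z)

lemma HasQ.add {n : ℕ} {φ ψ : ℍ → ℂ} {p r : PowerSeries ℂ} (h1 : HasQ n φ p) (h2 : HasQ n ψ r) :
    HasQ n (φ + ψ) (p + r) := by
  intro z
  simpa [add_mul] using (h1 z).add (h2 z)

lemma HasQ.smul {n : ℕ} {φ : ℍ → ℂ} {p : PowerSeries ℂ} (c : ℂ) (h1 : HasQ n φ p) :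
    HasQ n (c • φ) (c • p) := by
  intro z
  simpa [mul_assoc] using (h1 z).mul_left c

lemma HasQ.sub {n : ℕ} {φ ψ : ℍ → ℂ} {p r : PowerSeries ℂ} (h1 : HasQ n φ p) (h2 : HasQ n ψ r) :
    HasQ n (φ - ψ) (p - r) := by
  have := h1.add (h2.smul (-1))
  simpa [sub_eq_add_neg] using this

lemma HasQ.mul {n : ℕ} {φ ψ : ℍ → ℂ} {p r : PowerSeries ℂ} (h1 : HasQ n φ p) (h2 : HasQ n ψ r) :
    HasQ n (φ * ψ) (p * r) := by
  intro z
  have s1 := (h1 z).summable.norm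
  have s2 := (h2 z).summable.norm
  have e := tsum_mul_tsum_eq_tsum_sum_antidiagonal_of_summable_norm s1 s2
  have s3 := (summable_norm_sum_mul_antidiagonal_of_summable_norm s1 s2).of_norm
  rw [(h1 z).tsum_eq, (h2 z).tsum_eq] at e
  have := s3.hasSum
  rw [← e] at this
  refine this.congr_fun fun i => ?_
  rw [PowerSeries.coeff_mul, Finset.sum_mul]
  refine Finset.sum_congr rfl fun x hx => ?_
  rw [← Finset.HasAntidiagonal.mem_antidiagonal.mp hx, pow_add]
  ring

lemma HasQ.const (n : ℕ) (c : ℂ) : HasQ n (fun _ => c) (PowerSeries.C c) := by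
  intro z
  convert hasSum_single (0 : ℕ) _ using 1
  · simp
  · intro b hb
    simp [PowerSeries.coeff_C, hb]

lemma HasQ.one (n : ℕ) : HasQ n 1 1 := by
  have := HasQ.const n 1
  rw [map_one] at this
  exact this

lemma HasQ.pow {n : ℕ} {φ : ℍ → ℂ} {p : PowerSeries ℂ} (h1 : HasQ n φ p) (k : ℕ) :
    HasQ n (φ ^ k) (p ^ k) := by
  induction k with
  | zero => simpa using HasQ.one n
  | succ k ih => simpa [pow_succ] using ih.mul h1

lemma HasQ.qpow (n k : ℕ) : HasQ n (fun z => (Function.Periodic.qParam n z) ^ k) (PowerSeries.X ^ k) := by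
  intro z
  convert hasSum_single (k : ℕ) _ using 1
  · simp [PowerSeries.coeff_X_pow]
  · intro b hb
    simp [PowerSeries.coeff_X_pow, hb]

lemma HasQ.eq_zero {n : ℕ} (hn : 0 < n) {p : PowerSeries ℂ} (h : HasQ n 0 p) : p = 0 := by
  ext m
  have hn' : (0 : ℝ) < n := by exact_mod_cast hn
  have := UpperHalfPlane.qExpansion_coeff_unique (0 : ModularForm 𝒮ℒ 0) (c := fun i => PowerSeries.coeff i p)
    hn' ?_ ?_ m
  · rw [this, FunLike.coe_zero, UpperHalfPlane.qExpansion_zero]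
  · rw [FunLike.coe_zero]
    refine UpperHalfPlane.analyticAt_cuspFunction_zero hn' ?_ ?_ ?_
    · intro x; simp
    · exact mdifferentiable_const
    · exact Filter.const_boundedAtFilter _ (0 : ℂ)
  · intro τ
    simpa [smul_eq_mul] using h τ

lemma HasQ.unique {n : ℕ} (hn : 0 < n) {φ : ℍ → ℂ} {p r : PowerSeries ℂ} (h1 : HasQ n φ p)
    (h2 : HasQ n φ r) : p = r := by
  have := h1.sub h2
  rw [sub_self] at this
  exact sub_eq_zero.mp (this.eq_zero hn)

lemma qParam_pow (n : ℕ) (hn : n ≠ 0) (z : ℍ) :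
    Function.Periodic.qParam n z ^ n = Function.Periodic.qParam 1 z := by
  simp only [Function.Periodic.qParam]
  rw [← Complex.exp_nat_mul]
  congr 1
  have : (n : ℂ) ≠ 0 := by exact_mod_cast hn
  push_cast
  field_simp

lemma HasQ.expand {φ : ℍ → ℂ} {p : PowerSeries ℂ} (h : HasQ 1 φ p) (n : ℕ) (hn : n ≠ 0) :
    HasQ n φ (PowerSeries.expand n hn p) := by
  intro z
  have hinj : Function.Injective (fun i : ℕ => n * i) := fun a b hab => by
    simpa [hn] using hab
  rw [← hinj.hasSum_iff]
  · convert h z using 2 with i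
    simp only [Function.comp]
    rw [PowerSeries.coeff_expand_mul, pow_mul, qParam_pow n hn, Nat.cast_one]
  · intro x hx
    rw [PowerSeries.coeff_expand_of_not_dvd, zero_mul]
    rintro ⟨k, rfl⟩
    exact hx ⟨k, rfl⟩

end Part1

section Part2

/-- Power series with algebraic integer coefficients. -/
def II : Subring (PowerSeries ℂ) where
  carrier := {p | ∀ i, IsIntegral ℤ (PowerSeries.coeff i p)}
  zero_mem' := fun i => by simpa using isIntegral_zero
  one_mem' := fun i => by
    rw [PowerSeries.coeff_one]; split_ifs
    · exact isIntegral_one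
    · exact isIntegral_zero
  add_mem' := fun {a b} ha hb i => by
    rw [map_add]; exact (ha i).add (hb i)
  neg_mem' := fun {a} ha i => by
    rw [map_neg]; exact (ha i).neg
  mul_mem' := fun {a b} ha hb i => by
    rw [PowerSeries.coeff_mul]
    exact IsIntegral.sum _ fun x _ => (ha _).mul (hb _)

lemma mem_II {p : PowerSeries ℂ} : p ∈ II ↔ ∀ i, IsIntegral ℤ (PowerSeries.coeff i p) := Iff.rfl

/-- The complex span of the series with algebraic integer coefficients. -/
def BB : Subalgebra ℂ (PowerSeries ℂ) := Algebra.adjoin ℂ (II : Set (PowerSeries ℂ))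

lemma II_le_BB {p : PowerSeries ℂ} (h : p ∈ II) : p ∈ BB := Algebra.subset_adjoin h

lemma BB_induction {P : PowerSeries ℂ → Prop} (h0 : P 0) (hadd : ∀ x y, P x → P y → P (x + y))
    (hs : ∀ (c : ℂ) x, x ∈ II → P (c • x)) {p : PowerSeries ℂ} (hp : p ∈ BB) : P p := by
  have : p ∈ Submodule.span ℂ (II : Set (PowerSeries ℂ)) := by
    have h := Algebra.adjoin_eq_span (R := ℂ) (II : Set (PowerSeries ℂ))
    have e : (Submonoid.closure (II : Set (PowerSeries ℂ)) : Set (PowerSeries ℂ)) = II := by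
      have := Submonoid.closure_eq II.toSubmonoid
      exact congrArg (fun x : Submonoid (PowerSeries ℂ) => (x : Set (PowerSeries ℂ))) this
    rw [e] at h
    rw [← h]
    exact hp
  have key : ∀ c : ℂ, P (c • p) := by
    clear hp
    induction this using Submodule.span_induction with
    | mem x h => exact fun c => hs c x h
    | zero => intro c; simpa using h0
    | add x y _ _ hx hy => intro c; rw [smul_add]; exact hadd _ _ (hx c) (hy c)
    | smul a x _ hx => intro c; rw [smul_smul]; exact hx _
  simpa using key 1

local notation "KK" => algebraicClosure ℚ ℂ

lemma integral_mem_KK {x : ℂ} (h : IsIntegral ℤ x) : x ∈ algebraicClosure ℚ ℂ := by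
  rw [mem_algebraicClosure_iff]
  exact (h.tower_top (A := ℚ)).isAlgebraic

lemma exists_int_mul_integral {x : ℂ} (h : x ∈ algebraicClosure ℚ ℂ) :
    ∃ D : ℤ, D ≠ 0 ∧ IsIntegral ℤ ((D : ℂ) * x) := by
  rw [mem_algebraicClosure_iff] at h
  have h' : IsAlgebraic ℤ x := (IsFractionRing.isAlgebraic_iff ℤ ℚ ℂ).mpr h
  obtain ⟨y, hy, h2⟩ := h'.exists_integral_multiple
  exact ⟨y, hy, by simpa using h2⟩

/-- Apply a functional coefficientwise. -/
def LL (lam : ℂ →ₗ[KK] KK) (p : PowerSeries ℂ) : PowerSeries ℂ :=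
  PowerSeries.mk fun i => ((lam (PowerSeries.coeff i p) : KK) : ℂ)

lemma LL_add (lam : ℂ →ₗ[KK] KK) (p r : PowerSeries ℂ) : LL lam (p + r) = LL lam p + LL lam r := by
  ext i; simp [LL]

lemma lam_mul (lam : ℂ →ₗ[KK] KK) {a : ℂ} (ha : a ∈ algebraicClosure ℚ ℂ) (w : ℂ) :
    ((lam (a * w) : KK) : ℂ) = a * (lam w : KK) := by
  have := lam.map_smul (⟨a, ha⟩ : KK) w
  rw [show (⟨a, ha⟩ : KK) • w = a * w from rfl] at this
  rw [this]; rfl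

lemma LL_mul (lam : ℂ →ₗ[KK] KK) {c p : PowerSeries ℂ} 
    (hc : ∀ i, PowerSeries.coeff i c ∈ algebraicClosure ℚ ℂ) : LL lam (c * p) = c * LL lam p := by
  ext i
  simp only [LL, PowerSeries.coeff_mk, PowerSeries.coeff_mul, map_sum]
  push_cast
  refine Finset.sum_congr rfl fun x _ => ?_
  exact lam_mul lam (hc _) _

lemma LL_BB (lam : ℂ →ₗ[KK] KK) {p : PowerSeries ℂ} (hp : p ∈ BB) :
    ∃ D : ℤ, D ≠ 0 ∧ (D : PowerSeries ℂ) * LL lam p ∈ II := by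
  refine BB_induction (P := fun p => ∃ D : ℤ, D ≠ 0 ∧ (D : PowerSeries ℂ) * LL lam p ∈ II)
    ?_ ?_ ?_ hp
  · exact ⟨1, one_ne_zero, by
      rw [show LL lam 0 = 0 by ext i; simp [LL], mul_zero]; exact II.zero_mem⟩
  · intro x y hx hy
    obtain ⟨D, hD, h1⟩ := hx
    obtain ⟨E, hE, h2⟩ := hy
    refine ⟨D * E, mul_ne_zero hD hE, ?_⟩
    rw [LL_add]
    have := II.add_mem (II.mul_mem (intCast_mem II E) h1) (II.mul_mem (intCast_mem II D) h2)
    convert this using 1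
    push_cast; ring
  · intro c x hx
    obtain ⟨D, hD, h⟩ := exists_int_mul_integral (lam c).2
    refine ⟨D, hD, fun i => ?_⟩
    have : LL lam (c • x) = PowerSeries.C ((lam c : KK) : ℂ) * x := by
      ext i
      simp only [LL, PowerSeries.coeff_mk, PowerSeries.coeff_smul, PowerSeries.coeff_C_mul, smul_eq_mul]
      rw [mul_comm c, lam_mul lam (integral_mem_KK (hx i)), mul_comm]
    rw [this, ← mul_assoc, ← map_intCast (PowerSeries.C (R := ℂ)), ← map_mul, PowerSeries.coeff_C_mul]
    exact h.mul (hx i)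

lemma exists_lam {w : ℂ} (hw : w ≠ 0) : ∃ lam : ℂ →ₗ[KK] KK, lam w ≠ 0 := by
  by_contra! h
  exact hw ((Module.forall_dual_apply_eq_zero_iff KK w).mp h)

lemma rat_int_of_pow {x : ℚ} {D : ℤ} (hD : D ≠ 0)
    (h : ∀ k : ℕ, IsIntegral ℤ ((D : ℂ) * (x : ℂ) ^ k)) : ∃ y : ℤ, (y : ℚ) = x := by
  have h1 : ∀ k : ℕ, ∃ y : ℤ, (y : ℚ) = D * x ^ k := by
    intro k
    have h2 : IsIntegral ℤ ((D : ℚ) * x ^ k) := by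
      have := h k
      have e : ((D : ℂ) * (x : ℂ) ^ k) = algebraMap ℚ ℂ ((D : ℚ) * x ^ k) := by simp
      rw [e] at this
      exact (isIntegral_algebraMap_iff (algebraMap ℚ ℂ).injective).mp this
    obtain ⟨y, hy⟩ := IsIntegrallyClosed.isIntegral_iff.mp h2
    exact ⟨y, by simpa using hy⟩
  have hx : IsIntegral ℤ x := by
    refine IsIntegral.of_mem_of_fg (Algebra.adjoin ℤ {x}) ?_ x (Algebra.subset_adjoin rfl)
    have hle : (Algebra.adjoin ℤ {x}).toSubmodule ≤ Submodule.span ℤ {((D : ℚ))⁻¹} := by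
      rw [Algebra.adjoin_singleton_eq_range_aeval]
      rintro _ ⟨p, rfl⟩
      induction p using Polynomial.induction_on' with
      | add p r hp hr => rw [RingHom.map_add]; exact add_mem hp hr
      | monomial n a =>
        obtain ⟨y, hy⟩ := h1 n
        rw [Submodule.mem_span_singleton]
        refine ⟨a * y, ?_⟩
        have hD' : (D : ℚ) ≠ 0 := by exact_mod_cast hD
        simp [Polynomial.aeval_monomial, hy]
        field_simp
    have hfg : (Submodule.comap (Submodule.span ℤ {((D : ℚ))⁻¹}).subtype
      (Algebra.adjoin ℤ {x}).toSubmodule).FG := IsNoetherian.noetherian _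
    have hfg2 := hfg.map (Submodule.span ℤ {((D : ℚ))⁻¹}).subtype
    rwa [Submodule.map_comap_subtype, inf_eq_right.mpr hle] at hfg2
  obtain ⟨y, hy⟩ := IsIntegrallyClosed.isIntegral_iff.mp hx
  exact ⟨y, by simpa using hy⟩

lemma PS_lowest {d e : PowerSeries ℂ} {i : ℕ} {a : ℕ} (ha : ∀ j < a, PowerSeries.coeff j d = 0)
    (he : ∀ j < i, PowerSeries.coeff j e = 0) :
    (∀ j < a + i, PowerSeries.coeff j (d * e) = 0) ∧ 
      PowerSeries.coeff (a + i) (d * e) = PowerSeries.coeff a d * PowerSeries.coeff i e := by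
  obtain ⟨d', rfl⟩ := PowerSeries.X_pow_dvd_iff.mpr ha
  obtain ⟨e', rfl⟩ := PowerSeries.X_pow_dvd_iff.mpr he
  have : PowerSeries.X ^ a * d' * (PowerSeries.X ^ i * e') = PowerSeries.X ^ (a + i) * (d' * e') := by
    ring
  rw [this]
  refine ⟨fun j hj => ?_, ?_⟩
  · rw [PowerSeries.coeff_X_pow_mul', if_neg (by omega)]
  · simp [PowerSeries.coeff_X_pow_mul']

lemma PS_lowest_pow {e : PowerSeries ℂ} {i : ℕ} 
    (he : ∀ j < i, PowerSeries.coeff j e = 0) (k : ℕ) :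
    (∀ j < k * i, PowerSeries.coeff j (e ^ k) = 0) ∧ 
      PowerSeries.coeff (k * i) (e ^ k) = PowerSeries.coeff i e ^ k := by
  induction k with
  | zero => simp
  | succ k ih =>
    have := PS_lowest ih.1 he
    rw [pow_succ, add_mul, one_mul, pow_succ]
    exact ⟨this.1, by rw [this.2, ih.2]⟩

theorem formal_integrality {N : ℕ} (hN : 0 < N) (c : ℕ → ℚ) {C U V : PowerSeries ℂ} 
    (hC : ∀ i, PowerSeries.coeff i C = (c i : ℂ)) (hU : U ∈ BB) (hV : V ∈ BB) (hV0 : V ≠ 0)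
    (h : C * V = U) (hCN : C ^ N ∈ II) : ∀ i, ∃ y : ℤ, (y : ℚ) = c i := by
  obtain ⟨j, hj⟩ := PowerSeries.exists_coeff_ne_zero_iff_ne_zero.mpr hV0
  obtain ⟨lam, hlam⟩ := exists_lam hj
  obtain ⟨D, hD, h1⟩ := LL_BB lam hU
  obtain ⟨E, hE, h2⟩ := LL_BB lam hV
  have hcK : ∀ i, PowerSeries.coeff i C ∈ algebraicClosure ℚ ℂ := fun i => by
    rw [hC]; exact SubfieldClass.ratCast_mem _ _
  set V' : PowerSeries ℂ := (D * E : ℤ) * LL lam V with hV'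
  have hV'I : V' ∈ II := by
    have := II.mul_mem (intCast_mem II D) h2
    convert this using 1
    rw [hV']; push_cast; ring
  have hCV' : C * V' ∈ II := by
    have := II.mul_mem (intCast_mem II E) h1
    rw [← h, LL_mul lam hcK] at this
    convert this using 1
    rw [hV']; push_cast; ring
  have hV'0 : V' ≠ 0 := by
    refine mul_ne_zero ?_ ?_
    · rw [← map_intCast (PowerSeries.C (R := ℂ))]
      intro h0
      rw [map_eq_zero_iff _ PowerSeries.C_injective] at h0
      exact mul_ne_zero hD hE (by exact_mod_cast h0)
    · intro h0
      apply hlam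
      have := congrArg (PowerSeries.coeff j) h0
      simpa [LL] using this
  set d := V' ^ N with hd
  have hd0 : d ≠ 0 := pow_ne_zero _ hV'0
  have hdC : ∀ k : ℕ, d * C ^ k ∈ II := by
    intro k
    have h3 : V' ^ (N - k % N) * (C * V') ^ (k % N) * (C ^ N) ^ (k / N) ∈ II :=
      II.mul_mem (II.mul_mem (II.pow_mem hV'I _) (II.pow_mem hCV' _)) (II.pow_mem hCN _)
    convert h3 using 1
    have hk : k % N + N * (k / N) = k := Nat.mod_add_div k N
    have hk2 : N = (N - k % N) + k % N := by have := Nat.mod_lt k hN; omega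
    calc d * C ^ k = V' ^ ((N - k % N) + k % N) * C ^ (k % N + N * (k / N)) := by
          rw [hk, ← hk2]
      _ = _ := by rw [pow_add, pow_add, mul_pow, pow_mul]; ring
  classical
  obtain ⟨a, ha1, ha2⟩ : ∃ a, PowerSeries.coeff a d ≠ 0 ∧ ∀ j < a, PowerSeries.coeff j d = 0 := by
    have hex := PowerSeries.exists_coeff_ne_zero_iff_ne_zero.mpr hd0
    exact ⟨Nat.find hex, Nat.find_spec hex, fun j hj => by simpa using Nat.find_min hex hj⟩
  have hdI : d ∈ II := II.pow_mem hV'I _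
  obtain ⟨F, hF, hF2⟩ := exists_int_mul_integral (inv_mem (integral_mem_KK (hdI a)))
  intro i
  induction i using Nat.strong_induction_on with
  | _ i ih =>
    set T : PowerSeries ℂ := PowerSeries.mk fun j => if j < i then (c j : ℂ) else 0 with hT
    have hTI : T ∈ II := by
      intro j
      rw [hT, PowerSeries.coeff_mk]
      split_ifs with hji
      · obtain ⟨y, hy⟩ := ih j hji
        rw [← hy, Rat.cast_intCast]
        exact isIntegral_algebraMap (R := ℤ) (A := ℂ) (x := y)
      · exact isIntegral_zero
    have hsub : ∀ k : ℕ, d * (C - T) ^ k ∈ II := by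
      intro k
      rw [sub_eq_add_neg, add_pow, Finset.mul_sum]
      refine II.sum_mem fun x _ => ?_
      have := II.mul_mem (II.mul_mem (hdC x) (II.pow_mem (II.neg_mem hTI) (k - x)))
        (natCast_mem II (k.choose x))
      convert this using 1
      ring
    have hlow : ∀ j < i, PowerSeries.coeff j (C - T) = 0 := by
      intro j hj
      simp [hT, hC, hj]
    have hlow2 : PowerSeries.coeff i (C - T) = c i := by
      simp [hT, hC]
    refine rat_int_of_pow hF fun k => ?_
    have h4 := PS_lowest_pow hlow k
    have h5 := (PS_lowest ha2 h4.1).2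
    have h6 := hsub k (a + k * i)
    rw [h5, h4.2, hlow2] at h6
    have := hF2.mul h6
    rwa [mul_assoc, ← mul_assoc (_⁻¹), inv_mul_cancel₀ ha1, one_mul] at this

end Part2

section Part3

open scoped ModularForm


local notation "DD" => ModularForm.discriminant

lemma DD_smul (γ : SL(2, ℤ)) (z : ℍ) : DD (γ • z) = denom γ z ^ 12 * DD z := by
  have h := SlashInvariantForm.slash_action_generators_SL2Z ModularForm.discriminant_S_invariant 
    ModularForm.discriminant_T_invariant γ
  have h2 := congrFun h z
  rw [ModularForm.SL_slash_apply] at h2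
  have hd := denom_ne_zero γ z
  rw [← h2, _root_.zpow_neg]
  field_simp

lemma DD_mdiff : MDifferentiable 𝓘(ℂ) 𝓘(ℂ) DD := CuspForm.discriminant.holo'

lemma DD_bdd : IsBoundedAtImInfty DD := ModularForm.discriminant_isZeroAtImInfty.isBoundedAtImInfty

/-- Functions with expansions in `BB`. -/
def BBf (n : ℕ) : Subalgebra ℂ (ℍ → ℂ) where
  carrier := {φ | ∃ p ∈ BB, HasQ n φ p}
  mul_mem' := by
    rintro a b ⟨p, hp, h1⟩ ⟨r, hr, h2⟩
    exact ⟨p * r, BB.mul_mem hp hr, h1.mul h2⟩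
  add_mem' := by
    rintro a b ⟨p, hp, h1⟩ ⟨r, hr, h2⟩
    exact ⟨p + r, BB.add_mem hp hr, h1.add h2⟩
  algebraMap_mem' := fun c => ⟨_, BB.algebraMap_mem c, HasQ.const n c⟩

lemma E_mem_BBf {n : ℕ} (hn : 0 < n) {k : ℕ} (hk : 3 ≤ k) (hk2 : Even k) :
    ⇑(ModularForm.E hk) ∈ BBf n := by
  have h1 : HasQ 1 (ModularForm.E hk) (qExpansion 1 (ModularForm.E hk)) := by
    intro z
    have := ModularForm.hasSum_qExpansion (ModularForm.E hk) one_pos one_mem_strictPeriods_SL z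
    simpa using this
  refine ⟨_, ?_, h1.expand n hn.ne'⟩
  set b : ℂ := -(2 * k / bernoulli k : ℂ)
  have : PowerSeries.expand n hn.ne' (qExpansion 1 (ModularForm.E hk)) = 
      1 + b • PowerSeries.expand n hn.ne' 
        (PowerSeries.mk fun m => if m = 0 then 0 else (ArithmeticFunction.sigma (k - 1) m : ℂ)) := by
    have h2 : qExpansion 1 (ModularForm.E hk) = 1 + b • 
      (PowerSeries.mk fun m => if m = 0 then 0 else (ArithmeticFunction.sigma (k - 1) m : ℂ)) := by
      ext m
      rw [EisensteinSeries.E_qExpansion_coeff hk hk2]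
      by_cases hm : m = 0 <;> simp [hm, PowerSeries.coeff_one, b]
    rw [h2, map_add, map_one, map_smul]
  rw [this]
  refine BB.add_mem BB.one_mem (BB.smul_mem (II_le_BB fun i => ?_) b)
  rw [PowerSeries.coeff_expand]
  split_ifs
  · rw [PowerSeries.coeff_mk]
    split_ifs
    · exact isIntegral_zero
    · exact isIntegral_natCast (R := ℤ) (B := ℂ) _
  · exact isIntegral_zero

lemma DD_mem_BBf {n : ℕ} (hn : 0 < n) : DD ∈ BBf n := by
  have h4 := E_mem_BBf hn (by norm_num : 3 ≤ 4) (by decide)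
  have h6 := E_mem_BBf hn (by norm_num : 3 ≤ 6) (by decide)
  have := (BBf n).smul_mem ((BBf n).sub_mem ((BBf n).pow_mem h4 3) ((BBf n).pow_mem h6 2)) (1 / 1728)
  convert this using 1
  ext z
  rw [ModularForm.discriminant_eq_E₄_cube_sub_E₆_sq]
  simp
  ring

/-- Functions in `BBf` up to powers of the discriminant. -/
def RR (n : ℕ) (hn : 0 < n) : Subalgebra ℂ (ℍ → ℂ) where
  carrier := {φ | ∃ m : ℕ, DD ^ m * φ ∈ BBf n}
  mul_mem' := by
    rintro a b ⟨m, h1⟩ ⟨k, h2⟩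
    refine ⟨m + k, ?_⟩
    convert (BBf n).mul_mem h1 h2 using 1
    ring
  add_mem' := by
    rintro a b ⟨m, h1⟩ ⟨k, h2⟩
    refine ⟨m + k, ?_⟩
    convert (BBf n).add_mem ((BBf n).mul_mem ((BBf n).pow_mem (DD_mem_BBf hn) k) h1)
      ((BBf n).mul_mem ((BBf n).pow_mem (DD_mem_BBf hn) m) h2) using 1
    ring
  algebraMap_mem' := fun c => ⟨0, by simp⟩

/-- Holomorphic functions, meromorphic at all cusps. -/
def MM : Subalgebra ℂ (ℍ → ℂ) where
  carrier := {φ | MDifferentiable 𝓘(ℂ) 𝓘(ℂ) φ ∧ ∀ γ : SL(2, ℤ), ∃ m : ℕ, 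
    IsBoundedAtImInfty (DD ^ m * fun z => φ (γ • z))}
  mul_mem' := by
    rintro a b ⟨d1, h1⟩ ⟨d2, h2⟩
    refine ⟨d1.mul d2, fun γ => ?_⟩
    obtain ⟨m, h1⟩ := h1 γ
    obtain ⟨k, h2⟩ := h2 γ
    refine ⟨m + k, ?_⟩
    have := h1.mul h2
    unfold IsBoundedAtImInfty
    refine Eq.mp (congrArg (BoundedAtFilter atImInfty) ?_) this
    ext z; simp; ring
  add_mem' := by
    rintro a b ⟨d1, h1⟩ ⟨d2, h2⟩
    refine ⟨d1.add d2, fun γ => ?_⟩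
    obtain ⟨m, h1⟩ := h1 γ
    obtain ⟨k, h2⟩ := h2 γ
    refine ⟨m + k, ?_⟩
    have hp : ∀ j : ℕ, IsBoundedAtImInfty (DD ^ j) := fun j =>
      (boundedFilterSubalgebra ℂ atImInfty).pow_mem DD_bdd j
    have := ((hp k).mul h1).add ((hp m).mul h2)
    unfold IsBoundedAtImInfty
    refine Eq.mp (congrArg (BoundedAtFilter atImInfty) ?_) this
    ext z; simp; ring
  algebraMap_mem' := fun c => ⟨mdifferentiable_const, fun γ => ⟨0, by
    rw [pow_zero, one_mul]
    exact const_boundedAtFilter atImInfty c⟩⟩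

lemma exists_form (m : ℕ) : ∃ M : ModularForm 𝒮ℒ (12 * m : ℤ), 
    (∀ z, M z = ModularForm.E₄ z ^ (3 * m)) ∧ (qExpansion 1 M).coeff 0 = 1 := by
  induction m with
  | zero => exact ⟨ModularForm.mcast (by simp) (1 : ModularForm 𝒮ℒ 0), by
      intro z; rw [ModularForm.mcast_apply]; simp, by
      rw [ModularForm.qExpansion_mcast, ModularForm.qExpansion_one]; simp⟩
  | succ m ih =>
    obtain ⟨M, h1, h2⟩ := ih
    let M3 := (ModularForm.E₄.mul ModularForm.E₄).mul ModularForm.E₄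
    refine ⟨ModularForm.mcast (by push_cast; ring) (M.mul M3), fun z => ?_, ?_⟩
    · rw [ModularForm.mcast_apply]
      simp only [ModularForm.coe_mul, Pi.mul_apply, h1, M3]
      ring
    · rw [ModularForm.qExpansion_mcast, ModularForm.qExpansion_mul one_pos one_mem_strictPeriods_SL,
        ModularForm.qExpansion_mul one_pos one_mem_strictPeriods_SL,
        ModularForm.qExpansion_mul one_pos one_mem_strictPeriods_SL]
      simp only [PowerSeries.coeff_zero_eq_constantCoeff, map_mul] at h2 ⊢
      rw [h2]
      simp only [← PowerSeries.coeff_zero_eq_constantCoeff]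
      rw [EisensteinSeries.E_qExpansion_coeff_zero _ (by decide)]
      simp

lemma form_mem {n : ℕ} (hn : 0 < n) (m : ℕ) : ∀ F : ModularForm 𝒮ℒ (12 * m : ℤ), ⇑F ∈ BBf n := by
  induction m with
  | zero =>
    intro F
    obtain ⟨c, hc⟩ := ModularFormClass.levelOne_weight_zero_const 
      (ModularForm.mcast (by simp) F : ModularForm 𝒮ℒ 0)
    have : ⇑F = Function.const _ c := hc
    rw [this]
    exact (BBf n).algebraMap_mem c
  | succ m ih =>
    intro F
    obtain ⟨M, h1, h2⟩ := exists_form (m + 1)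
    have hc := ModularForm.sub_smul_isCuspForm F M h2
    rw [ModularForm.isCuspForm_iff_coeffZero_eq_zero] at hc
    set G := F - (qExpansion 1 F).coeff 0 • M with hG
    have h3 := ModularForm.discriminant_mul_discriminantEquiv (ModularForm.toCuspForm G hc)
    have h4 := ih (ModularForm.mcast (by push_cast; ring) (CuspForm.discriminantEquiv (ModularForm.toCuspForm G hc)))
    have h5 := (BBf n).add_mem ((BBf n).mul_mem (DD_mem_BBf hn) h4)
      ((BBf n).smul_mem ((BBf n).pow_mem (E_mem_BBf hn (by norm_num : 3 ≤ 4) (by decide)) (3 * (m + 1)))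
        ((qExpansion 1 F).coeff 0))
    convert h5 using 1
    ext z
    have h6 := congrFun h3 z
    rw [ModularForm.toCuspForm_apply] at h6
    have h7 : G z = F z - (qExpansion 1 F).coeff 0 * M z := by
      rw [hG]; rfl
    rw [h7, h1] at h6
    have h8 : F z = (F z - (qExpansion 1 F).coeff 0 * ModularForm.E₄ z ^ (3 * (m + 1))) +
      (qExpansion 1 F).coeff 0 * ModularForm.E₄ z ^ (3 * (m + 1)) := by ring
    rw [← h6] at h8
    exact h8

theorem level_one_mem {n : ℕ} (hn : 0 < n) {φ : ℍ → ℂ} (hφ : φ ∈ MM)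
    (hinv : ∀ (γ : SL(2, ℤ)) z, φ (γ • z) = φ z) : φ ∈ RR n hn := by
  obtain ⟨hd, h⟩ := hφ
  obtain ⟨m, hm⟩ := h 1
  have hsl : ∀ γ : SL(2, ℤ), (DD ^ m * φ) ∣[(12 * m : ℤ)] (γ : SL(2, ℤ)) = DD ^ m * φ := by
    intro γ
    ext z
    rw [ModularForm.SL_slash_apply]
    have hd := denom_ne_zero γ z
    simp only [Pi.mul_apply, Pi.pow_apply, DD_smul, hinv]
    rw [_root_.zpow_neg, mul_pow, _root_.zpow_mul]
    norm_cast
    field_simp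
  have hdd : MDifferentiable 𝓘(ℂ) 𝓘(ℂ) (DD ^ m * φ) := by
    refine MDifferentiable.mul ?_ hd
    exact DD_mdiff.pow m
  let F : ModularForm 𝒮ℒ (12 * m : ℤ) := 
    { toFun := DD ^ m * φ
      slash_action_eq' := by
        rintro A ⟨A, rfl⟩
        exact hsl A
      holo' := hdd
      bdd_at_cusps' := by
        intro c hc
        rw [Subgroup.IsArithmetic.isCusp_iff_isCusp_SL2Z] at hc
        rw [OnePoint.isBoundedAt_iff_forall_SL2Z hc]
        intro γ _
        rw [hsl]
        simpa using hm }
  exact ⟨m, form_mem hn m F⟩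

end Part3

section Part4

open scoped ModularForm

local notation "DD" => ModularForm.discriminant

open EisensteinSeries in
/-- Partial Eisenstein series of weight twelve. -/
def GS (S : Set (Fin 2 → ℤ)) (z : ℍ) : ℂ := ∑' v, S.indicator (fun v => eisSummand 12 v z) v

/-- Translate of a set of row vectors. -/
def actS (S : Set (Fin 2 → ℤ)) (γ : SL(2, ℤ)) : Set (Fin 2 → ℤ) := {w | w ᵥ* (γ⁻¹ : SL(2, ℤ)).1 ∈ S}

/-- Right multiplication as an equivalence. -/
def actEquiv (γ : SL(2, ℤ)) : (Fin 2 → ℤ) ≃ (Fin 2 → ℤ) where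
  toFun v := v ᵥ* γ.1
  invFun w := w ᵥ* (γ⁻¹ : SL(2, ℤ)).1
  left_inv v := by
    change v ᵥ* γ.1 ᵥ* (γ⁻¹ : SL(2, ℤ)).1 = v
    rw [Matrix.vecMul_vecMul, ← Matrix.SpecialLinearGroup.coe_mul, mul_inv_cancel]; simp
  right_inv v := by
    change v ᵥ* (γ⁻¹ : SL(2, ℤ)).1 ᵥ* γ.1 = v
    rw [Matrix.vecMul_vecMul, ← Matrix.SpecialLinearGroup.coe_mul, inv_mul_cancel]; simp

lemma GS_smul (S : Set (Fin 2 → ℤ)) (γ : SL(2, ℤ)) (z : ℍ) :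
    GS S (γ • z) = denom γ z ^ 12 * GS (actS S γ) z := by
  unfold GS
  rw [← tsum_mul_left, ← (actEquiv γ).tsum_eq
    (fun v => denom γ z ^ 12 * (actS S γ).indicator (fun v => EisensteinSeries.eisSummand 12 v z) v)]
  refine tsum_congr fun v => ?_
  have hmem : actEquiv γ v ∈ actS S γ ↔ v ∈ S := by
    have := (actEquiv γ).left_inv v
    change (actEquiv γ).invFun ((actEquiv γ).toFun v) ∈ S ↔ v ∈ S
    rw [this]
  by_cases hv : v ∈ S
  · rw [Set.indicator_of_mem hv, Set.indicator_of_mem (hmem.mpr hv),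
      EisensteinSeries.eisSummand_SL2_apply]
    norm_cast
  · rw [Set.indicator_of_notMem hv, Set.indicator_of_notMem (fun h => hv (hmem.mp h)), mul_zero]

lemma eis_bound {A B : ℝ} (hB : 0 < B) {z : ℍ} (hz : z ∈ verticalStrip A B) (v : Fin 2 → ℤ) :
    ‖EisensteinSeries.eisSummand 12 v z‖ ≤ 
      EisensteinSeries.r ⟨⟨A, B⟩, hB⟩ ^ (-12 : ℝ) * ‖v‖ ^ (-12 : ℝ) := by
  have := EisensteinSeries.summand_bound_of_mem_verticalStrip (k := 12) (by norm_num) v hB hz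
  simp only [EisensteinSeries.eisSummand, norm_zpow]
  convert this using 1
  rw [← Real.rpow_intCast]; norm_num

lemma eis_bound_summable (C : ℝ) : Summable fun v : Fin 2 → ℤ => C * ‖v‖ ^ (-12 : ℝ) :=
  (EisensteinSeries.summable_one_div_norm_rpow (by norm_num)).mul_left C

lemma indicator_norm_le (S : Set (Fin 2 → ℤ)) (z : ℍ) (v : Fin 2 → ℤ) :
    ‖S.indicator (fun v => EisensteinSeries.eisSummand 12 v z) v‖ ≤ ‖EisensteinSeries.eisSummand 12 v z‖ :=
  norm_indicator_le_norm_self _ _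

lemma GS_summable (S : Set (Fin 2 → ℤ)) (z : ℍ) : 
    Summable fun v => S.indicator (fun v => EisensteinSeries.eisSummand 12 v z) v :=
  (EisensteinSeries.summable_norm_eisSummand (k := 12) (by norm_num) z).of_norm_bounded 
    (indicator_norm_le S z)

lemma GS_bdd (S : Set (Fin 2 → ℤ)) : IsBoundedAtImInfty (GS S) := by
  rw [UpperHalfPlane.isBoundedAtImInfty_iff]
  refine ⟨∑' v : Fin 2 → ℤ, EisensteinSeries.r ⟨⟨1, 2⟩, two_pos⟩ ^ (-12 : ℝ) * ‖v‖ ^ (-12 : ℝ), 2, ?_⟩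
  intro z hz
  obtain ⟨n, hn⟩ := ModularGroup_T_zpow_mem_verticalStrip z one_pos
  simp only [Nat.cast_one, one_mul] at hn
  have hn' := verticalStrip_anti_right _ hz hn
  have e : GS S z = GS (actS S (ModularGroup.T ^ n)⁻¹) ((ModularGroup.T ^ n) • z) := by
    have h1 := GS_smul (actS S (ModularGroup.T ^ n)⁻¹) (ModularGroup.T ^ n) z
    have h2 : denom (ModularGroup.T ^ n : SL(2, ℤ)) z = 1 := by
      rw [ModularGroup.denom_apply]; simp [ModularGroup.coe_T_zpow]
    have h3 : actS (actS S (ModularGroup.T ^ n)⁻¹) (ModularGroup.T ^ n) = S := by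
      ext w
      simp only [actS, Set.mem_ofPred_eq, inv_inv]
      rw [Matrix.vecMul_vecMul, ← Matrix.SpecialLinearGroup.coe_mul, inv_mul_cancel]; simp
    rw [h1, h2, h3]; simp
  rw [e]
  refine (norm_tsum_le_tsum_norm (GS_summable _ _).norm).trans ?_
  refine (GS_summable _ _).norm.tsum_le_tsum (fun v => ?_) (eis_bound_summable _)
  exact (indicator_norm_le _ _ _).trans (eis_bound two_pos hn' v)

lemma GS_mdiff (S : Set (Fin 2 → ℤ)) : MDifferentiable 𝓘(ℂ) 𝓘(ℂ) (GS S) := by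
  rw [UpperHalfPlane.mdifferentiable_iff]
  have hlu : TendstoLocallyUniformly (fun (s : Finset (Fin 2 → ℤ)) (z : ℍ) => 
      ∑ v ∈ s, S.indicator (fun v => EisensteinSeries.eisSummand 12 v z) v) (GS S) Filter.atTop := by
    rw [tendstoLocallyUniformly_iff_forall_isCompact]
    intro K hK
    obtain ⟨A, B, hB, HABK⟩ := subset_verticalStrip_of_isCompact hK
    refine (tendstoUniformlyOn_tsum (hu := eis_bound_summable (EisensteinSeries.r ⟨⟨A, B⟩, hB⟩ ^ (-12 : ℝ)))
      (fun p z hz ↦ ?_)).mono HABK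
    exact (indicator_norm_le _ _ _).trans (eis_bound hB hz p)
  have hlu2 : TendstoLocallyUniformlyOn (fun (s : Finset (Fin 2 → ℤ)) => 
      (fun z : ℍ => ∑ v ∈ s, S.indicator (fun v => EisensteinSeries.eisSummand 12 v z) v) ∘ ofComplex) 
      (GS S ∘ ofComplex) Filter.atTop {z : ℂ | 0 < z.im} := by
    have := (tendstoLocallyUniformlyOn_univ.mpr hlu).comp (t := {z : ℂ | 0 < z.im}) ofComplex 
      (fun _ _ => Set.mem_univ _) ?_
    · exact this
    · intro z hz
      exact (UpperHalfPlane.contMDiffAt_ofComplex (n := 0) hz).continuousAt.continuousWithinAt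
  refine hlu2.differentiableOn (Eventually.of_forall fun s => ?_) isOpen_upperHalfPlaneSet
  refine (DifferentiableOn.fun_sum (u := s) 
    (A := fun v z => S.indicator (fun v => EisensteinSeries.eisSummand 12 v (ofComplex z)) v) fun v _ => ?_)
  by_cases hv : v ∈ S
  · simp only [Set.indicator_of_mem hv]
    exact EisensteinSeries.eisSummand_extension_differentiableOn _ _
  · simp only [Set.indicator_of_notMem hv]
    exact differentiableOn_const _

/-- Normalised weight zero quotient. -/
def hS (S : Set (Fin 2 → ℤ)) (z : ℍ) : ℂ := GS S z / DD z

lemma hS_smul (S : Set (Fin 2 → ℤ)) (γ : SL(2, ℤ)) (z : ℍ) : hS S (γ • z) = hS (actS S γ) z := by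
  unfold hS
  rw [GS_smul, DD_smul]
  have := denom_ne_zero γ z
  have := ModularForm.discriminant_ne_zero z
  field_simp

lemma MDiff_inv {f : ℍ → ℂ} (hf : MDifferentiable 𝓘(ℂ) 𝓘(ℂ) f) (h0 : ∀ z, f z ≠ 0) :
    MDifferentiable 𝓘(ℂ) 𝓘(ℂ) (fun z => (f z)⁻¹) := by
  rw [UpperHalfPlane.mdifferentiable_iff] at hf ⊢
  exact hf.inv fun z _ => h0 _

lemma hS_mem (S : Set (Fin 2 → ℤ)) : hS S ∈ MM := by
  refine ⟨?_, fun γ => ⟨1, ?_⟩⟩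
  · exact (GS_mdiff S).mul (MDiff_inv DD_mdiff ModularForm.discriminant_ne_zero)
  · refine Eq.mp (congrArg IsBoundedAtImInfty ?_) (GS_bdd (actS S γ))
    ext z
    have := ModularForm.discriminant_ne_zero z
    simp only [Pi.mul_apply, pow_one, hS_smul]
    unfold hS
    field_simp

/-- Limit terms. -/
def gR (v : Fin 2 → ℤ) : ℝ := if v 0 = 0 then ((v 1 : ℝ) ^ 12)⁻¹ else 0

/-- Points tending to the cusp. -/
def zk (k : ℕ) : ℍ := ⟨⟨0, k + 2⟩, by change (0:ℝ) < k + 2; positivity⟩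

lemma GS_tendsto (S : Set (Fin 2 → ℤ)) : 
    Tendsto (fun k => GS S (zk k)) atTop (𝓝 (∑' v, S.indicator (fun v => (gR v : ℂ)) v)) := by
  refine tendsto_tsum_of_dominated_convergence (eis_bound_summable (EisensteinSeries.r ⟨⟨1, 2⟩, two_pos⟩ ^ (-12 : ℝ))) ?_ ?_
  · intro v
    by_cases hv : v ∈ S
    · simp only [Set.indicator_of_mem hv]
      unfold gR EisensteinSeries.eisSummand
      split_ifs with h
      · simp [h]
      · rw [Complex.ofReal_zero, tendsto_zero_iff_norm_tendsto_zero]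
        have h1 : ∀ k : ℕ, ‖((v 0 : ℂ) * (zk k : ℂ) + v 1) ^ (-12 : ℤ)‖ ≤ ((k : ℝ) + 1)⁻¹ := by
          intro k
          rw [norm_zpow, _root_.zpow_neg]
          have h2 : (k : ℝ) + 1 ≤ ‖((v 0 : ℂ) * (zk k : ℂ) + v 1)‖ := by
            refine le_trans ?_ (Complex.abs_im_le_norm _)
            have h3 : ((v 0 : ℂ) * (zk k : ℂ) + v 1).im = v 0 * (k + 2) := by
              simp [zk, UpperHalfPlane.coe]
            rw [h3, abs_mul, abs_of_pos (by positivity : (0:ℝ) < k + 2)]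
            have h4 : (1 : ℝ) ≤ |(v 0 : ℝ)| := by
              exact_mod_cast Int.one_le_abs h
            nlinarith
          have h5 : (1 : ℝ) ≤ (k : ℝ) + 1 := by linarith [(Nat.cast_nonneg k : (0:ℝ) ≤ k)]
          refine inv_anti₀ (by linarith) ?_
          have h6 := h5.trans h2
          calc (k : ℝ) + 1 ≤ _ := h2
            _ ≤ _ := by
              have := le_self_pow₀ h6 (by norm_num : 12 ≠ 0)
              exact_mod_cast this
        refine squeeze_zero (fun _ => norm_nonneg _) h1 ?_
        simpa [one_div] using tendsto_one_div_add_atTop_nhds_zero_nat (𝕜 := ℝ)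
    · simp only [Set.indicator_of_notMem hv]
      exact tendsto_const_nhds
  · refine Eventually.of_forall fun k v => ?_
    refine (indicator_norm_le _ _ _).trans (eis_bound two_pos ?_ v)
    rw [mem_verticalStrip_iff]
    change |(0:ℝ)| ≤ 1 ∧ (2:ℝ) ≤ k + 2
    simp

lemma gR_nonneg (v : Fin 2 → ℤ) : 0 ≤ gR v := by
  unfold gR; split_ifs <;> positivity

lemma gR_bound_hasSum : HasSum (fun d : ℤ => 1 / (d : ℝ) ^ 2) (π ^ 2 / 6 + π ^ 2 / 6) := by
  have h1 : HasSum (fun n : ℕ => 1 / ((n : ℤ) : ℝ) ^ 2) (π ^ 2 / 6) := by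
    simpa using hasSum_zeta_two
  have h2 : HasSum (fun n : ℕ => 1 / ((-(n : ℤ) : ℤ) : ℝ) ^ 2) (π ^ 2 / 6) := by
    simpa using hasSum_zeta_two
  simpa using HasSum.of_nat_of_neg (f := fun d : ℤ => 1 / (d : ℝ) ^ 2) h1 h2

/-- Embedding of the second coordinate. -/
def vec0 (d : ℤ) : Fin 2 → ℤ := ![0, d]

lemma vec0_inj : Function.Injective vec0 := fun a b h => by
  have := congrFun h 1
  simpa [vec0] using this

lemma gR_support (S : Set (Fin 2 → ℤ)) : Function.support (S.indicator gR) ⊆ Set.range vec0 := by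
  intro v hv
  have h0 : v 0 = 0 := by
    by_contra h
    apply hv
    by_cases hs : v ∈ S <;> simp [hs, gR, h]
  exact ⟨v 1, by ext i; fin_cases i <;> simp [vec0, h0]⟩

lemma gR_le (d : ℤ) : gR (vec0 d) ≤ 1 / (d : ℝ) ^ 2 := by
  simp only [gR, vec0, Matrix.cons_val_zero, if_true, Matrix.cons_val_one, one_div]
  by_cases hd : d = 0
  · simp [hd]
  · have : (1 : ℝ) ≤ (d : ℝ) ^ 2 := by
      have : (1 : ℤ) ≤ d ^ 2 := by have := sq_pos_of_ne_zero hd; omega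
      exact_mod_cast this
    refine inv_anti₀ (by positivity) ?_
    calc (d : ℝ) ^ 2 ≤ ((d : ℝ) ^ 2) ^ 6 := le_self_pow₀ this (by norm_num)
      _ = _ := by ring

lemma gR_summable (S : Set (Fin 2 → ℤ)) : Summable (S.indicator gR) := by
  rw [← vec0_inj.summable_iff (fun x hx => by
    by_contra h; exact hx (gR_support S h))]
  refine Summable.of_nonneg_of_le (fun d => ?_) (fun d => ?_) gR_bound_hasSum.summable
  · exact Set.indicator_nonneg (fun v _ => gR_nonneg v) _
  · exact (Set.indicator_le_self' (fun v _ => gR_nonneg v) _).trans (gR_le d)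

lemma LS_ge {S : Set (Fin 2 → ℤ)} (h : ![0, 1] ∈ S) : 1 ≤ ∑' v, S.indicator gR v := by
  have := (gR_summable S).le_tsum ![0, 1] (fun v _ => Set.indicator_nonneg (fun v _ => gR_nonneg v) _)
  rw [Set.indicator_of_mem h] at this
  simpa [gR] using this

lemma LS_lt {S : Set (Fin 2 → ℤ)} (h : ![0, 1] ∉ S) (h' : ![0, -1] ∉ S) : 
    ∑' v, S.indicator gR v < 1 := by
  rw [← vec0_inj.tsum_eq (gR_support S)]
  have h3 : ∀ d : ℤ, S.indicator gR (vec0 d) ≤ 1 / 4 * (1 / (d : ℝ) ^ 2) := by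
    intro d
    by_cases hd : vec0 d ∈ S
    · rw [Set.indicator_of_mem hd]
      simp only [gR, vec0, Matrix.cons_val_zero, if_true, Matrix.cons_val_one, one_div]
      by_cases hd0 : d = 0
      · simp [hd0]
      · have hd1 : d ≠ 1 := fun h4 => h (by rw [h4] at hd; exact hd)
        have hd2 : d ≠ -1 := fun h4 => h' (by rw [h4] at hd; exact hd)
        have h5 : (4 : ℤ) ≤ d ^ 2 := by
          have : d ≤ -2 ∨ 2 ≤ d := by omega
          rcases this with h | h <;> nlinarith
        have h6 : (4 : ℝ) ≤ (d : ℝ) ^ 2 := by exact_mod_cast h5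
        rw [← mul_inv]
        refine inv_anti₀ (by positivity) ?_
        calc 4 * (d : ℝ) ^ 2 ≤ (d : ℝ) ^ 2 * (d : ℝ) ^ 2 := by nlinarith
          _ = ((d : ℝ) ^ 2) ^ 2 := by ring
          _ ≤ ((d : ℝ) ^ 2) ^ 6 := pow_le_pow_right₀ (by linarith) (by norm_num)
          _ = _ := by ring
    · rw [Set.indicator_of_notMem hd]; positivity
  have h4 := gR_bound_hasSum.mul_left (1 / 4)
  have h5 := ((gR_summable S).comp_injective vec0_inj).tsum_le_tsum h3 h4.summable
  rw [h4.tsum_eq] at h5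
  refine lt_of_le_of_lt h5 ?_
  have := Real.pi_lt_d2
  have := Real.pi_pos
  nlinarith

theorem hS_sep {S : Set (Fin 2 → ℤ)} {T : Set (Fin 2 → ℤ)} (hT : ![0, 1] ∈ T) (h : hS S = hS T) :
    ![0, 1] ∈ S ∨ ![0, -1] ∈ S := by
  have hG : GS S = GS T := by
    ext z
    have := congrFun h z
    unfold hS at this
    have h0 := ModularForm.discriminant_ne_zero z
    field_simp at this
    exact this
  have h1 := GS_tendsto S
  rw [hG] at h1
  have h2 := tendsto_nhds_unique h1 (GS_tendsto T)
  have h3 : ∀ U : Set (Fin 2 → ℤ), ∑' v, U.indicator (fun v => (gR v : ℂ)) v = ((∑' v, U.indicator gR v : ℝ) : ℂ) := by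
    intro U
    rw [Complex.ofReal_tsum]
    refine tsum_congr fun v => ?_
    by_cases hv : v ∈ U <;> simp [hv]
  rw [h3, h3] at h2
  have h4 : ∑' v, S.indicator gR v = ∑' v, T.indicator gR v := by exact_mod_cast h2
  by_contra hcon
  push Not at hcon
  have h5 := LS_lt hcon.1 hcon.2
  have h6 := LS_ge hT
  linarith

end Part4

section Part5

open scoped ModularForm

local notation "DD" => ModularForm.discriminant

/-- Congruence class of row vectors. -/
def cls (n : ℕ) (v : Fin 2 → ℤ) : Set (Fin 2 → ℤ) := {w | ∀ i, ((w i : ℤ) : ZMod n) = v i}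

lemma cls_self (n : ℕ) (v : Fin 2 → ℤ) : v ∈ cls n v := fun _ => rfl

lemma cls_congr {n : ℕ} {v w : Fin 2 → ℤ} (h : w ∈ cls n v) : cls n w = cls n v := by
  ext u
  exact forall_congr' fun i => by rw [h i]

lemma cls_vecMul {n : ℕ} {v w : Fin 2 → ℤ} (h : w ∈ cls n v) (γ : SL(2, ℤ)) :
    w ᵥ* γ.1 ∈ cls n (v ᵥ* γ.1) := by
  intro i
  have h0 := h 0
  have h1 := h 1
  simp only [Matrix.vecMul, dotProduct, Fin.sum_univ_two]
  push_cast
  rw [h0, h1]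

lemma vecMul_inv_self (v : Fin 2 → ℤ) (γ : SL(2, ℤ)) : v ᵥ* γ.1 ᵥ* (γ⁻¹ : SL(2, ℤ)).1 = v := 
  (actEquiv γ).left_inv v

lemma vecMul_self_inv (v : Fin 2 → ℤ) (γ : SL(2, ℤ)) : v ᵥ* (γ⁻¹ : SL(2, ℤ)).1 ᵥ* γ.1 = v := 
  (actEquiv γ).right_inv v

lemma actS_cls (n : ℕ) (v : Fin 2 → ℤ) (γ : SL(2, ℤ)) : actS (cls n v) γ = cls n (v ᵥ* γ.1) := by
  ext w
  constructor
  · intro h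
    have h' : w ᵥ* (γ⁻¹ : SL(2, ℤ)).1 ∈ cls n v := h
    have := cls_vecMul h' γ
    rwa [vecMul_self_inv] at this
  · intro h
    have := cls_vecMul h γ⁻¹
    rw [vecMul_inv_self] at this
    exact this

lemma hS_cls_smul (n : ℕ) (v : Fin 2 → ℤ) (γ : SL(2, ℤ)) (z : ℍ) : 
    hS (cls n v) (γ • z) = hS (cls n (v ᵥ* γ.1)) z := by
  rw [hS_smul, actS_cls]

lemma hS_stab {n : ℕ} (a : Fin 2 → ℤ) (β γ : SL(2, ℤ)) (hβ : ![0, 1] ᵥ* β.1 = a) 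
    (h : ∀ z, hS (cls n a) (γ • z) = hS (cls n a) z) :
    a ᵥ* γ.1 ∈ cls n a ∨ a ᵥ* γ.1 ∈ cls n (-a) := by
  have h1 : hS (cls n (a ᵥ* γ.1 ᵥ* (β⁻¹ : SL(2, ℤ)).1)) = hS (cls n ![0, 1]) := by
    ext z
    have := h (β⁻¹ • z)
    rw [hS_cls_smul, hS_cls_smul, hS_cls_smul] at this
    rw [this, ← hβ, vecMul_inv_self]
  have neg : (![0, -1] : Fin 2 → ℤ) = - ![0, 1] := by
    ext i; fin_cases i <;> simp
  have sw : ∀ u v : Fin 2 → ℤ, u ∈ cls n v → v ∈ cls n u := fun u v h i => (h i).symm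
  rcases hS_sep (cls_self n _) h1 with h2 | h2
  · left
    have := cls_vecMul h2 β
    rw [vecMul_self_inv, hβ] at this
    exact sw _ _ this
  · right
    rw [neg] at h2
    have := cls_vecMul h2 β
    rw [vecMul_self_inv, Matrix.neg_vecMul, hβ] at this
    exact sw _ _ this

lemma Gamma_of_stab {n : ℕ} (γ : SL(2, ℤ)) 
    (h1 : ∀ z, hS (cls n ![1, 0]) (γ • z) = hS (cls n ![1, 0]) z)
    (h2 : ∀ z, hS (cls n ![1, 1]) (γ • z) = hS (cls n ![1, 1]) z) :
    γ ∈ CongruenceSubgroup.Gamma n ∨ -γ ∈ CongruenceSubgroup.Gamma n := by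
  have k1 := hS_stab ![1, 0] ModularGroup.S γ (by 
    ext i; fin_cases i <;> simp [ModularGroup.S, Matrix.vecMul, dotProduct, Fin.sum_univ_two]) h1
  have k2 := hS_stab ![1, 1] ⟨!![1, 0; 1, 1], by simp⟩ γ (by 
    ext i; fin_cases i <;> simp [Matrix.vecMul, dotProduct, Fin.sum_univ_two]) h2
  have hdet : γ.1 0 0 * γ.1 1 1 - γ.1 0 1 * γ.1 1 0 = 1 := by
    have := γ.2; rwa [Matrix.det_fin_two] at this
  have hdet' : ((γ.1 0 0 : ℤ) : ZMod n) * γ.1 1 1 - (γ.1 0 1 : ℤ) * (γ.1 1 0 : ℤ) = 1 := by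
    exact_mod_cast congrArg (Int.cast : ℤ → ZMod n) hdet
  simp only [CongruenceSubgroup.Gamma_mem]
  simp only [Matrix.SpecialLinearGroup.coe_neg, Matrix.neg_apply]
  simp [cls, Matrix.vecMul, dotProduct, Fin.forall_fin_two, Fin.sum_univ_two] at k1 k2
  push_cast
  rcases k1 with ⟨a, b⟩ | ⟨a, b⟩ <;> rcases k2 with ⟨c, d⟩ | ⟨c, d⟩ <;> grind

lemma Gamma_cls {n : ℕ} {γ δ : SL(2, ℤ)} (v : Fin 2 → ℤ) 
    (h : Matrix.SpecialLinearGroup.map (Int.castRingHom (ZMod n)) γ = 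
      Matrix.SpecialLinearGroup.map (Int.castRingHom (ZMod n)) δ) :
    cls n (v ᵥ* γ.1) = cls n (v ᵥ* δ.1) := by
  apply cls_congr
  intro i
  have : ∀ a b, ((γ.1 a b : ℤ) : ZMod n) = ((δ.1 a b : ℤ) : ZMod n) := by
    intro a b
    have := congrArg (fun M => M.1 a b) h
    simpa using this
  simp only [Matrix.vecMul, dotProduct, Fin.sum_univ_two]
  push_cast
  rw [this, this]

lemma Gamma_fix {n : ℕ} {γ : SL(2, ℤ)} (hγ : γ ∈ CongruenceSubgroup.Gamma n) (v : Fin 2 → ℤ) (z : ℍ) :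
    hS (cls n v) (γ • z) = hS (cls n v) z := by
  rw [hS_cls_smul, Gamma_cls (δ := 1)]
  · simp
  · rw [map_one]; exact hγ

lemma exists_sep0 (n : ℕ) (hn : 0 < n) : ∃ t : ℕ, ∀ γ : SL(2, ℤ), 
    (∀ z, (hS (cls n ![1, 0]) + (t : ℂ) • hS (cls n ![1, 1])) (γ • z) = 
      (hS (cls n ![1, 0]) + (t : ℂ) • hS (cls n ![1, 1])) z) →
      γ ∈ CongruenceSubgroup.Gamma n ∨ -γ ∈ CongruenceSubgroup.Gamma n := by
  by_contra! hcon
  choose γ h1 h2 using hcon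
  haveI : NeZero n := ⟨hn.ne'⟩
  haveI : Finite (SL(2, ZMod n)) := Subtype.finite
  obtain ⟨t, u, htu, he⟩ := Finite.exists_ne_map_eq_of_infinite
    (fun t => Matrix.SpecialLinearGroup.map (Int.castRingHom (ZMod n)) (γ t))
  have e : ∀ v z, hS (cls n v) (γ u • z) = hS (cls n v) (γ t • z) := by
    intro v z
    rw [hS_cls_smul, hS_cls_smul, Gamma_cls v he]
  have e2 : ∀ z, hS (cls n ![1, 1]) (γ t • z) = hS (cls n ![1, 1]) z := by
    intro z
    have a := h1 t z
    have b := h1 u z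
    simp only [Pi.add_apply, Pi.smul_apply, smul_eq_mul, e] at a b
    have hne : (t : ℂ) - u ≠ 0 := by
      rw [sub_ne_zero]; exact_mod_cast htu
    apply mul_left_cancel₀ hne
    linear_combination a - b
  have e1 : ∀ z, hS (cls n ![1, 0]) (γ t • z) = hS (cls n ![1, 0]) z := by
    intro z
    have a := h1 t z
    simp only [Pi.add_apply, Pi.smul_apply, smul_eq_mul, e2] at a
    linear_combination a
  rcases Gamma_of_stab (γ t) e1 e2 with h | h
  · exact (h2 t).1 h
  · exact (h2 t).2 h

end Part5

section Part6

open scoped ModularForm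

local notation "DD" => ModularForm.discriminant

lemma HasQ_regroup {ι : Type} (n : ℕ) (w : ι → ℕ) (hw : ∀ i, {x | w x = i}.Finite) (a : ι → ℂ)
    (ha : ∀ j, IsIntegral ℤ (a j)) (φ : ℍ → ℂ)
    (h : ∀ z : ℍ, HasSum (fun j => a j * (Function.Periodic.qParam n z) ^ (w j)) (φ z)) :
    ∃ p ∈ II, HasQ n φ p := by
  classical
  have hf : ∀ i, Finite {x // w x = i} := fun i => hw i
  have := fun i => Fintype.ofFinite {x // w x = i}
  refine ⟨PowerSeries.mk fun i => ∑ j : {x // w x = i}, a j, ?_, ?_⟩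
  · rw [mem_II]
    intro i
    rw [PowerSeries.coeff_mk]
    exact IsIntegral.sum _ fun j _ => ha j
  · intro z
    have h1 := (Equiv.hasSum_iff (Equiv.sigmaFiberEquiv w)).mpr (h z)
    refine h1.sigma fun i => ?_
    rw [PowerSeries.coeff_mk, Finset.sum_mul]
    have e : ∀ c : {x // w x = i}, ((fun j => a j * Function.Periodic.qParam ↑n ↑z ^ w j) ∘ 
        (Equiv.sigmaFiberEquiv w)) ⟨i, c⟩ = a c * Function.Periodic.qParam n z ^ i := by
      rintro ⟨x, hx⟩
      simp [Equiv.sigmaFiberEquiv, hx]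
    simp_rw [e]
    exact hasSum_fintype _

lemma pnat_fiber_finite (i : ℕ) : {x : ℕ+ × ℕ+ | (x.1 : ℕ) * x.2 = i}.Finite := by
  refine Set.Finite.subset (Set.finite_Iic ((⟨i + 1, by omega⟩, ⟨i + 1, by omega⟩) : ℕ+ × ℕ+)) ?_
  rintro ⟨c, r⟩ h
  have h : (c : ℕ) * r = i := h
  have hc := c.pos
  have hr := r.pos
  refine ⟨?_, ?_⟩
  · change (c : ℕ) ≤ i + 1
    nlinarith
  · change (r : ℕ) ≤ i + 1
    nlinarith

/-- Half of a congruence class. -/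
def clsP (n : ℕ) (v : Fin 2 → ℤ) : Set (Fin 2 → ℤ) := {w | w ∈ cls n v ∧ 0 < w 0}

lemma GS_union {S T : Set (Fin 2 → ℤ)} (h : Disjoint S T) (z : ℍ) : 
    GS (S ∪ T) z = GS S z + GS T z := by
  unfold GS
  rw [Set.indicator_union_of_disjoint h, (GS_summable S z).tsum_add (GS_summable T z)]

lemma GS_neg (S : Set (Fin 2 → ℤ)) (z : ℍ) : GS {w | -w ∈ S} z = GS S z := by
  unfold GS
  rw [← (Equiv.neg (Fin 2 → ℤ)).tsum_eq]
  refine tsum_congr fun v => ?_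
  have e : EisensteinSeries.eisSummand 12 (-v) z = EisensteinSeries.eisSummand 12 v z := by
    unfold EisensteinSeries.eisSummand
    have : (((-v) 0 : ℤ) : ℂ) * z + ((-v) 1 : ℤ) = -((v 0 : ℂ) * z + v 1) := by
      simp; ring
    rw [this, Even.neg_zpow (by decide)]
  by_cases hv : v ∈ S
  · rw [Set.indicator_of_mem (by simpa using hv), Set.indicator_of_mem hv]
    exact e
  · rw [Set.indicator_of_notMem (by simpa using hv), Set.indicator_of_notMem hv]

lemma cls_split {n : ℕ} (hn : 2 ≤ n) (e : ℤ) : 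
    cls n ![1, e] = clsP n ![1, e] ∪ {w | -w ∈ clsP n ![-1, -e]} := by
  ext w
  have key : -w ∈ cls n ![-1, -e] ↔ w ∈ cls n ![1, e] := by
    simp [cls, Fin.forall_fin_two]
  constructor
  · intro h
    have h0 : w 0 ≠ 0 := by
      intro h0
      have := h 0
      rw [h0] at this
      have : Fact (1 < n) := ⟨by omega⟩
      simp at *
    rcases lt_or_gt_of_ne h0 with h1 | h1
    · right; exact ⟨key.mpr h, by simpa using h1⟩
    · left; exact ⟨h, h1⟩
  · rintro (h | h)
    · exact h.1
    · exact key.mp h.1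

lemma cls_disj (n : ℕ) (e : ℤ) : Disjoint (clsP n ![1, e]) {w | -w ∈ clsP n ![-1, -e]} := by
  rw [Set.disjoint_left]
  intro w h1 h2
  have h3 := h1.2
  have h4 : 0 < (-w) 0 := h2.2
  simp at h4
  omega

/-- parametrisation of half lattices. -/
def prm (n : ℕ) (e : ℤ) (x : ℕ+ × ℤ) : Fin 2 → ℤ := ![x.1, e + n * x.2]

lemma prm_inj {n : ℕ} (hn : 0 < n) (e : ℤ) : Function.Injective (prm n e) := by
  rintro ⟨a, b⟩ ⟨c, d⟩ h
  have h0 := congrFun h 0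
  have h1 := congrFun h 1
  simp [prm] at h0 h1
  ext
  · exact_mod_cast congrArg (fun x : ℕ+ => (x : ℕ)) h0
  · rcases h1 with h1 | h1
    · exact h1
    · omega

lemma eis_inner_sum {n : ℕ} (hn : 0 < n) (e : ℤ) (c : ℕ+) (z : ℍ) : 
    ∑' k : ℤ, EisensteinSeries.eisSummand 12 (prm n e (c, k)) z = 
      ((n : ℂ) ^ 12)⁻¹ * ((-2 * ↑Real.pi * Complex.I) ^ 12 / (Nat.factorial 11 : ℂ)) *
        ∑' r : ℕ+, ((r : ℕ) : ℂ) ^ 11 * cexp (2 * π * Complex.I * e / n) ^ (r : ℕ) * 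
          (Function.Periodic.qParam n z) ^ ((c : ℕ) * r) := by
  have hn0 : (n : ℂ) ≠ 0 := by exact_mod_cast hn.ne'
  have him : 0 < (((c : ℕ) * z + e) / n : ℂ).im := by
    have : (((c : ℕ) * z + e) / n : ℂ).im = c * z.im / n := by
      rw [Complex.div_natCast_im]; simp
    rw [this]
    have := c.pos
    have := z.im_pos
    positivity
  have h := EisensteinSeries.qExpansion_identity_pnat (k := 11) (by norm_num) ⟨_, him⟩
  rw [mul_assoc]
  have e1 : ∀ r : ℕ+, ((r : ℕ) : ℂ) ^ 11 * cexp (2 * π * Complex.I * e / n) ^ (r : ℕ) * 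
          (Function.Periodic.qParam n z) ^ ((c : ℕ) * r) = 
      ((r : ℕ) : ℂ) ^ 11 * cexp (2 * π * Complex.I * (((c : ℕ) * z + e) / n)) ^ (r : ℕ) := by
    intro r
    rw [mul_assoc, pow_mul, ← mul_pow, Function.Periodic.qParam, ← Complex.exp_nat_mul, ← Complex.exp_add]
    congr 4
    push_cast
    field_simp
    ring
  simp_rw [e1]
  refine Eq.trans ?_ (congrArg (fun x => ((n : ℂ) ^ 12)⁻¹ * x) h)
  rw [← tsum_mul_left]
  refine tsum_congr fun k => ?_
  simp only [EisensteinSeries.eisSummand, prm, Matrix.cons_val_zero, Matrix.cons_val_one]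
  rw [_root_.zpow_neg, one_div, ← mul_inv, ← mul_pow]
  norm_num
  congr 1
  norm_cast
  congr 1
  push_cast
  field_simp
  ring

lemma GS_clsP_mem {n : ℕ} (hn : 2 ≤ n) (a e : ℤ) : GS (clsP n ![a, e]) ∈ BBf n := by
  classical
  have hn' : 0 < n := by omega
  have : NeZero n := ⟨hn'.ne'⟩
  have hn0 : (n : ℂ) ≠ 0 := by exact_mod_cast hn'.ne'
  set ζ := cexp (2 * π * Complex.I * e / n) with hζ
  have hζn : ζ ^ n = 1 := by
    rw [hζ, ← Complex.exp_nat_mul, Complex.exp_eq_one_iff]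
    exact ⟨e, by field_simp⟩
  have hζ1 : ‖ζ‖ = 1 := Complex.norm_eq_one_of_pow_eq_one hζn hn'.ne'
  have hζi : IsIntegral ℤ ζ := IsIntegral.of_pow hn' (by rw [hζn]; exact isIntegral_one)
  set K := ((n : ℂ) ^ 12)⁻¹ * ((-2 * ↑Real.pi * Complex.I) ^ 12 / (Nat.factorial 11 : ℂ)) with hK
  set A : ℕ+ × ℕ+ → ℂ := fun x => (if ((x.1 : ℕ) : ZMod n) = a then 1 else 0) * 
    (((x.2 : ℕ) : ℂ) ^ 11 * ζ ^ (x.2 : ℕ)) with hA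
  have hAi : ∀ x, IsIntegral ℤ (A x) := by
    intro x
    refine IsIntegral.mul ?_ (IsIntegral.mul (IsIntegral.pow (isIntegral_natCast (R := ℤ) (B := ℂ) _) _) (hζi.pow _))
    split_ifs
    · exact isIntegral_one
    · exact isIntegral_zero
  have hsum : ∀ z : ℍ, Summable fun x => A x * (Function.Periodic.qParam n z) ^ ((x.1 : ℕ) * x.2) := by
    intro z
    refine Summable.of_norm_bounded (summable_prod_mul_pow 11 (UpperHalfPlane.norm_qParam_lt_one n z)).norm ?_
    intro x
    rw [hA]
    simp only [norm_mul, norm_pow, hζ1, one_pow, mul_one]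
    split_ifs <;> simp
  obtain ⟨p, hp, hq⟩ := HasQ_regroup n (fun x : ℕ+ × ℕ+ => (x.1 : ℕ) * x.2) pnat_fiber_finite A hAi 
    (fun z => ∑' x, A x * (Function.Periodic.qParam n z) ^ ((x.1 : ℕ) * x.2)) (fun z => (hsum z).hasSum)
  have hmem := (BBf n).smul_mem (⟨p, II_le_BB hp, hq⟩ : _ ∈ BBf n) K
  convert hmem using 1
  ext z
  simp only [Pi.smul_apply, smul_eq_mul]
  rw [(hsum z).tsum_prod]
  have hinj := prm_inj hn' e
  have hsup : Function.support ((clsP n ![a, e]).indicator (fun v => EisensteinSeries.eisSummand 12 v z)) ⊆ 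
      Set.range (prm n e) := by
    intro w hw
    have hw' : w ∈ clsP n ![a, e] := by
      by_contra h
      exact hw (Set.indicator_of_notMem h _)
    have h1 := hw'.1 1
    simp only [Matrix.cons_val_one] at h1
    have h2 := hw'.2
    rw [eq_comm, ZMod.intCast_eq_intCast_iff_dvd_sub] at h1
    obtain ⟨k, hk⟩ := h1
    refine ⟨(⟨(w 0).toNat, by omega⟩, k), ?_⟩
    ext i
    fin_cases i
    · simp [prm]; omega
    · simp [prm]; simp at hk; omega
  have hS := (GS_summable (clsP n ![a, e]) z).comp_injective hinj
  unfold GS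
  rw [← hinj.tsum_eq hsup]
  rw [show (∑' c, (clsP n ![a, e]).indicator (fun v => EisensteinSeries.eisSummand 12 v z) (prm n e c)) = _ from hS.tsum_prod]
  rw [← tsum_mul_left]
  refine tsum_congr fun c => ?_
  have hm : ∀ k, prm n e (c, k) ∈ clsP n ![a, e] ↔ ((c : ℕ) : ZMod n) = a := by
    intro k
    simp [clsP, cls, prm, Fin.forall_fin_two]
  simp only [Function.comp_apply]
  by_cases hc : ((c : ℕ) : ZMod n) = a
  · simp only [Set.indicator_of_mem ((hm _).mpr hc), hA, hc, if_true, one_mul]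
    exact eis_inner_sum hn' e c z
  · simp only [Set.indicator_of_notMem (fun h => hc ((hm _).mp h)), hA, hc, if_false, zero_mul, tsum_zero, mul_zero]

lemma hS_mem_RR {n : ℕ} (hn : 2 ≤ n) (e : ℤ) : hS (cls n ![1, e]) ∈ RR n (by omega) := by
  refine ⟨1, ?_⟩
  have h := (BBf n).add_mem (GS_clsP_mem hn 1 e) (GS_clsP_mem hn (-1) (-e))
  convert h using 1
  ext z
  simp only [pow_one, Pi.mul_apply, Pi.add_apply, hS]
  rw [mul_div_cancel₀ _ (ModularForm.discriminant_ne_zero z), cls_split hn, GS_union (cls_disj n e), GS_neg]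

/-- A function with given level structure separating cosets. -/
theorem exists_sep {n : ℕ} (hn : 2 ≤ n) : ∃ h : ℍ → ℂ, h ∈ MM ∧ h ∈ RR n (by omega) ∧ 
    (∀ γ ∈ CongruenceSubgroup.Gamma n, ∀ z, h (γ • z) = h z) ∧ 
    (∀ γ : SL(2, ℤ), (∀ z, h (γ • z) = h z) → 
      γ ∈ CongruenceSubgroup.Gamma n ∨ -γ ∈ CongruenceSubgroup.Gamma n) := by
  obtain ⟨t, ht⟩ := exists_sep0 n (by omega)
  refine ⟨_, ?_, ?_, ?_, ht⟩
  · exact MM.add_mem (hS_mem _) (MM.smul_mem (hS_mem _) _)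
  · exact Subalgebra.add_mem _ (hS_mem_RR hn 0) (Subalgebra.smul_mem _ (hS_mem_RR hn 1) _)
  · intro γ hγ z
    simp only [Pi.add_apply, Pi.smul_apply, Gamma_fix hγ]

end Part6

section Part7

open scoped ModularForm

local notation "DD" => ModularForm.discriminant

lemma MM_smul {φ : ℍ → ℂ} (h : φ ∈ MM) (γ : SL(2, ℤ)) : (fun z => φ (γ • z)) ∈ MM := by
  obtain ⟨h1, h2⟩ := h
  refine ⟨?_, fun δ => ?_⟩
  · have : MDifferentiable 𝓘(ℂ) 𝓘(ℂ) (fun z : ℍ => γ • z) := by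
      refine UpperHalfPlane.mdifferentiable_smul (g := (γ : GL (Fin 2) ℝ)) ?_
      simp
    exact h1.comp this
  · obtain ⟨m, hm⟩ := h2 (γ * δ)
    refine ⟨m, ?_⟩
    refine Eq.mp (congrArg IsBoundedAtImInfty ?_) hm
    ext z
    simp [mul_smul]

/-- Action on the algebra of functions. -/
def sig (γ : SL(2, ℤ)) : MM →+* MM where
  toFun φ := ⟨fun z => φ.1 (γ⁻¹ • z), MM_smul φ.2 _⟩
  map_one' := rfl
  map_mul' _ _ := rfl
  map_zero' := rfl
  map_add' _ _ := rfl

lemma sig_apply (γ : SL(2, ℤ)) (φ : MM) (z : ℍ) : (sig γ φ).1 z = φ.1 (γ⁻¹ • z) := rfl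

lemma sig_mul (γ δ : SL(2, ℤ)) (φ : MM) : sig γ (sig δ φ) = sig (γ * δ) φ := by
  apply Subtype.ext
  ext z
  simp only [sig_apply, _root_.mul_inv_rev, mul_smul]

/-- Stabiliser. -/
def stab (φ : MM) : Subgroup SL(2, ℤ) where
  carrier := {γ | sig γ φ = φ}
  mul_mem' := by
    intro a b ha hb
    change sig (a * b) φ = φ
    rw [← sig_mul, hb, ha]
  one_mem' := by
    apply Subtype.ext
    ext z
    simp [sig_apply]
  inv_mem' := by
    intro a ha
    have ha : sig a φ = φ := ha
    change sig a⁻¹ φ = φ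
    conv_lhs => rw [← ha]
    rw [sig_mul, inv_mul_cancel]
    apply Subtype.ext
    ext z
    simp [sig_apply]

lemma mem_stab {φ : MM} {γ : SL(2, ℤ)} : γ ∈ stab φ ↔ sig γ φ = φ := Iff.rfl

/-- Function attached to a coset. -/
def cof (H : Subgroup SL(2, ℤ)) (φ : MM) (x : SL(2, ℤ) ⧸ H) : MM := sig x.out φ

lemma cof_mk {H : Subgroup SL(2, ℤ)} {φ : MM} (h : H ≤ stab φ) (γ : SL(2, ℤ)) : 
    cof H φ (γ : SL(2, ℤ) ⧸ H) = sig γ φ := by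
  obtain ⟨k, hk⟩ := QuotientGroup.mk_out_eq_mul H γ
  unfold cof
  rw [hk, ← sig_mul, mem_stab.mp (h k.2)]

lemma sig_cof {H : Subgroup SL(2, ℤ)} {φ : MM} (h : H ≤ stab φ) (δ : SL(2, ℤ)) (x : SL(2, ℤ) ⧸ H) :
    sig δ (cof H φ x) = cof H φ (δ • x) := by
  induction x using QuotientGroup.induction_on with
  | H γ => 
    rw [cof_mk h, sig_mul]
    exact (cof_mk h _).symm

open Polynomial in
lemma lagrange {n : ℕ} (hn : 0 < n) (h φ : MM) (H : Subgroup SL(2, ℤ)) (hH : H ≤ stab h) [Fintype (SL(2, ℤ) ⧸ H)] 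
    [DecidableEq (SL(2, ℤ) ⧸ H)]
    (hφ : H ≤ stab φ) (hR : h.1 ∈ RR n hn) : 
    (φ * ∏ y ∈ Finset.univ.erase ((1 : SL(2, ℤ)) : SL(2, ℤ) ⧸ H), (h - cof H h y)).1 ∈ RR n hn := by
  set Q : Polynomial MM := ∑ x : SL(2, ℤ) ⧸ H, C (cof H φ x) * ∏ y ∈ Finset.univ.erase x, (X - C (cof H h y)) with hQ
  have hQ1 : ∀ δ, Q.map (sig δ) = Q := by
    intro δ
    rw [hQ, Polynomial.map_sum, ← Equiv.sum_comp (MulAction.toPerm δ : Equiv.Perm (SL(2, ℤ) ⧸ H))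
      (fun x => C (cof H φ x) * ∏ y ∈ Finset.univ.erase x, (X - C (cof H h y)))]
    refine Finset.sum_congr rfl fun x _ => ?_
    rw [Polynomial.map_mul, Polynomial.map_C, sig_cof hφ, Polynomial.map_prod]
    refine congrArg (fun t => C (cof H φ (δ • x)) * t) ?_
    refine Finset.prod_bij (fun (y : SL(2, ℤ) ⧸ H) _ => δ • y) ?_ ?_ ?_ ?_
    · intro y hy
      simp at hy ⊢
      exact hy
    · intro a _ b _ hab
      exact MulAction.injective δ hab
    · intro b hb
      refine ⟨δ⁻¹ • b, ?_, by simp⟩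
      simp at hb ⊢
      intro hc
      apply hb
      rw [← hc]; simp
    · intro y _
      simp [sig_cof (hH)]
  have hc : ∀ i, (Q.coeff i).1 ∈ RR n hn := by
    intro i
    refine level_one_mem hn (Q.coeff i).2 fun γ z => ?_
    have := congrArg (fun P => P.coeff i) (hQ1 γ⁻¹)
    simp only [Polynomial.coeff_map] at this
    have := congrFun (congrArg Subtype.val this) z
    rw [sig_apply, inv_inv] at this
    exact this
  have h1 : ∀ {ψ : MM} (hψ : H ≤ stab ψ), cof H ψ ((1 : SL(2, ℤ)) : SL(2, ℤ) ⧸ H) = ψ := by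
    intro ψ hψ
    rw [cof_mk hψ]
    exact (stab ψ).one_mem
  have hev : Q.eval h = φ * ∏ y ∈ Finset.univ.erase ((1 : SL(2, ℤ)) : SL(2, ℤ) ⧸ H), (h - cof H h y) := by
    rw [hQ, Polynomial.eval_finsetSum, Finset.sum_eq_single ((1 : SL(2, ℤ)) : SL(2, ℤ) ⧸ H)]
    · rw [Polynomial.eval_mul, Polynomial.eval_C, h1 hφ, Polynomial.eval_prod]
      simp
    · intro x _ hx
      rw [Polynomial.eval_mul, Polynomial.eval_prod, Finset.prod_eq_zero (i := ((1 : SL(2, ℤ)) : SL(2, ℤ) ⧸ H)), mul_zero]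
      · simp [hx.symm]
      · simp [h1 (hH)]
    · simp
  rw [← hev, Polynomial.eval_eq_sum, Polynomial.sum]
  have : ((∑ i ∈ Q.support, Q.coeff i * h ^ i : MM) : ℍ → ℂ) = ∑ i ∈ Q.support, (Q.coeff i).1 * h.1 ^ i := by
    push_cast; rfl
  rw [this]
  exact Subalgebra.sum_mem _ fun i _ => Subalgebra.mul_mem _ (hc i) (Subalgebra.pow_mem _ hR i)

theorem exists_frac {n : ℕ} (hn : 2 ≤ n) {f : ℍ → ℂ} (hf : f ∈ MM) 
    (hinv : ∀ γ ∈ CongruenceSubgroup.Gamma n, ∀ z, f (γ • z) = f z) :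
    ∃ V : ℍ → ℂ, V ≠ 0 ∧ V ∈ RR n (by omega) ∧ f * V ∈ RR n (by omega) := by
  classical
  obtain ⟨h0, hM, hR, hG, hsep⟩ := exists_sep hn
  set h : MM := ⟨h0, hM⟩ with hh
  set φ : MM := ⟨f, hf⟩ with hφ
  have hst : ∀ γ, γ ∈ stab h ↔ ∀ z, h0 (γ • z) = h0 z := by
    intro γ
    rw [← inv_mem_iff, mem_stab, Subtype.ext_iff, funext_iff]
    simp only [sig_apply, inv_inv]
    rfl
  have hle : CongruenceSubgroup.Gamma n ≤ stab h := fun γ hγ => (hst γ).mpr (hG γ hγ)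
  have : NeZero n := ⟨by omega⟩
  have : (stab h).FiniteIndex := Subgroup.finiteIndex_of_le hle
  have : Fintype (SL(2, ℤ) ⧸ stab h) := Fintype.ofFinite _
  have key : stab h ≤ stab φ := by
    intro γ hγ
    have hγ' := (stab h).inv_mem hγ
    rw [mem_stab]
    apply Subtype.ext
    ext z
    rw [sig_apply]
    rcases hsep γ⁻¹ ((hst _).mp hγ') with h | h
    · exact hinv _ h z
    · have := hinv _ h z
      rw [ModularGroup.SL_neg_smul] at this
      exact this
  have k1 := lagrange (by omega : 0 < n) h 1 (stab h) le_rfl (by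
    intro γ _; rfl) hR
  have k2 := lagrange (by omega : 0 < n) h φ (stab h) le_rfl key hR
  refine ⟨_, ?_, k1, ?_⟩
  · have e : (1 * ∏ y ∈ Finset.univ.erase ((1 : SL(2, ℤ)) : SL(2, ℤ) ⧸ stab h), (h - cof (stab h) h y) : MM).1 = 
      ∏ y ∈ Finset.univ.erase ((1 : SL(2, ℤ)) : SL(2, ℤ) ⧸ stab h), (h - cof (stab h) h y).1 := by
      rw [one_mul]; push_cast; rfl
    rw [e, Ne, UpperHalfPlane.prod_eq_zero_iff (fun i _ => (h - cof (stab h) h i).2.1)]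
    push Not
    intro y hy h0
    have h1 : h - cof (stab h) h y = 0 := Subtype.ext h0
    rw [sub_eq_zero] at h1
    have h2 : y.out ∈ stab h := h1.symm
    apply Finset.ne_of_mem_erase hy
    rw [← QuotientGroup.out_eq' y, QuotientGroup.eq]
    simpa using h2
  · have e : (φ * ∏ y ∈ Finset.univ.erase ((1 : SL(2, ℤ)) : SL(2, ℤ) ⧸ stab h), (h - cof (stab h) h y) : MM).1 = 
      f * (1 * ∏ y ∈ Finset.univ.erase ((1 : SL(2, ℤ)) : SL(2, ℤ) ⧸ stab h), (h - cof (stab h) h y) : MM).1 := by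
      rw [one_mul]; rfl
    rw [e] at k2
    exact k2

end Part7

section Part8

open scoped ModularForm

local notation "DD" => ModularForm.discriminant

lemma unit_mem_MM {f : ℍ → ℂ} (hf : IsModularUnit f) : f ∈ MM := by
  obtain ⟨h1, -, -, h4⟩ := hf
  refine ⟨h1, fun γ => ?_⟩
  obtain ⟨α, κ, -, hκ⟩ := h4 γ
  obtain ⟨m, hm⟩ := exists_nat_ge (-α)
  refine ⟨m, ?_⟩
  have hp := ModularForm.tendsto_atImInfty_tprod_one_sub_eta_q_pow
  have b1 := (hp.pow m).isBigO_one (F := ℝ)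
  have b2 := hκ.isBigO_one (F := ℝ)
  have b3 : (fun z : ℍ => Function.Periodic.qParam 1 z ^ m * cexp (2 * π * Complex.I * α * z)) 
      =O[atImInfty] (fun _ => (1 : ℝ)) := by
    refine Asymptotics.IsBigO.of_bound 1 (Eventually.of_forall fun z => ?_)
    rw [norm_mul, norm_pow, Function.Periodic.norm_qParam, Complex.norm_exp, ← Real.exp_nat_mul, ← Real.exp_add]
    simp only [norm_one, mul_one, Real.exp_le_one_iff]
    have e : (2 * π * Complex.I * α * z : ℂ).re = - (2 * π * α * z.im) := by
      simp [mul_assoc]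
    rw [e]
    have h5 : 0 ≤ π * z.im * (m + α) := by
      have := z.im_pos
      have := Real.pi_pos
      have : 0 ≤ m + α := by linarith
      positivity
    have : (z : ℂ).im = z.im := rfl
    rw [this]
    nlinarith
  have b := (b1.mul b2).mul b3
  unfold IsBoundedAtImInfty BoundedAtFilter
  simp only [mul_one] at b
  refine Asymptotics.IsBigO.congr b ?_ (fun _ => rfl)
  intro z
  simp only [Pi.mul_apply, Pi.pow_apply]
  rw [ModularForm.discriminant_eq_q_prod, mul_pow, Complex.exp_neg]
  have := Complex.exp_ne_zero (2 * π * Complex.I * α * z)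
  field_simp

theorem int_coeffs {f : ℍ → ℂ} (hf : IsModularUnit f) (s : ℚ) (c : ℕ → ℚ) (P : PowerSeries ℂ)
    (hP : ∀ i, PowerSeries.coeff i P = (c i : ℂ)) 
    (hq : HasQ 1 (fun z => f z * Complex.exp (-(2 * (π : ℂ) * Complex.I * (s : ℂ) * (z : ℂ)))) P)
    {N : ℕ} (hN : 0 < N) (hPN : P ^ N ∈ II) : ∀ i, ∃ y : ℤ, (y : ℚ) = c i := by
  have hMM := unit_mem_MM hf
  obtain ⟨h1, h2, ⟨M, hM0, hM⟩, h4⟩ := hf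
  set n := 2 * M * s.den with hn
  have hsd := s.den_pos
  have hn2 : 2 ≤ n := by
    rw [hn]
    have : 1 ≤ M * s.den := Nat.mul_pos hM0 hsd
    nlinarith
  have hn0 : 0 < n := by omega
  have hn0' : n ≠ 0 := by omega
  have hle : ∀ γ ∈ CongruenceSubgroup.Gamma n, ∀ z, f (γ • z) = f z := by
    intro γ hγ
    apply hM
    rw [CongruenceSubgroup.Gamma_mem] at hγ ⊢
    have hd : M ∣ n := ⟨2 * s.den, by rw [hn]; ring⟩
    have cast : ∀ a b : ℤ, (a : ZMod n) = b → (a : ZMod M) = b := by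
      intro a b hab
      rw [ZMod.intCast_eq_intCast_iff_dvd_sub] at hab ⊢
      exact (by exact_mod_cast hd : (M : ℤ) ∣ n).trans hab
    refine ⟨?_, ?_, ?_, ?_⟩
    · exact_mod_cast cast _ 1 (by exact_mod_cast hγ.1)
    · exact_mod_cast cast _ 0 (by exact_mod_cast hγ.2.1)
    · exact_mod_cast cast _ 0 (by exact_mod_cast hγ.2.2.1)
    · exact_mod_cast cast _ 1 (by exact_mod_cast hγ.2.2.2)
  obtain ⟨V, hV0, ⟨m, hV⟩, ⟨k, hU⟩⟩ := exists_frac hn2 hMM hle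
  have hD := fun j => (BBf n).pow_mem (DD_mem_BBf hn0) j
  have hV' := (BBf n).mul_mem (hD k) hV
  have hU' := (BBf n).mul_mem (hD m) hU
  obtain ⟨v, hvB, hv⟩ := hV'
  obtain ⟨u, huB, hu⟩ := hU'
  set t : ℤ := 2 * M * s.num with ht
  have hts : (n : ℂ) * s = t := by
    rw [hn, ht]
    push_cast
    have h5 : (s.den : ℂ) ≠ 0 := by exact_mod_cast hsd.ne'
    have h6 : (s : ℂ) = s.num / s.den := by
      conv_lhs => rw [← Rat.num_div_den s]
      push_cast; rfl
    rw [h6]; field_simp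
  obtain ⟨a, b, hab⟩ : ∃ a b : ℕ, t = a - b := ⟨t.toNat, (-t).toNat, by omega⟩
  have hA := (hq.expand n hn0').mul ((HasQ.qpow n a).mul hv)
  have hB := (HasQ.qpow n b).mul hu
  have heq : PowerSeries.expand n hn0' P * (PowerSeries.X ^ a * v) = PowerSeries.X ^ b * u := by
    refine hA.unique hn0 (Eq.mp (congrArg (fun x => HasQ n x _) ?_) hB)
    ext z
    simp only [Pi.mul_apply, Pi.pow_apply]
    have : Function.Periodic.qParam n z ^ b = cexp (-(2 * π * Complex.I * s * z)) * Function.Periodic.qParam n z ^ a := by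
      unfold Function.Periodic.qParam
      rw [← Complex.exp_nat_mul, ← Complex.exp_nat_mul, ← Complex.exp_add]
      congr 1
      have h5 : (n : ℂ) ≠ 0 := by exact_mod_cast hn0'
      have h6 : (s : ℂ) = (a - b) / n := by
        rw [eq_div_iff h5, mul_comm, hts, hab]; push_cast; rfl
      rw [h6]
      push_cast
      field_simp
      ring
    rw [this]
    ring
  have hXB : ∀ j : ℕ, (PowerSeries.X ^ j : PowerSeries ℂ) ∈ BB := by
    intro j
    refine II_le_BB (mem_II.mpr fun i => ?_)
    rw [PowerSeries.coeff_X_pow]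
    split_ifs
    · exact isIntegral_one
    · exact isIntegral_zero
  have hne : PowerSeries.X ^ a * v ≠ 0 := by
    refine mul_ne_zero (pow_ne_zero _ PowerSeries.X_ne_zero) ?_
    rintro rfl
    apply hV0
    ext z
    have h5 := hv z
    simp only [map_zero, zero_mul] at h5
    replace h5 := h5.unique hasSum_zero
    simpa [ModularForm.discriminant_ne_zero] using h5
  have hfint := formal_integrality hN (fun i => if n ∣ i then c (i / n) else 0) (C := PowerSeries.expand n hn0' P)
    (by 
      intro i
      rw [PowerSeries.coeff_expand]
      split_ifs
      · rw [hP]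
      · simp) (BB.mul_mem (hXB b) huB) (BB.mul_mem (hXB a) hvB) hne heq (by
      rw [← map_pow, mem_II]
      intro i
      rw [PowerSeries.coeff_expand]
      split_ifs
      · exact hPN _
      · exact isIntegral_zero)
  intro i
  obtain ⟨y, hy⟩ := hfint (n * i)
  refine ⟨y, ?_⟩
  simpa [hn0'] using hy

end Part8

section Part9

lemma pow_est (ρ : ℝ) (hρ0 : 0 ≤ ρ) (hρ : ρ < 1) (k : ℕ) : 
    ∃ C : ℝ, 0 ≤ C ∧ ∀ x : ℂ, ‖x‖ ≤ ρ → ‖(1 - x) ^ k - 1‖ ≤ C * ‖x‖ := by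
  induction k with
  | zero => exact ⟨0, le_rfl, fun x _ => by simp⟩
  | succ k ih =>
    obtain ⟨C, hC0, hC⟩ := ih
    refine ⟨2 * C + 1, by positivity, fun x hx => ?_⟩
    have e : (1 - x) ^ (k + 1) - 1 = ((1 - x) ^ k - 1) * (1 - x) - x := by ring
    have h1 : ‖1 - x‖ ≤ 2 := by
      refine (norm_sub_le _ _).trans ?_
      rw [norm_one]; linarith
    rw [e]
    refine (norm_sub_le _ _).trans ?_
    rw [norm_mul]
    have := mul_le_mul (hC x hx) h1 (norm_nonneg _) (by positivity)
    linarith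

lemma zpow_est (ρ : ℝ) (hρ0 : 0 ≤ ρ) (hρ : ρ < 1) (k : ℤ) : 
    ∃ C : ℝ, 0 ≤ C ∧ ∀ x : ℂ, ‖x‖ ≤ ρ → ‖(1 - x) ^ k - 1‖ ≤ C * ‖x‖ := by
  obtain ⟨m, rfl | rfl⟩ := k.eq_nat_or_neg
  · exact_mod_cast pow_est ρ hρ0 hρ m
  · obtain ⟨C, hC0, hC⟩ := pow_est ρ hρ0 hρ m
    have h1 : 0 < 1 - ρ := by linarith
    refine ⟨C / (1 - ρ) ^ m, by positivity, fun x hx => ?_⟩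
    have h2 : 1 - ρ ≤ ‖1 - x‖ := by
      have := norm_sub_norm_le 1 x
      rw [norm_one] at this; linarith
    have h3 : (1 - x) ≠ 0 := by rw [← norm_pos_iff]; linarith
    have h4 : (1 - x) ^ (-(m : ℤ)) - 1 = -((1 - x) ^ m - 1) / (1 - x) ^ m := by
      rw [_root_.zpow_neg, zpow_natCast]; field_simp; ring
    rw [h4, norm_div, norm_neg, norm_pow, div_mul_eq_mul_div]
    refine div_le_div₀ (by positivity) (hC x hx) (by positivity) ?_
    exact pow_le_pow_left₀ h1.le h2 m

lemma bdd_est (ρ : ℝ) (hρ0 : 0 ≤ ρ) (hρ : ρ < 1) (B : ℕ) : 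
    ∃ C : ℝ, 0 ≤ C ∧ ∀ b : ℤ, |b| ≤ B → ∀ x : ℂ, ‖x‖ ≤ ρ → ‖(1 - x) ^ b - 1‖ ≤ C * ‖x‖ := by
  choose C hC0 hC using zpow_est ρ hρ0 hρ
  refine ⟨∑ b ∈ Finset.Icc (-B : ℤ) B, C b, Finset.sum_nonneg fun b _ => hC0 b, fun b hb x hx => ?_⟩
  refine (hC b x hx).trans ?_
  gcongr
  refine Finset.single_le_sum (f := C) (fun b _ => hC0 b) ?_
  rw [Finset.mem_Icc]; exact abs_le.mp hb

/-- Bounded exponent systems. -/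
def Bdd (b : ℕ → ℤ) : Prop := ∃ B : ℕ, ∀ n, |b n| ≤ B

lemma Bdd.add {b c : ℕ → ℤ} (hb : Bdd b) (hc : Bdd c) : Bdd (b + c) := by
  obtain ⟨B, hB⟩ := hb
  obtain ⟨C, hC⟩ := hc
  refine ⟨B + C, fun n => (abs_add_le _ _).trans ?_⟩
  push_cast
  exact add_le_add (hB n) (hC n)

lemma Bdd.smul {b : ℕ → ℤ} (hb : Bdd b) (k : ℤ) : Bdd (k • b) := by
  obtain ⟨B, hB⟩ := hb
  refine ⟨k.natAbs * B, fun n => ?_⟩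
  simp only [Pi.smul_apply, smul_eq_mul, abs_mul]
  push_cast
  exact mul_le_mul_of_nonneg_left (hB n) (abs_nonneg _)

lemma Bdd.zero : Bdd 0 := ⟨0, fun n => by simp⟩

lemma Bdd.sum {ι : Type} (s : Finset ι) (b : ι → ℕ → ℤ) (hb : ∀ i ∈ s, Bdd (b i)) : Bdd (∑ i ∈ s, b i) := by
  classical
  induction s using Finset.induction_on with
  | empty => simpa using Bdd.zero
  | insert a s ha ih =>
    rw [Finset.sum_insert ha]
    exact (hb a (by simp)).add (ih fun i hi => hb i (by simp [hi]))

/-- Generalised product. -/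
def PP (b : ℕ → ℤ) (q : ℂ) : ℂ := ∏' n : ℕ, (1 - q ^ (n + 1)) ^ b n

lemma one_sub_ne {q : ℂ} (hq : ‖q‖ < 1) (n : ℕ) : 1 - q ^ (n + 1) ≠ 0 := by
  intro h
  have : ‖q ^ (n + 1)‖ = 1 := by rw [← sub_eq_zero.mp h, norm_one]
  rw [norm_pow] at this
  have h2 : ‖q‖ ^ (n + 1) < 1 := pow_lt_one₀ (norm_nonneg q) hq (Nat.succ_ne_zero n)
  linarith

lemma pow_le_rho {q : ℂ} {ρ : ℝ} (hρ : ρ < 1) (hq : ‖q‖ ≤ ρ) (n : ℕ) : ‖q ^ (n + 1)‖ ≤ ρ := by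
  rw [norm_pow, pow_succ']
  have h0 := norm_nonneg q
  have : ‖q‖ ^ n ≤ 1 := pow_le_one₀ h0 (by linarith)
  nlinarith

lemma geom_summable {ρ : ℝ} (hρ0 : 0 ≤ ρ) (hρ : ρ < 1) (C : ℝ) : Summable fun n : ℕ => C * ρ ^ (n + 1) := by
  refine Summable.mul_left C ?_
  exact (summable_nat_add_iff 1).mpr (summable_geometric_of_lt_one hρ0 hρ)

lemma PP_mult {b : ℕ → ℤ} (hb : Bdd b) {q : ℂ} (hq : ‖q‖ < 1) : 
    Multipliable fun n : ℕ => (1 - q ^ (n + 1)) ^ b n := by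
  obtain ⟨B, hB⟩ := hb
  obtain ⟨C, hC0, hC⟩ := bdd_est ‖q‖ (norm_nonneg _) hq B
  have : Summable fun n : ℕ => ‖(1 - q ^ (n + 1)) ^ b n - 1‖ := by
    refine Summable.of_nonneg_of_le (fun n => norm_nonneg _) (fun n => ?_) (geom_summable (norm_nonneg q) hq C)
    rw [← norm_pow]
    exact hC _ (hB n) _ (pow_le_rho hq le_rfl n)
  simpa using multipliable_one_add_of_summable this

lemma PP_zero (q : ℂ) : PP 0 q = 1 := by simp [PP]

lemma PP_add {b c : ℕ → ℤ} (hb : Bdd b) (hc : Bdd c) {q : ℂ} (hq : ‖q‖ < 1) : 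
    PP (b + c) q = PP b q * PP c q := by
  unfold PP
  rw [← (PP_mult hb hq).tprod_mul (PP_mult hc hq)]
  refine tprod_congr fun n => ?_
  rw [Pi.add_apply, zpow_add₀ (one_sub_ne hq n)]

lemma PP_ne {b : ℕ → ℤ} (hb : Bdd b) {q : ℂ} (hq : ‖q‖ < 1) : PP b q ≠ 0 := by
  intro h
  have := PP_add hb (hb.smul (-1)) hq
  rw [h, zero_mul] at this
  simp [PP_zero] at this

lemma PP_zsmul {b : ℕ → ℤ} (hb : Bdd b) (k : ℤ) {q : ℂ} (hq : ‖q‖ < 1) : 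
    PP (k • b) q = PP b q ^ k := by
  have h0 := PP_ne hb hq
  induction k using Int.induction_on with
  | zero => simp [PP_zero]
  | succ i ih => rw [add_smul, one_smul, PP_add (hb.smul _) hb hq, ih, zpow_add_one₀ h0]
  | pred i ih => 
    have := PP_add (hb.smul (-i - 1)) hb hq
    rw [sub_smul, one_smul, sub_add_cancel, ih] at this
    rw [zpow_sub_one₀ h0, this, sub_smul, one_smul]
    field_simp

lemma PP_sum {ι : Type} (s : Finset ι) (b : ι → ℕ → ℤ) (hb : ∀ i, Bdd (b i)) {q : ℂ} (hq : ‖q‖ < 1) : 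
    PP (∑ i ∈ s, b i) q = ∏ i ∈ s, PP (b i) q := by
  classical
  induction s using Finset.induction_on with
  | empty => simp [PP_zero]
  | insert a s ha ih =>
    rw [Finset.sum_insert ha, Finset.prod_insert ha, PP_add (hb a) (Bdd.sum _ _ fun i _ => hb i) hq, ih]

lemma PP_cont {b : ℕ → ℤ} (hb : Bdd b) : ContinuousOn (PP b) (Metric.ball 0 1) := by
  intro q hq
  refine ContinuousAt.continuousWithinAt ?_
  rw [mem_ball_zero_iff] at hq
  obtain ⟨ρ, h1, h2⟩ := exists_between hq
  have hρ0 : 0 ≤ ρ := (norm_nonneg q).trans h1.le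
  obtain ⟨B, hB⟩ := hb
  obtain ⟨C, hC0, hC⟩ := bdd_est ρ hρ0 h2 B
  have := tendsto_tprod_one_add_of_dominated_convergence (𝓕 := 𝓝 q) (g := fun n => (1 - q ^ (n + 1)) ^ b n - 1)
      (f := fun (q : ℂ) (n : ℕ) ↦ (1 - q ^ (n + 1)) ^ b n - 1) (bound := fun n ↦ C * ρ ^ (n + 1)) 
      (geom_summable hρ0 h2 C) ?_ ?_
  · simp only [add_sub_cancel] at this
    exact this
  · intro k
    refine Tendsto.sub ?_ tendsto_const_nhds
    have h3 : ContinuousAt (fun q : ℂ => (1 - q ^ (k + 1)) ^ b k) q := 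
      ContinuousAt.zpow₀ (by fun_prop) _ (Or.inl (one_sub_ne hq k))
    exact h3
  · have : ∀ᶠ x : ℂ in 𝓝 q, ‖x‖ < ρ := continuous_norm.continuousAt.eventually_lt continuousAt_const h1
    filter_upwards [this] with x hx n
    refine (hC _ (hB n) _ (pow_le_rho h2 hx.le n)).trans ?_
    rw [norm_pow]
    gcongr

lemma PP_tail {b : ℕ → ℤ} (hb : Bdd b) (K : ℕ) (hK : ∀ n < K, b n = 0) : 
    ∃ C : ℝ, ∀ q : ℂ, ‖q‖ ≤ 1 / 2 → ‖PP b q - 1‖ ≤ C * ‖q‖ ^ (K + 1) := by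
  have hb' := hb
  obtain ⟨B, hB⟩ := hb
  obtain ⟨C, hC0, hC⟩ := bdd_est (1 / 2) (by norm_num) (by norm_num) B
  refine ⟨2 * C * Real.exp (2 * C), fun q hq => ?_⟩
  have hq1 : ‖q‖ < 1 := by linarith
  have h1 : ∀ t : Finset ℕ, ∑ n ∈ t, ‖(1 - q ^ (n + 1)) ^ b n - 1‖ ≤ 2 * C * ‖q‖ ^ (K + 1) := by
    intro t
    have h2 : ∀ n, ‖(1 - q ^ (n + 1)) ^ b n - 1‖ ≤ C * ‖q‖ ^ (K + 1) * (if n < K then 0 else (1 / 2) ^ (n - K)) := by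
      intro n
      split_ifs with hn
      · rw [hK n hn]; simp
      · refine (hC _ (hB n) _ (pow_le_rho (by norm_num) hq n)).trans ?_
        rw [norm_pow, mul_assoc]
        obtain ⟨j, rfl⟩ := Nat.exists_eq_add_of_le (not_lt.mp hn)
        rw [show K + j + 1 = (K + 1) + j by ring, pow_add, Nat.add_sub_cancel_left]
        gcongr
    have h3 : HasSum (fun n => if n < K then 0 else ((1 : ℝ) / 2) ^ (n - K)) 2 := by
      rw [← hasSum_nat_add_iff' K]
      simp only [Nat.add_sub_cancel, not_lt.mpr (Nat.le_add_left K _), if_false]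
      rw [Finset.sum_eq_zero (fun i hi => by simp [Finset.mem_range.mp hi]), sub_zero]
      exact hasSum_geometric_two
    refine (Finset.sum_le_sum fun n _ => h2 n).trans ?_
    rw [← Finset.mul_sum]
    have h4 := sum_le_hasSum t (fun n _ => by split_ifs <;> positivity) h3
    have h5 : 0 ≤ C * ‖q‖ ^ (K + 1) := by positivity
    nlinarith
  have h2 : ∀ t : Finset ℕ, ‖∏ n ∈ t, (1 - q ^ (n + 1)) ^ b n - 1‖ ≤ 2 * C * Real.exp (2 * C) * ‖q‖ ^ (K + 1) := by
    intro t
    have h3 := t.norm_prod_one_add_sub_one_le (fun n => (1 - q ^ (n + 1)) ^ b n - 1)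
    simp only [add_sub_cancel] at h3
    refine h3.trans ?_
    set S := ∑ n ∈ t, ‖(1 - q ^ (n + 1)) ^ b n - 1‖ with hS
    have hS0 : 0 ≤ S := Finset.sum_nonneg fun n _ => norm_nonneg _
    have hS1 := h1 t
    have hq2 : ‖q‖ ^ (K + 1) ≤ 1 := pow_le_one₀ (norm_nonneg q) hq1.le
    have hS2 : S ≤ 2 * C := by nlinarith
    have h4 : Real.exp S - 1 ≤ S * Real.exp S := by
      have := Real.add_one_le_exp (-S)
      have h5 := Real.exp_pos S
      have h6 : Real.exp (-S) * Real.exp S = 1 := by rw [← Real.exp_add]; simp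
      nlinarith
    refine h4.trans ?_
    calc S * Real.exp S ≤ (2 * C * ‖q‖ ^ (K + 1)) * Real.exp (2 * C) := by gcongr
      _ = _ := by ring
  have h3 := ((PP_mult hb' hq1).hasProd.sub_const 1).norm
  exact le_of_tendsto h3 (Eventually.of_forall h2)

end Part9

section Part10

/-- the variable `q` -/
def qq (z : ℍ) : ℂ := Function.Periodic.qParam 1 z

lemma qq_exp (z : ℍ) : qq z = Complex.exp (2 * (π : ℂ) * Complex.I * (z : ℂ)) := by
  simp [qq, Function.Periodic.qParam]

lemma qq_norm (z : ℍ) : ‖qq z‖ = Real.exp (-(2 * π * z.im)) := by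
  rw [qq_exp, Complex.norm_exp]
  congr 1
  simp

lemma qq_lt (z : ℍ) : ‖qq z‖ < 1 := by
  rw [qq_norm, Real.exp_lt_one_iff]
  have := z.im_pos
  have := Real.pi_pos
  have : 0 < 2 * π * z.im := by positivity
  linarith

lemma qq_ne (z : ℍ) : qq z ≠ 0 := by rw [qq_exp]; exact Complex.exp_ne_zero _

lemma qq_tendsto : Tendsto qq atImInfty (𝓝 0) := by
  have := UpperHalfPlane.qParam_tendsto_atImInfty (h := 1) zero_lt_one
  exact this

lemma qq_cont : Continuous qq := by
  have : qq = fun z : ℍ => Complex.exp (2 * (π : ℂ) * Complex.I * (z : ℂ)) := funext qq_exp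
  rw [this]
  have := UpperHalfPlane.continuous_coe
  fun_prop

lemma hasQ_iff {φ : ℍ → ℂ} {p : PowerSeries ℂ} : HasQ 1 φ p ↔ 
    ∀ z : ℍ, HasSum (fun i => PowerSeries.coeff i p * qq z ^ i) (φ z) := by
  simp [HasQ, qq]

lemma HasQ.tendsto {φ : ℍ → ℂ} {p : PowerSeries ℂ} (h : HasQ 1 φ p) : 
    Tendsto φ atImInfty (𝓝 (PowerSeries.coeff 0 p)) := by
  rw [hasQ_iff] at h
  have e : φ = fun z => ∑' i, PowerSeries.coeff i p * qq z ^ i := funext fun z => (h z).tsum_eq.symm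
  have e2 : PowerSeries.coeff 0 p = ∑' i, PowerSeries.coeff i p * (0 : ℂ) ^ i := by
    rw [tsum_eq_single 0]
    · simp
    · intro b hb; simp [hb]
  rw [e, e2]
  refine tendsto_tsum_of_dominated_convergence (bound := fun i => ‖PowerSeries.coeff i p * qq UpperHalfPlane.I ^ i‖)
    (h UpperHalfPlane.I).summable.norm (fun i => (qq_tendsto.pow i).const_mul _) ?_
  have : ∀ᶠ z : ℍ in atImInfty, 1 ≤ z.im := by
    rw [Filter.Eventually, atImInfty_mem]
    exact ⟨1, fun z hz => hz⟩
  filter_upwards [this] with z hz i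
  rw [norm_mul, norm_mul, norm_pow, norm_pow]
  gcongr
  rw [qq_norm, qq_norm]
  gcongr
  simpa using hz

lemma HasQ.shift {φ : ℍ → ℂ} {p : PowerSeries ℂ} (j : ℕ) (h : HasQ 1 φ (PowerSeries.X ^ j * p)) :
    HasQ 1 (fun z => φ z / qq z ^ j) p := by
  rw [hasQ_iff] at h ⊢
  intro z
  have h1 := h z
  rw [← hasSum_nat_add_iff' j] at h1
  rw [Finset.sum_eq_zero, sub_zero] at h1
  · have h2 := h1.div_const (qq z ^ j)
    refine h2.congr_fun fun i => ?_
    rw [PowerSeries.coeff_X_pow_mul, pow_add]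
    have := qq_ne z
    field_simp
  · intro i hi
    rw [PowerSeries.coeff_X_pow_mul']
    simp [Finset.mem_range.mp hi]

lemma HasQ.dvd_of_bound {φ : ℍ → ℂ} {p : PowerSeries ℂ} (h : HasQ 1 φ p) (m : ℕ) (C : ℝ)
    (hC : ∀ z, ‖qq z‖ ≤ 1 / 2 → ‖φ z‖ ≤ C * ‖qq z‖ ^ m) : PowerSeries.X ^ m ∣ p := by
  suffices H : ∀ j ≤ m, PowerSeries.X ^ j ∣ p from H m le_rfl
  intro j
  induction j with
  | zero => intro _; simp
  | succ j ih =>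
    intro hj
    obtain ⟨p', rfl⟩ := ih (by omega)
    have h1 := h.shift
    have h2 := h1.tendsto
    have hev : ∀ᶠ z : ℍ in atImInfty, ‖qq z‖ ≤ 1 / 2 := by
      have := qq_tendsto.norm
      rw [norm_zero] at this
      exact this.eventually_le_const (by norm_num)
    have h3 : Tendsto (fun z => φ z / qq z ^ j) atImInfty (𝓝 0) := by
      have h4 : Tendsto (fun z => C * ‖qq z‖ ^ (m - j)) atImInfty (𝓝 0) := by
        have := (qq_tendsto.norm.pow (m - j)).const_mul C
        rwa [norm_zero, zero_pow (by omega), mul_zero] at this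
      refine squeeze_zero_norm' ?_ h4
      filter_upwards [hev] with z hz
      have h5 : 0 < ‖qq z‖ := norm_pos_iff.mpr (qq_ne z)
      rw [norm_div, norm_pow, div_le_iff₀ (by positivity), mul_assoc, ← pow_add, Nat.sub_add_cancel (by omega)]
      exact hC z hz
    have h4 := tendsto_nhds_unique h2 h3
    rw [pow_succ]
    refine mul_dvd_mul_left _ ?_
    rw [PowerSeries.X_dvd_iff, ← PowerSeries.coeff_zero_eq_constantCoeff_apply]
    exact h4

/-- exponents of `[r]_l`, one class -/
def clx (l r : ℤ) (n : ℕ) : ℤ := -(if ((n : ℤ) + 1) ≡ r [ZMOD l] then 1 else 0)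

/-- exponents of `[r]_l` -/
def bex (l r : ℤ) : ℕ → ℤ := clx l r + clx l (-r)

lemma clx_bdd (l r : ℤ) : Bdd (clx l r) := ⟨1, fun n => by unfold clx; split_ifs <;> simp⟩

lemma bex_bdd (l r : ℤ) : Bdd (bex l r) := (clx_bdd l r).add (clx_bdd l (-r))

lemma clx_tprod (l r : ℤ) (z : ℍ) : 
    (∏' n : {n : ℤ // 0 < n ∧ n ≡ r [ZMOD l]}, (1 - cexp (2*(π:ℂ)*Complex.I*((n:ℤ):ℂ)*(z:ℂ)))⁻¹) = PP (clx l r) (qq z) := by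
  have hinj : Function.Injective (fun n : {n : ℤ // 0 < n ∧ n ≡ r [ZMOD l]} => ((n : ℤ) - 1).toNat) := by
    rintro ⟨a, ha, ha'⟩ ⟨b, hb, hb'⟩ hab
    simp only at hab
    rw [Subtype.mk.injEq]; omega
  unfold PP
  rw [← hinj.tprod_eq]
  · refine tprod_congr ?_
    rintro ⟨n, hn, hn'⟩
    have e1 : (((n - 1).toNat : ℕ) : ℤ) + 1 = n := by omega
    have e2 : (((n - 1).toNat : ℕ) : ℂ) + 1 = n := by exact_mod_cast e1
    simp only [clx]
    rw [e1, if_pos hn', _root_.zpow_neg_one, qq_exp, ← Complex.exp_nat_mul]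
    congr 3
    push_cast
    rw [e2]
    ring
  · intro n hn
    rw [Function.mem_mulSupport] at hn
    by_cases h : ((n : ℤ) + 1) ≡ r [ZMOD l]
    · exact ⟨⟨(n : ℤ) + 1, by omega, h⟩, by simp⟩
    · simp [clx, h] at hn

lemma rl_eq (l r : ℤ) (z : ℍ) : rl l r z = 
    cexp (2*(π:ℂ)*Complex.I*((-((l:ℝ)*bern ((r:ℝ)/(l:ℝ))/2) : ℝ) : ℂ)*(z:ℂ)) * PP (bex l r) (qq z) := by
  unfold rl
  rw [clx_tprod, clx_tprod, bex, PP_add (clx_bdd _ _) (clx_bdd _ _) (qq_lt z), mul_assoc]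

lemma prod_rl (l : ℤ) (m : ℕ → ℤ) (s : Finset ℕ) (z : ℍ) : 
    ∏ r ∈ s, rl l r z ^ m r = 
    cexp (2*(π:ℂ)*Complex.I*((∑ r ∈ s, m r * (-((l:ℝ)*bern (((r : ℤ):ℝ)/(l:ℝ))/2)) : ℝ) : ℂ)*(z:ℂ)) 
      * PP (∑ r ∈ s, m r • bex l r) (qq z) := by
  rw [PP_sum _ _ (fun i => (bex_bdd _ _).smul _) (qq_lt z)]
  push_cast
  rw [Finset.mul_sum, Finset.sum_mul, Complex.exp_sum, ← Finset.prod_mul_distrib]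
  refine Finset.prod_congr rfl fun r _ => ?_
  rw [rl_eq, mul_zpow, PP_zsmul (bex_bdd _ _) _ (qq_lt z), ← Complex.exp_int_mul]
  congr 2
  push_cast
  ring

end Part10

section Part11

lemma ww_isUnit (n : ℕ) : IsUnit (1 - PowerSeries.X ^ (n + 1) : PowerSeries ℤ) := by
  rw [PowerSeries.isUnit_iff_constantCoeff]
  simp

/-- the unit `1 - X^(n+1)` -/
def ww (n : ℕ) : (PowerSeries ℤ)ˣ := (ww_isUnit n).unit

lemma ww_val (n : ℕ) : ((ww n : (PowerSeries ℤ)ˣ) : PowerSeries ℤ) = 1 - PowerSeries.X ^ (n + 1) := rfl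

/-- truncated products -/
def WK (A : ℕ → ℤ) (K : ℕ) : (PowerSeries ℤ)ˣ := ∏ n ∈ Finset.range K, ww n ^ A n

/-- the base change to complex series -/
abbrev toC : PowerSeries ℤ →+* PowerSeries ℂ := PowerSeries.map (Int.castRingHom ℂ)

lemma hasQ_ww (n : ℕ) : HasQ 1 (fun z => 1 - qq z ^ (n + 1)) (toC (ww n : (PowerSeries ℤ)ˣ)) := by
  have h := (HasQ.one 1).sub (HasQ.qpow 1 (n + 1))
  rw [ww_val, map_sub, map_one, map_pow, PowerSeries.map_X]
  convert h using 1
  ext z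
  simp [qq]

lemma hasQ_ww_inv (n : ℕ) : HasQ 1 (fun z => (1 - qq z ^ (n + 1))⁻¹) (toC ((ww n)⁻¹ : (PowerSeries ℤ)ˣ)) := by
  have h1 : HasQ 1 (fun z => (1 - qq z ^ (n + 1))⁻¹) 
      (PowerSeries.mk fun i => if (n + 1) ∣ i then 1 else 0) := by
    rw [hasQ_iff]
    intro z
    have hinj : Function.Injective (fun i : ℕ => (n + 1) * i) := fun a b hab => by
      simpa using hab
    rw [← hinj.hasSum_iff]
    · have := hasSum_geometric_of_norm_lt_one (ξ := qq z ^ (n + 1)) (by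
        rw [norm_pow]; exact pow_lt_one₀ (norm_nonneg _) (qq_lt z) (Nat.succ_ne_zero n))
      refine this.congr_fun fun i => ?_
      simp [pow_mul]
    · intro i hi
      rw [PowerSeries.coeff_mk, if_neg, zero_mul]
      rintro ⟨k, rfl⟩
      exact hi ⟨k, rfl⟩
  have h2 := (hasQ_ww n).mul h1
  have h3 : ((fun z => 1 - qq z ^ (n + 1)) * (fun z => (1 - qq z ^ (n + 1))⁻¹) : ℍ → ℂ) = 1 := by
    ext z
    simp [mul_inv_cancel₀ (one_sub_ne (qq_lt z) n)]
  rw [h3] at h2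
  have h4 := h2.unique one_pos (HasQ.one 1)
  have h5 : toC ((ww n)⁻¹ : (PowerSeries ℤ)ˣ) * toC (ww n : (PowerSeries ℤ)ˣ) = 1 := by
    rw [← map_mul, Units.inv_mul, map_one]
  rw [left_inv_eq_right_inv h5 h4]
  exact h1

lemma hasQ_ww_zpow (n : ℕ) (a : ℤ) : 
    HasQ 1 (fun z => (1 - qq z ^ (n + 1)) ^ a) (toC ((ww n ^ a : (PowerSeries ℤ)ˣ) : PowerSeries ℤ)) := by
  obtain ⟨m, rfl | rfl⟩ := a.eq_nat_or_neg
  · have := (hasQ_ww n).pow m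
    rw [zpow_natCast, Units.val_pow_eq_pow_val, map_pow]
    convert this using 1
    ext z; simp
  · have := (hasQ_ww_inv n).pow m
    rw [_root_.zpow_neg, zpow_natCast, ← inv_pow, Units.val_pow_eq_pow_val, map_pow]
    convert this using 1
    ext z; simp

lemma hasQ_WK (A : ℕ → ℤ) (K : ℕ) : 
    HasQ 1 (fun z => ∏ n ∈ Finset.range K, (1 - qq z ^ (n + 1)) ^ A n) (toC (WK A K : (PowerSeries ℤ)ˣ)) := by
  induction K with
  | zero =>
    simp only [WK, Finset.prod_range_zero, Units.val_one, map_one]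
    exact HasQ.one 1
  | succ K ih =>
    have := ih.mul (hasQ_ww_zpow K (A K))
    rw [← map_mul, ← Units.val_mul] at this
    simp only [WK, Finset.prod_range_succ] at this ⊢
    exact this

lemma WK_neg (A : ℕ → ℤ) (K : ℕ) : WK (-A) K = (WK A K)⁻¹ := by
  simp [WK, ← Finset.prod_inv_distrib]

lemma PP_split {A : ℕ → ℤ} (hA : Bdd A) (K : ℕ) {q : ℂ} (hq : ‖q‖ < 1) : 
    PP A q = (∏ n ∈ Finset.range K, (1 - q ^ (n + 1)) ^ A n) * PP (fun n => if n < K then 0 else A n) q := by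
  obtain ⟨B, hB⟩ := hA
  have e : A = (fun n => if n < K then A n else 0) + (fun n => if n < K then 0 else A n) := by
    ext n; simp only [Pi.add_apply]; split_ifs <;> simp
  have h1 : Bdd (fun n => if n < K then A n else 0) := ⟨B, fun n => by dsimp only; split_ifs <;> simp [hB]⟩
  have h2 : Bdd (fun n => if n < K then 0 else A n) := ⟨B, fun n => by dsimp only; split_ifs <;> simp [hB]⟩
  conv_lhs => rw [e, PP_add h1 h2 hq]
  congr 1
  unfold PP
  rw [tprod_eq_prod (s := Finset.range K)]
  · refine Finset.prod_congr rfl fun n hn => ?_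
    dsimp only
    rw [if_pos (Finset.mem_range.mp hn)]
  · intro n hn
    rw [Finset.mem_range] at hn
    dsimp only
    rw [if_neg hn, _root_.zpow_zero]

lemma trunc {A : ℕ → ℤ} (hA : Bdd A) {R : PowerSeries ℂ} (hR : HasQ 1 (fun z => PP A (qq z)) R) (K : ℕ) :
    PowerSeries.X ^ (K + 1) ∣ R - toC (WK A K : (PowerSeries ℤ)ˣ) := by
  have h2 : Bdd (fun n => if n < K then 0 else A n) := by
    obtain ⟨B, hB⟩ := hA
    exact ⟨B, fun n => by dsimp only; split_ifs <;> simp [hB]⟩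
  obtain ⟨C, hC⟩ := PP_tail h2 K (fun n hn => if_pos hn)
  have h1 := (hR.mul (hasQ_WK (-A) K)).sub (HasQ.one 1)
  have h3 := h1.dvd_of_bound (K + 1) C ?_
  · rw [WK_neg] at h3
    have h4 := h3.mul_right (toC (WK A K : (PowerSeries ℤ)ˣ))
    rwa [sub_mul, one_mul, mul_assoc, ← map_mul, Units.inv_mul, map_one, mul_one] at h4
  · intro z hz
    have h5 := hC (qq z) hz
    have h6 : ∀ n ∈ Finset.range K, (1 - qq z ^ (n + 1)) ^ A n * (1 - qq z ^ (n + 1)) ^ (-A n) = 1 := by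
      intro n _
      rw [← zpow_add₀ (one_sub_ne (qq_lt z) n)]; simp
    have h7 := Finset.prod_congr rfl h6
    rw [Finset.prod_mul_distrib, Finset.prod_const_one] at h7
    simp only [Pi.sub_apply, Pi.mul_apply, Pi.one_apply, Pi.neg_apply]
    rw [PP_split hA K (qq_lt z)]
    convert h5 using 3
    rw [mul_right_comm, h7, one_mul]

lemma ww_zpow (n : ℕ) (a : ℤ) : 
    PowerSeries.X ^ (n + 2) ∣ ((ww n ^ a : (PowerSeries ℤ)ˣ) : PowerSeries ℤ) - (1 - (a : PowerSeries ℤ) * PowerSeries.X ^ (n + 1)) := by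
  have hX : ∀ b : PowerSeries ℤ, PowerSeries.X ^ (n + 2) ∣ b * PowerSeries.X ^ (n + 1) * PowerSeries.X ^ (n + 1) := by
    intro b
    refine ⟨b * PowerSeries.X ^ n, by ring⟩
  induction a using Int.induction_on with
  | zero => simp
  | succ i ih =>
    rw [_root_.zpow_add_one, Units.val_mul, ww_val]
    have := (ih.mul_right (1 - PowerSeries.X ^ (n + 1))).add (hX i)
    convert this using 1
    push_cast
    ring
  | pred i ih =>
    have e : (ww n) ^ (-(i : ℤ)) = ww n ^ (-(i : ℤ) - 1) * ww n := by rw [_root_.zpow_sub_one]; simp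
    rw [e, Units.val_mul, ww_val] at ih
    rw [← Units.dvd_mul_right (u := ww n), ww_val]
    have := ih.add (hX (i + 1))
    convert this using 1
    push_cast
    ring

lemma const_ww (n : ℕ) : Units.map (PowerSeries.constantCoeff (R := ℤ)).toMonoidHom (ww n) = 1 := by
  ext
  simp [ww_val]

lemma const_WK (A : ℕ → ℤ) (K : ℕ) : PowerSeries.constantCoeff ((WK A K : (PowerSeries ℤ)ˣ) : PowerSeries ℤ) = 1 := by
  have : Units.map (PowerSeries.constantCoeff (R := ℤ)).toMonoidHom (WK A K) = 1 := by
    rw [WK, map_prod]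
    refine Finset.prod_eq_one fun n _ => ?_
    rw [map_zpow, const_ww, _root_.one_zpow]
  have h := congrArg Units.val this
  simpa using h

lemma div_exponents (A : ℕ → ℤ) (P : PowerSeries ℤ) (hP : PowerSeries.constantCoeff P = 1) (N : ℕ) (hN : 0 < N)
    (h : ∀ K, PowerSeries.X ^ (K + 1) ∣ P ^ N - ((WK A K : (PowerSeries ℤ)ˣ) : PowerSeries ℤ)) : ∀ n, (N : ℤ) ∣ A n := by
  intro K
  induction K using Nat.strong_induction_on with
  | _ K ih =>
  have hN' : (N : ℤ) ≠ 0 := by exact_mod_cast hN.ne'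
  set Y := WK (fun n => A n / N) K with hY
  have hYN : Y ^ N = WK A K := by
    rw [hY, WK, WK, ← Finset.prod_pow]
    refine Finset.prod_congr rfl fun n hn => ?_
    rw [← zpow_natCast, ← _root_.zpow_mul, Int.ediv_mul_cancel (ih n (Finset.mem_range.mp hn))]
  set Z := P * ((Y⁻¹ : (PowerSeries ℤ)ˣ) : PowerSeries ℤ) with hZ
  have hZ0 : PowerSeries.constantCoeff Z = 1 := by
    rw [hZ, hY, ← WK_neg, map_mul, hP, const_WK, one_mul]
  have h1 : PowerSeries.X ^ (K + 2) ∣ Z ^ N - ((ww K ^ A K : (PowerSeries ℤ)ˣ) : PowerSeries ℤ) := by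
    have h2 := (h (K + 1)).mul_right (((Y⁻¹ ^ N : (PowerSeries ℤ)ˣ)) : PowerSeries ℤ)
    convert h2 using 1
    have e : WK A (K + 1) * Y⁻¹ ^ N = ww K ^ A K := by
      rw [inv_pow, hYN, WK, WK, Finset.prod_range_succ]
      rw [mul_comm, inv_mul_cancel_left]
    rw [sub_mul, ← Units.val_mul, e, hZ, mul_pow, Units.val_pow_eq_pow_val]
  have h2 := h1.add (ww_zpow K (A K))
  obtain ⟨E, hE⟩ := h2
  have hS : PowerSeries.constantCoeff (∑ i ∈ Finset.range N, Z ^ i) = N := by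
    simp [map_sum, hZ0]
  have h3 : (Z - 1) * (∑ i ∈ Finset.range N, Z ^ i) = PowerSeries.X ^ (K + 1) * (-(A K : PowerSeries ℤ) + PowerSeries.X * E) := by
    rw [mul_geom_sum]
    linear_combination hE
  have h4 : PowerSeries.X ^ (K + 1) ∣ Z - 1 := by
    refine PowerSeries.X_prime.pow_dvd_of_dvd_mul_right (K + 1) ?_ ⟨_, h3⟩
    rw [PowerSeries.X_dvd_iff, hS]
    exact hN'
  obtain ⟨D, hD⟩ := h4
  rw [hD, mul_assoc] at h3
  have h5 := mul_left_cancel₀ (pow_ne_zero _ PowerSeries.X_ne_zero) h3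
  have h6 := congrArg PowerSeries.constantCoeff h5
  rw [map_mul, hS, map_add, map_neg, map_mul, PowerSeries.constantCoeff_X, zero_mul, add_zero, map_intCast] at h6
  refine ⟨-PowerSeries.constantCoeff D, ?_⟩
  simp only [Int.cast_id] at h6
  linear_combination h6

theorem exponents_dvd {f : ℍ → ℂ} (hf : IsModularUnit f) (s : ℚ) (c : ℕ → ℚ) (P : PowerSeries ℂ)
    (hP : ∀ i, PowerSeries.coeff i P = (c i : ℂ)) (hc : c 0 = 1)
    (hq : HasQ 1 (fun z => f z * Complex.exp (-(2 * (π : ℂ) * Complex.I * (s : ℂ) * (z : ℂ)))) P)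
    {N : ℕ} (hN : 0 < N) {A : ℕ → ℤ} (hA : Bdd A) 
    (hPN : HasQ 1 (fun z => PP A (qq z)) (P ^ N)) : ∀ n, (N : ℤ) ∣ A n := by
  have ht := trunc hA hPN
  have hco : P ^ N ∈ II := by
    rw [mem_II]
    intro i
    have := PowerSeries.X_pow_dvd_iff.mp (ht i) i (by omega)
    rw [map_sub, sub_eq_zero] at this
    rw [this, PowerSeries.coeff_map]
    exact isIntegral_algebraMap
  choose y hy using int_coeffs hf s c P hP hq hN hco
  have hPz : P = toC (PowerSeries.mk y) := by
    ext i
    rw [hP, ← hy, PowerSeries.coeff_map, PowerSeries.coeff_mk]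
    simp
  refine div_exponents A (PowerSeries.mk y) ?_ N hN fun K => ?_
  · rw [← PowerSeries.coeff_zero_eq_constantCoeff_apply, PowerSeries.coeff_mk]
    have := hy 0
    rw [hc] at this
    exact_mod_cast this
  · have h1 := ht K
    rw [hPz, ← map_pow, ← map_sub, PowerSeries.X_pow_dvd_iff] at h1
    rw [PowerSeries.X_pow_dvd_iff]
    intro i hi
    have := h1 i hi
    rw [PowerSeries.coeff_map] at this
    exact (Int.castRingHom ℂ).injective_int (by rw [this, map_zero])

end Part11

section Part12

lemma PP_tendsto {A : ℕ → ℤ} (hA : Bdd A) : Tendsto (fun z => PP A (qq z)) atImInfty (𝓝 1) := by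
  have h := (PP_cont hA).continuousAt (Metric.ball_mem_nhds 0 one_pos)
  have h0 : PP A 0 = 1 := by simp [PP]
  have h1 := h.tendsto.comp qq_tendsto
  rw [h0] at h1
  exact h1

/-- points going up the imaginary axis -/
def zpt (k : ℕ) : ℍ := ⟨((k : ℂ) + 1) * Complex.I, by simp; positivity⟩

lemma zpt_tendsto : Tendsto zpt atTop atImInfty := by
  rw [atImInfty, tendsto_comap_iff]
  have : (UpperHalfPlane.im ∘ zpt) = fun k : ℕ => (k : ℝ) + 1 := by
    ext k; simp [zpt, UpperHalfPlane.im]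
  rw [this]
  exact tendsto_atTop_add_const_right _ _ tendsto_natCast_atTop_atTop

lemma exponent_zero {F G : ℍ → ℂ} {a b : ℂ} (ha : a ≠ 0) (hb : b ≠ 0) (hF : Tendsto F atImInfty (𝓝 a))
    (hG : Tendsto G atImInfty (𝓝 b)) (e : ℝ) 
    (h : ∀ z : ℍ, F z = cexp (2 * (π : ℂ) * Complex.I * (e : ℂ) * (z : ℂ)) * G z) : e = 0 := by
  have h1 : Tendsto (fun k => F (zpt k) / G (zpt k)) atTop (𝓝 (a / b)) := 
    (hF.comp zpt_tendsto).div (hG.comp zpt_tendsto) hb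
  have hGne : ∀ᶠ k in atTop, G (zpt k) ≠ 0 := (hG.comp zpt_tendsto).eventually_ne hb
  set x : ℂ := cexp (-(2 * π * e)) with hx
  have hpt : ∀ k : ℕ, cexp (2 * (π : ℂ) * Complex.I * (e : ℂ) * (zpt k : ℂ)) = x ^ (k + 1) := by
    intro k
    rw [hx, ← Complex.exp_nat_mul]
    congr 1
    simp only [zpt]
    push_cast
    linear_combination 2 * (π : ℂ) * e * (k + 1) * Complex.I_sq
  have h2 : Tendsto (fun k : ℕ => x ^ (k + 1)) atTop (𝓝 (a / b)) := by
    refine h1.congr' ?_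
    filter_upwards [hGne] with k hk
    rw [h, hpt]
    field_simp
  have h3 : Tendsto (fun k : ℕ => x ^ (k + 1 + 1)) atTop (𝓝 (a / b)) := (tendsto_add_atTop_iff_nat 1).mpr h2
  have h4 : Tendsto (fun k : ℕ => x ^ (k + 1 + 1)) atTop (𝓝 (a / b * x)) := by
    simp only [pow_succ _ (_ + 1)]
    exact h2.mul_const x
  have h5 := tendsto_nhds_unique h3 h4
  have h6 : x = 1 := by
    have : a / b ≠ 0 := div_ne_zero ha hb
    exact mul_left_cancel₀ this (by rw [← h5, mul_one])
  have h7 : ‖x‖ = 1 := by rw [h6, norm_one]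
  rw [hx, Complex.norm_exp] at h7
  have h8 : (-(2 * π * e) : ℂ).re = -(2 * π * e) := by
    have : (-(2 * π * e) : ℂ) = ((-(2 * π * e) : ℝ) : ℂ) := by push_cast; ring
    rw [this, Complex.ofReal_re]
  rw [h8, Real.exp_eq_one_iff] at h7
  have := Real.pi_pos
  have h9 : π * e = 0 := by linarith
  exact (mul_eq_zero.mp h9).resolve_left this.ne'

lemma unique_root {f φ : ℍ → ℂ} (hfc : Continuous f) (s : ℝ) 
    (hφ : ∀ z : ℍ, φ z = f z * cexp (-(2 * (π : ℂ) * Complex.I * (s : ℂ) * (z : ℂ))))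
    (hφ1 : Tendsto φ atImInfty (𝓝 1)) {N : ℕ} (hN : 0 < N) {B : ℕ → ℤ} (hB : Bdd B) (e : ℝ)
    (h : ∀ z : ℍ, (cexp (2 * (π : ℂ) * Complex.I * (e : ℂ) * (z : ℂ)) * PP B (qq z)) ^ N = f z ^ N) (z : ℍ) : 
    f z = cexp (2 * (π : ℂ) * Complex.I * (e : ℂ) * (z : ℂ)) * PP B (qq z) := by
  set g : ℍ → ℂ := fun z => cexp (2 * (π : ℂ) * Complex.I * (e : ℂ) * (z : ℂ)) * PP B (qq z) with hg
  have hgne : ∀ z, g z ≠ 0 := fun z => mul_ne_zero (Complex.exp_ne_zero _) (PP_ne hB (qq_lt z))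
  have hgc : Continuous g := by
    refine Continuous.mul ?_ ?_
    · have := UpperHalfPlane.continuous_coe
      fun_prop
    · exact (PP_cont hB).comp_continuous qq_cont fun z => by simpa using qq_lt z
  have hc : Continuous (fun z => f z / g z) := hfc.div hgc hgne
  have hroot : ∀ z, (f z / g z) ^ N = 1 := by
    intro z
    rw [div_pow, ← h z]
    exact div_self (pow_ne_zero _ (hgne z))
  have hfin : (Set.range fun z => f z / g z).Finite := by
    have hp : (Polynomial.X ^ N - 1 : Polynomial ℂ) ≠ 0 := Polynomial.X_pow_sub_C_ne_zero hN 1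
    refine (Polynomial.finite_setOfPred_isRoot hp).subset ?_
    rintro _ ⟨z, rfl⟩
    simp [Polynomial.IsRoot, hroot z]
  have hpre : IsPreconnected (Set.range fun z => f z / g z) := isPreconnected_range hc
  have hsub : (Set.range fun z => f z / g z).Subsingleton := by
    by_contra hns
    rw [Set.not_subsingleton_iff] at hns
    exact hpre.infinite_of_nontrivial hns hfin
  set ζ := f UpperHalfPlane.I / g UpperHalfPlane.I with hζ
  have hfζ : ∀ z, f z = ζ * g z := by
    intro z
    rw [← div_eq_iff (hgne z)]
    exact hsub ⟨z, rfl⟩ ⟨_, rfl⟩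
  have hζ0 : ζ ≠ 0 := by
    intro h0
    have := hroot UpperHalfPlane.I
    rw [← hζ, h0, zero_pow hN.ne'] at this
    exact zero_ne_one this
  have hlim : Tendsto (fun z => ζ * PP B (qq z)) atImInfty (𝓝 ζ) := by
    simpa using (PP_tendsto hB).const_mul ζ
  have hrel : ∀ z : ℍ, φ z = cexp (2 * (π : ℂ) * Complex.I * ((e - s : ℝ) : ℂ) * (z : ℂ)) * (ζ * PP B (qq z)) := by
    intro z
    rw [hφ, hfζ, hg]
    have : cexp (2 * (π : ℂ) * Complex.I * ((e - s : ℝ) : ℂ) * (z : ℂ)) = 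
      cexp (2 * (π : ℂ) * Complex.I * (e : ℂ) * (z : ℂ)) * cexp (-(2 * (π : ℂ) * Complex.I * (s : ℂ) * (z : ℂ))) := by
      rw [← Complex.exp_add]; congr 1; push_cast; ring
    rw [this]; ring
  have h0 := exponent_zero one_ne_zero hζ0 hφ1 hlim _ hrel
  have hζ1 : ζ = 1 := by
    refine tendsto_nhds_unique hlim (hφ1.congr fun z => ?_)
    rw [hrel, h0]; simp
  rw [hfζ, hζ1, one_mul]

lemma clx_dist (l r : ℤ) (hl : 0 < l) : clx l r = clx (2 * l) r + clx (2 * l) (r + l) := by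
  ext n
  simp only [clx, Pi.add_apply, Int.modEq_iff_dvd]
  by_cases h : l ∣ r - ((n : ℤ) + 1)
  · obtain ⟨t, ht⟩ := h
    rw [if_pos ⟨t, ht⟩]
    rcases Int.even_or_odd' t with ⟨u, rfl | rfl⟩
    · rw [if_pos ⟨u, by rw [ht]; ring⟩, if_neg]
      · simp
      · rintro ⟨v, hv⟩
        have : l * (2 * (v - u) - 1) = 0 := by linear_combination ht - hv
        rcases mul_eq_zero.mp this with h | h <;> omega
    · rw [if_pos (c := 2 * l ∣ r + l - _) ⟨u + 1, by linear_combination ht⟩, if_neg]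
      · simp
      · rintro ⟨v, hv⟩
        have : l * (2 * (v - u) - 1) = 0 := by linear_combination ht - hv
        rcases mul_eq_zero.mp this with h | h <;> omega
  · rw [if_neg h, if_neg, if_neg]
    · simp
    · rintro ⟨v, hv⟩
      exact h ⟨2 * v - 1, by linear_combination hv⟩
    · rintro ⟨v, hv⟩
      exact h ⟨2 * v, by linear_combination hv⟩

lemma clx_congr (l r r' : ℤ) (h : l ∣ r - r') : clx l r = clx l r' := by
  ext n
  simp only [clx, Int.modEq_iff_dvd]
  have : l ∣ r - ((n : ℤ) + 1) ↔ l ∣ r' - ((n : ℤ) + 1) := by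
    rw [show r - ((n : ℤ) + 1) = (r - r') + (r' - (n + 1)) by ring]
    exact dvd_add_right h
  simp only [this]

lemma bex_dist (l r : ℤ) (hl : 0 < l) : bex l r = bex (2 * l) r + bex (2 * l) (l - r) := by
  unfold bex
  rw [clx_dist l r hl, clx_dist l (-r) hl, clx_congr (2 * l) (r + l) (-(l - r)) ⟨1, by ring⟩,
    show -r + l = l - r by ring]
  abel

lemma bern_eq {x : ℝ} (h0 : 0 ≤ x) (h1 : x < 1) : bern x = x ^ 2 - x + 1 / 6 := by
  rw [bern, Int.fract_eq_self.mpr ⟨h0, h1⟩]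

lemma bern_dist (l r : ℤ) (hr : 0 < r) (hl : r < l) : 
    (l : ℝ) * bern ((r : ℝ) / (l : ℝ)) = ((2 * l : ℤ) : ℝ) * bern ((r : ℝ) / ((2 * l : ℤ) : ℝ)) 
      + ((2 * l : ℤ) : ℝ) * bern (((l - r : ℤ) : ℝ) / ((2 * l : ℤ) : ℝ)) := by
  have hr' : (0 : ℝ) < r := by exact_mod_cast hr
  have hl' : (r : ℝ) < l := by exact_mod_cast hl
  have hl0 : (0 : ℝ) < l := hr'.trans hl'
  push_cast
  rw [bern_eq (by positivity) (by rw [div_lt_one hl0]; exact hl'), 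
    bern_eq (by positivity) (by rw [div_lt_one (by positivity)]; linarith),
    bern_eq (div_nonneg (by linarith) (by positivity)) (by rw [div_lt_one (by positivity)]; linarith)]
  field_simp
  ring

lemma rl_dist (l r : ℤ) (hr : 0 < r) (hl : r < l) (z : ℍ) : 
    rl l r z = rl (2 * l) r z * rl (2 * l) (l - r) z := by
  rw [rl_eq, rl_eq, rl_eq, bex_dist l r (by omega), PP_add (bex_bdd _ _) (bex_bdd _ _) (qq_lt z), bern_dist l r hr hl]
  rw [mul_mul_mul_comm, ← Complex.exp_add]
  congr 2
  push_cast
  ring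

lemma expansion {φ : ℍ → ℂ} (hφ : MDiff φ) (c : ℕ → ℚ) 
    (h : ∀ z : ℍ, φ z = 1 + ∑' n : ℕ, (c n : ℂ) * cexp (2 * (π : ℂ) * Complex.I * ((n : ℂ) + 1) * (z : ℂ))) :
    ∃ (c' : ℕ → ℚ) (P : PowerSeries ℂ), (∀ i, PowerSeries.coeff i P = (c' i : ℂ)) ∧ c' 0 = 1 ∧ HasQ 1 φ P := by
  have hterm : ∀ (z : ℍ) (n : ℕ), cexp (2 * (π : ℂ) * Complex.I * ((n : ℂ) + 1) * (z : ℂ)) = qq z ^ (n + 1) := by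
    intro z n
    rw [qq_exp, ← Complex.exp_nat_mul]
    congr 1; push_cast; ring
  simp only [hterm] at h
  by_cases hs : ∀ z : ℍ, Summable fun n : ℕ => (c n : ℂ) * qq z ^ (n + 1)
  · refine ⟨fun i => if i = 0 then 1 else c (i - 1), 
      PowerSeries.mk fun i => (((if i = 0 then 1 else c (i - 1) : ℚ)) : ℂ), fun i => by simp, by simp, ?_⟩
    rw [hasQ_iff]
    intro z
    rw [← hasSum_nat_add_iff' 1]
    simp only [PowerSeries.coeff_mk, Nat.add_eq_zero_iff, one_ne_zero, and_false, if_false, Nat.add_sub_cancel]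
    have h2 := (hs z).hasSum
    have h3 : φ z - ∑ i ∈ Finset.range 1, (((if i = 0 then 1 else c (i - 1) : ℚ)) : ℂ) * qq z ^ i = ∑' n : ℕ, (c n : ℂ) * qq z ^ (n + 1) := by
      rw [h z]
      simp
    rw [h3]
    exact h2
  · push Not at hs
    obtain ⟨z0, hz0⟩ := hs
    have hone : ∀ z : ℍ, z.im < z0.im → φ z - 1 = 0 := by
      intro z hz
      rw [h z, tsum_eq_zero_of_not_summable, add_zero, sub_self]
      intro hsum
      refine hz0 (Summable.of_norm_bounded hsum.norm fun n => ?_)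
      rw [norm_mul, norm_mul, norm_pow, norm_pow]
      gcongr
      rw [qq_norm, qq_norm]
      gcongr
    have hz : (fun z => φ z - 1) = 0 := by
      let τ : ℍ := ⟨((z0.im / 2 : ℝ) : ℂ) * Complex.I, by
        have := z0.im_pos
        simpa using this⟩
      refine UpperHalfPlane.eq_zero_of_frequently (τ := τ) (hφ.sub mdifferentiable_const) ?_
      have hτ : τ.im < z0.im := by
        have := z0.im_pos
        simp only [τ, UpperHalfPlane.im]
        simp
        exact this
      have hev : ∀ᶠ z : ℍ in 𝓝 τ, z.im < z0.im := 
        UpperHalfPlane.continuous_im.continuousAt.eventually_lt continuousAt_const hτ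
      have hev' : ∀ᶠ z : ℍ in 𝓝[≠] τ, φ z - 1 = 0 := 
        (hev.filter_mono nhdsWithin_le_nhds).mono fun z hz => hone z hz
      exact hev'.frequently
    refine ⟨fun i => if i = 0 then 1 else 0, 1, fun i => ?_, by simp, ?_⟩
    · rw [PowerSeries.coeff_one]; split_ifs with hi <;> simp [hi]
    · have : φ = 1 := by
        ext z
        have := congrFun hz z
        simpa [sub_eq_zero] using this
      rw [this]
      exact HasQ.one 1

end Part12

lemma A_val (l : ℕ) (m : ℕ → ℤ) (j : ℕ) (hj : 1 ≤ j) (hjl : j < l) :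
    (∑ r ∈ Finset.Icc 1 (l / 2), m r • bex l r) (j - 1) = 
      -((if j ∈ Finset.Icc 1 (l / 2) then m j else 0) + (if l - j ∈ Finset.Icc 1 (l / 2) then m (l - j) else 0)) := by
  rw [Finset.sum_apply]
  have key : ∀ r ∈ Finset.Icc 1 (l / 2), (m r • bex l r) (j - 1) = 
      -((if j = r then m r else 0) + (if l - j = r then m r else 0)) := by
    intro r hr
    rw [Finset.mem_Icc] at hr
    have e1 : (((j - 1 : ℕ) : ℤ) + 1 ≡ (r : ℤ) [ZMOD (l : ℤ)]) ↔ j = r := by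
      rw [Int.modEq_iff_dvd]
      constructor
      · rintro ⟨t, ht⟩
        have h1 : (r : ℤ) - j = l * t := by omega
        have h2 : t = 0 := by
          by_contra h0
          rcases lt_or_gt_of_ne h0 with h | h
          · have : (l : ℤ) * t ≤ -l := by nlinarith
            omega
          · have : (l : ℤ) * t ≥ l := by nlinarith
            omega
        rw [h2] at h1; omega
      · rintro rfl
        exact ⟨0, by omega⟩
    have e2 : (((j - 1 : ℕ) : ℤ) + 1 ≡ -(r : ℤ) [ZMOD (l : ℤ)]) ↔ l - j = r := by
      rw [Int.modEq_iff_dvd]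
      constructor
      · rintro ⟨t, ht⟩
        have h1 : -(r : ℤ) - j = l * t := by omega
        have h2 : t = -1 := by
          by_contra h0
          rcases lt_or_gt_of_ne h0 with h | h
          · have : (l : ℤ) * t ≤ l * (-2) := by
              apply mul_le_mul_of_nonneg_left <;> omega
            omega
          · have : (l : ℤ) * t ≥ 0 := by
              apply mul_nonneg <;> omega
            omega
        rw [h2] at h1; omega
      · intro h
        exact ⟨-1, by omega⟩
    simp only [Pi.smul_apply, bex, Pi.add_apply, clx, e1, e2, smul_eq_mul]
    split_ifs <;> ring
  rw [Finset.sum_congr rfl key, Finset.sum_neg_distrib, Finset.sum_add_distrib, Finset.sum_ite_eq, Finset.sum_ite_eq]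

lemma zpow_div_pow (x : ℂ) (N : ℕ) (k : ℤ) (h : (N : ℤ) ∣ k) : (x ^ (k / N)) ^ N = x ^ k := by
  rw [← zpow_natCast, ← _root_.zpow_mul, Int.ediv_mul_cancel h]

lemma rl_ne (l r : ℤ) (z : ℍ) : rl l r z ≠ 0 := by
  rw [rl_eq]
  exact mul_ne_zero (Complex.exp_ne_zero _) (PP_ne (bex_bdd _ _) (qq_lt z))

lemma double_prod (l : ℕ) (hl : 1 ≤ l) (m : ℕ → ℤ) (z : ℍ) : 
    ∏ j ∈ Finset.Icc 1 l, rl ((2 * l : ℕ) : ℤ) j z ^ 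
      ((if j ∈ Finset.Icc 1 (l / 2) then m j else 0) + (if l - j ∈ Finset.Icc 1 (l / 2) then m (l - j) else 0)) = 
    ∏ r ∈ Finset.Icc 1 (l / 2), rl l r z ^ m r := by
  have e : ∏ r ∈ Finset.Icc 1 (l / 2), rl l r z ^ m r = 
      (∏ r ∈ Finset.Icc 1 (l / 2), rl ((2 * l : ℕ) : ℤ) r z ^ m r) * 
      ∏ r ∈ Finset.Icc 1 (l / 2), rl ((2 * l : ℕ) : ℤ) ((l - r : ℕ) : ℤ) z ^ m r := by
    rw [← Finset.prod_mul_distrib]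
    refine Finset.prod_congr rfl fun r hr => ?_
    rw [Finset.mem_Icc] at hr
    rw [← mul_zpow, rl_dist l r (by omega) (by omega)]
    congr 2
    push_cast [Nat.cast_sub (show r ≤ l by omega)]
    rfl
  rw [e]
  simp only [zpow_add₀ (rl_ne _ _ z)]
  rw [Finset.prod_mul_distrib]
  congr 1
  · symm
    have hsub : Finset.Icc 1 (l / 2) ⊆ Finset.Icc 1 l := Finset.Icc_subset_Icc le_rfl (Nat.div_le_self _ _)
    rw [← Finset.prod_subset hsub]
    · refine Finset.prod_congr rfl fun r hr => ?_
      rw [if_pos hr]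
    · intro j _ hj
      rw [if_neg hj, _root_.zpow_zero]
  · have hinj : Set.InjOn (fun r => l - r) (Finset.Icc 1 (l / 2) : Finset ℕ) := by
      intro a ha b hb hab
      simp only [Finset.coe_Icc, Set.mem_Icc] at ha hb hab
      omega
    have hsub : (Finset.Icc 1 (l / 2)).image (fun r => l - r) ⊆ Finset.Icc 1 l := by
      intro j hj
      obtain ⟨r, hr, rfl⟩ := Finset.mem_image.mp hj
      rw [Finset.mem_Icc] at hr ⊢
      omega
    rw [← Finset.prod_subset hsub, Finset.prod_image hinj]
    · refine Finset.prod_congr rfl fun r hr => ?_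
      have hr' := Finset.mem_Icc.mp hr
      have : l - (l - r) = r := by omega
      rw [this, if_pos hr]
    · intro j hj hj'
      rw [if_neg, _root_.zpow_zero]
      intro h
      rw [Finset.mem_Icc] at hj
      exact hj' (Finset.mem_image.mpr ⟨l - j, h, by omega⟩)

/-- Lemma: if a modular unit `f` with rational Fourier coefficients and leading coefficient `1`
(up to a fractional power of `q`) has a positive integral power lying in `E(l)`, then
`f ∈ E(2l)`, and even `f ∈ E(l)` for odd `l`. -/
theorem sl2z_invariant_units_stmt13 (l : ℕ) (hl : 1 ≤ l) (f : UpperHalfPlane → ℂ)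
    (hf : IsModularUnit f)
    (hexp : ∃ (s : ℚ) (c : ℕ → ℚ), ∀ z : UpperHalfPlane,
      f z * Complex.exp (-(2 * (π : ℂ) * Complex.I * (s : ℂ) * (z : ℂ))) =
        1 + ∑' n : ℕ, (c n : ℂ) *
          Complex.exp (2 * (π : ℂ) * Complex.I * ((n : ℂ) + 1) * (z : ℂ)))
    (N : ℕ) (hN : 0 < N) (hfN : MemE l (fun z => f z ^ N)) :
    MemE (2 * l) f ∧ (Odd l → MemE l f) := by

  obtain ⟨s, c, hc⟩ := hexp
  obtain ⟨m, hm⟩ := hfN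
  beta_reduce at hm
  set φ : ℍ → ℂ := fun z => f z * Complex.exp (-(2 * (π : ℂ) * Complex.I * (s : ℂ) * (z : ℂ))) with hφ
  have hφd : MDiff φ := by
    refine hf.1.mul ?_
    have hd : Differentiable ℂ fun w : ℂ => Complex.exp (-(2 * (π : ℂ) * Complex.I * (s : ℂ) * w)) := by
      fun_prop
    exact hd.mdifferentiable.comp UpperHalfPlane.mdifferentiable_coe
  obtain ⟨c', P, hP, hc0, hPq⟩ := expansion hφd c hc
  have hφ1 : Tendsto φ atImInfty (𝓝 1) := by
    have := hPq.tendsto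
    rw [hP, hc0] at this
    simpa using this
  set A : ℕ → ℤ := ∑ r ∈ Finset.Icc 1 (l / 2), m r • bex l r with hA
  have hAb : Bdd A := Bdd.sum _ _ fun r _ => (bex_bdd _ _).smul _
  have hφN : ∀ z, φ z ^ N = PP A (qq z) := by
    set e : ℝ := ∑ r ∈ Finset.Icc 1 (l / 2), m r * (-(((l : ℤ):ℝ)*bern (((r : ℤ):ℝ)/((l : ℤ):ℝ))/2)) with he
    have h1 : ∀ z : ℍ, φ z ^ N = cexp (2 * (π : ℂ) * Complex.I * ((e - N * s : ℝ) : ℂ) * (z : ℂ)) * PP A (qq z) := by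
      intro z
      have h2 := hm z
      rw [prod_rl, ← he, ← hA] at h2
      simp only [hφ]
      rw [mul_pow, h2, ← Complex.exp_nat_mul, mul_right_comm, ← Complex.exp_add]
      congr 2
      push_cast
      ring
    have h2 : Tendsto (fun z => φ z ^ N) atImInfty (𝓝 1) := by simpa using hφ1.pow N
    have h3 := exponent_zero one_ne_zero one_ne_zero h2 (PP_tendsto hAb) _ h1
    intro z
    rw [h1, h3]
    simp
  have hdvd : ∀ n, (N : ℤ) ∣ A n := by
    refine exponents_dvd hf s c' P hP hc0 hPq hN hAb ?_
    have := hPq.pow N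
    convert this using 1
    ext z
    exact (hφN z).symm
  have hroot : ∀ (L : ℤ) (S : Finset ℕ) (k : ℕ → ℤ), (∀ z, (∏ r ∈ S, rl L r z ^ k r) ^ N = f z ^ N) → 
      ∀ z, f z = ∏ r ∈ S, rl L r z ^ k r := by
    intro L S k h z
    rw [prod_rl]
    refine unique_root hf.1.continuous (s : ℝ) (φ := φ) (fun z => by simp [hφ]) hφ1 hN 
      (Bdd.sum _ _ fun r _ => (bex_bdd _ _).smul _) _ (fun z => ?_) z
    rw [← prod_rl]
    exact h z
  have hM : ∀ j, 1 ≤ j → j ≤ l → (N : ℤ) ∣ ((if j ∈ Finset.Icc 1 (l / 2) then m j else 0) + 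
      (if l - j ∈ Finset.Icc 1 (l / 2) then m (l - j) else 0)) := by
    intro j h1 h2
    rcases h2.lt_or_eq with h3 | rfl
    · have := hdvd (j - 1)
      rw [hA, A_val l m j h1 h3, dvd_neg] at this
      exact this
    · rw [if_neg, if_neg]
      · simp
      · simp
      · rw [Finset.mem_Icc]; omega
  refine ⟨⟨fun j => ((if j ∈ Finset.Icc 1 (l / 2) then m j else 0) + 
      (if l - j ∈ Finset.Icc 1 (l / 2) then m (l - j) else 0)) / N, ?_⟩, fun hodd => ⟨fun j => m j / N, ?_⟩⟩
  · rw [Nat.mul_div_cancel_left l two_pos]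
    refine hroot _ _ _ fun z => ?_
    rw [hm z, ← double_prod l hl m z, ← Finset.prod_pow]
    refine Finset.prod_congr rfl fun j hj => ?_
    rw [Finset.mem_Icc] at hj
    exact zpow_div_pow _ _ _ (hM j hj.1 hj.2)
  · refine hroot _ _ _ fun z => ?_
    rw [hm z, ← Finset.prod_pow]
    refine Finset.prod_congr rfl fun j hj => ?_
    refine zpow_div_pow _ _ _ ?_
    have hj' := Finset.mem_Icc.mp hj
    have := hM j hj'.1 (by omega)
    rw [if_pos hj, if_neg, add_zero] at this
    · exact this
    · rw [Finset.mem_Icc]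
      obtain ⟨t, rfl⟩ := hodd
      omega
end
end
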